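/- Fix θ > 0 and an integer m ≥ 1. Let {a(N) ∈ 𝒫_N}_{N≥1} be a regular sequence of ordered tuples with limiting measure μ, and set μ_N := (1/N)∑_{i=1}^N δ_{a(N)_i/N}. Then lim_{N→∞} 𝓑_{a(N)}( y_1/√N, …, y_m/√N; N; θ ) · exp( −√N · 𝔼[μ_N] · ∑_{i=1}^m y_i ) = exp( (Var[μ]/(2θ)) ∑_{i=1}^m y_i² ), and the convergence is uniform for (y_1, …, y_m) in any compact subset of ℂ^m. -/

import Mathlib

open MeasureTheory Filter Topology
open scoped ENNReal

noncomputable section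

/-- A triangular array with `M` levels: for `k : Fin M`, level `k+1` has `k+1` real entries. -/
abbrev Tri (M : ℕ) := ∀ k : Fin M, Fin (k.1 + 1) → ℝ

/-- `Interlaces u v` means `u ≺ v`, i.e. `v 1 > u 1 > v 2 > u 2 > ⋯ > v n > u n > v (n+1)`. -/
def Interlaces {n : ℕ} (u : Fin n → ℝ) (v : Fin (n + 1) → ℝ) : Prop :=
  ∀ i : Fin n, u i < v i.castSucc ∧ v i.succ < u i

/-- Level `k+1` (for `k < N`) of the configuration consisting of the triangular array `x`
(levels `1, …, N-1`) together with the top level `a` (level `N`). -/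
def lvl {N : ℕ} (a : Fin N → ℝ) (x : Tri (N - 1)) (k : ℕ) (hk : k < N) :
    Fin (k + 1) → ℝ :=
  if h : k < N - 1 then fun i => x ⟨k, h⟩ i
  else fun i => a ⟨i.1, by have := i.isLt; omega⟩

/-- The (unnormalized) density of the orbital beta process with top level `a`. -/
def obpWt (θ : ℝ) {N : ℕ} (a : Fin N → ℝ) (x : Tri (N - 1)) : ℝ :=
  ∏ k : Fin (N - 1),
    ((∏ i : Fin (k.1 + 1), ∏ j : Fin (k.1 + 1),
        if i < j then |x k i - x k j| ^ (2 - 2 * θ) else 1) *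
      ∏ s : Fin (k.1 + 2), ∏ r : Fin (k.1 + 1),
        |lvl a x (k.1 + 1) (by have := k.isLt; omega) s - x k r| ^ (θ - 1))

/-- The interlacing scheme `𝒫(a)`: arrays `(a⁽¹⁾ ≺ a⁽²⁾ ≺ ⋯ ≺ a⁽ᴺ⁻¹⁾ ≺ a)`. -/
def obpDomain {N : ℕ} (a : Fin N → ℝ) : Set (Tri (N - 1)) :=
  {x | ∀ k : Fin (N - 1),
      Interlaces (x k) (lvl a x (k.1 + 1) (by have := k.isLt; omega))}

/-- The orbital beta process `𝕄^{a,θ}` with top level `a`. -/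
def obp (θ : ℝ) {N : ℕ} (a : Fin N → ℝ) : Measure (Tri (N - 1)) :=
  (ENNReal.ofReal (∫ x in obpDomain a, obpWt θ a x))⁻¹ •
    volume.withDensity fun x =>
      ENNReal.ofReal ((obpDomain a).indicator (obpWt θ a) x)

/-- The Weyl chamber `𝒲_m = {x : x 0 ≥ x 1 ≥ ⋯}`. -/
def weylChamber (m : ℕ) : Set (Fin m → ℝ) :=
  {x | ∀ i j : Fin m, i ≤ j → x j ≤ x i}

/-- The (unnormalized) density of the Gaussian beta ensemble. -/
def gbeWt (θ : ℝ) (m : ℕ) (x : Fin m → ℝ) : ℝ :=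
  (∏ i : Fin m, ∏ j : Fin m, if i < j then |x i - x j| ^ (2 * θ) else 1) *
    Real.exp (-(θ / 2) * ∑ i, x i ^ 2)

/-- The Gaussian beta ensemble `𝕄^{(θ)}_m` of rank `m`. -/
def gbe (θ : ℝ) (m : ℕ) : Measure (Fin m → ℝ) :=
  (ENNReal.ofReal (∫ x in weylChamber m, gbeWt θ m x))⁻¹ •
    volume.withDensity fun x =>
      ENNReal.ofReal ((weylChamber m).indicator (gbeWt θ m) x)

/-- The empirical measure `μ_N = (1/N) ∑ δ_{a_i/N}`. -/
def empMeasure {N : ℕ} (a : Fin N → ℝ) : Measure ℝ :=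
  ((N : ℝ≥0∞))⁻¹ • ∑ i : Fin N, Measure.dirac (a i / N)

/-- The mean `𝔼[ν]` of a measure on `ℝ`. -/
def meanM (ν : Measure ℝ) : ℝ := ∫ t, t ∂ν

/-- The variance `Var[ν]` of a measure on `ℝ`. -/
def varM (ν : Measure ℝ) : ℝ := (∫ t, t ^ 2 ∂ν) - meanM ν ^ 2

/-- A regular sequence of ordered tuples with limiting measure `μ`. -/
def RegularSeq (a : (N : ℕ) → Fin N → ℝ) (μ : Measure ℝ) : Prop :=
  (∀ N : ℕ, 1 ≤ N → StrictAnti (a N)) ∧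
  (∃ C : ℝ, ∀ N : ℕ, ∀ hN : 1 ≤ N,
      |a N ⟨0, by omega⟩| ≤ C * N ∧ |a N ⟨N - 1, by omega⟩| ≤ C * N) ∧
  IsProbabilityMeasure μ ∧
  (∃ R : ℝ, μ {t : ℝ | |t| ≤ R}ᶜ = 0) ∧
  ∀ f : BoundedContinuousFunction ℝ ℝ,
    Tendsto (fun N : ℕ => ∫ t, f t ∂empMeasure (a N)) atTop (𝓝 (∫ t, f t ∂μ))

/-- Projection of a triangular array (with top level of size `N`) to its `m`-th level. -/
def levelProj {N : ℕ} (m : ℕ) (h1 : 1 ≤ m) (h2 : m < N) (x : Tri (N - 1)) :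
    Fin m → ℝ :=
  fun i => x ⟨m - 1, by omega⟩ ⟨i.1, (by have := i.isLt; omega : i.1 < m - 1 + 1)⟩

/-- Projection of a triangular array to its bottom `m` levels. -/
def triProj {N : ℕ} (m : ℕ) (h : m < N) (x : Tri (N - 1)) : Tri m :=
  fun k i => x ⟨k.1, by have := k.isLt; omega⟩ ⟨i.1, i.isLt⟩

/-- The top level of a triangular array with `m` levels. -/
def topLvl {m : ℕ} (hm : 1 ≤ m) (x : Tri m) : Fin m → ℝ :=
  fun i => x ⟨m - 1, by omega⟩ ⟨i.1, (by have := i.isLt; omega : i.1 < m - 1 + 1)⟩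

/-- The Gelfand–Tsetlin polytope `𝒲_{m,corners}` (weak interlacing). -/
def gtPoly (m : ℕ) : Set (Tri m) :=
  {x | ∀ k : Fin m, ∀ hk : k.1 + 1 < m, ∀ i : Fin (k.1 + 1),
      x k i ≤ x ⟨k.1 + 1, hk⟩ i.castSucc ∧ x ⟨k.1 + 1, hk⟩ i.succ ≤ x k i}

/-- Unnormalized density of the Gaussian beta corners process with `m` levels. -/
def gbcWt (θ : ℝ) {m : ℕ} (hm : 1 ≤ m) (x : Tri m) : ℝ :=
  (∏ i : Fin m, ∏ j : Fin m,
      if i < j then topLvl hm x i - topLvl hm x j else 1) *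
    Real.exp (-(θ / 2) * ∑ i, topLvl hm x i ^ 2) *
    ∏ k : Fin (m - 1),
      ((∏ i : Fin (k.1 + 1), ∏ j : Fin (k.1 + 1),
          if i < j then
            |x ⟨k.1, by have := k.isLt; omega⟩ i -
              x ⟨k.1, by have := k.isLt; omega⟩ j| ^ (2 - 2 * θ)
          else 1) *
        ∏ i : Fin (k.1 + 1), ∏ j : Fin (k.1 + 2),
          |x ⟨k.1, by have := k.isLt; omega⟩ i -
            x ⟨k.1 + 1, by have := k.isLt; omega⟩ j| ^ (θ - 1))

/-- The Gaussian beta corners process `𝕄^{(θ)}_{m,corners}`. -/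
def gbc (θ : ℝ) {m : ℕ} (hm : 1 ≤ m) : Measure (Tri m) :=
  (ENNReal.ofReal (∫ x in gtPoly m, gbcWt θ hm x))⁻¹ •
    volume.withDensity fun x =>
      ENNReal.ofReal ((gtPoly m).indicator (gbcWt θ hm) x)

/-- Strict interlacing domain `x⁽¹⁾ ≺ x⁽²⁾ ≺ ⋯ ≺ x⁽ᵐ⁾` inside `Tri m`. -/
def triDomain (m : ℕ) : Set (Tri m) :=
  {x | ∀ k : Fin m, ∀ hk : k.1 + 1 < m, Interlaces (x k) (x ⟨k.1 + 1, hk⟩)}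

/-- The θ-Gibbs conditional density of the bottom `n` levels given level `n+1`. -/
def gibbsWt (θ : ℝ) (n : ℕ) (x : Tri (n + 1)) : ℝ :=
  ((∏ k : Fin (n + 1), Real.Gamma ((k.1 + 1) * θ)) /
      Real.Gamma θ ^ ((n + 1) * (n + 2) / 2)) *
    (∏ i : Fin (n + 1), ∏ j : Fin (n + 1),
      if i < j then
        (x ⟨n, Nat.lt_succ_self n⟩ i - x ⟨n, Nat.lt_succ_self n⟩ j) ^ (1 - 2 * θ)
      else 1) *
    ∏ k : Fin n,
      ((∏ i : Fin (k.1 + 1), ∏ j : Fin (k.1 + 1),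
          if i < j then
            (x ⟨k.1, by have := k.isLt; omega⟩ i -
              x ⟨k.1, by have := k.isLt; omega⟩ j) ^ (2 - 2 * θ)
          else 1) *
        ∏ i : Fin (k.1 + 1), ∏ j : Fin (k.1 + 2),
          |x ⟨k.1, by have := k.isLt; omega⟩ i -
            x ⟨k.1 + 1, by have := k.isLt; omega⟩ j| ^ (θ - 1))

/-- `|a⁽ᵏ⁾|`, the sum of the entries of level `k` (with `a⁽⁰⁾ := 0` and `a⁽ᴺ⁾ := a`). -/
def sumLvl {N : ℕ} (a : Fin N → ℝ) (x : Tri (N - 1)) (k : ℕ) : ℝ :=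
  if k = 0 then 0
  else if h : k - 1 < N - 1 then ∑ i, x ⟨k - 1, h⟩ i
  else ∑ i, a i

/-- The multivariate Bessel function `𝓑_a(y; θ)`, defined through its combinatorial
integral representation over the interlacing scheme with top level `a`. -/
def MBF (θ : ℝ) {N : ℕ} (a : Fin N → ℝ) (y : Fin N → ℂ) : ℂ :=
  ((((∏ k : Fin N, Real.Gamma ((k.1 + 1) * θ)) /
        Real.Gamma θ ^ (N * (N + 1) / 2)) : ℝ) : ℂ) *
    (((∏ i : Fin N, ∏ j : Fin N,
        if i < j then |a i - a j| ^ (1 - 2 * θ) else 1) : ℝ) : ℂ) *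
    ∫ x in obpDomain a,
      Complex.exp (∑ k : Fin N,
        y k * ((sumLvl a x (k.1 + 1) - sumLvl a x k.1 : ℝ) : ℂ)) *
      ((obpWt θ a x : ℝ) : ℂ)

/-- Padding of an `m`-tuple with `N - m` zeros: `(y_1, …, y_m, 0^{N-m})`. -/
def padC {m N : ℕ} (_h : m ≤ N) (y : Fin m → ℂ) : Fin N → ℂ :=
  fun k => if h' : k.1 < m then y ⟨k.1, h'⟩ else 0

/-- Integrand `exp(yz) ∏ (z - a_i)^{-θ}` of the left-directed contour integral,
with `w^{-θ} := exp(-θ Log w)` for the principal branch `Log`. -/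
def contourFnL (θ : ℝ) {N : ℕ} (a : Fin N → ℝ) (y z : ℂ) : ℂ :=
  Complex.exp (y * z) *
    ∏ i : Fin N, Complex.exp (-(θ : ℂ) * Complex.log (z - (a i : ℂ)))

/-- Integrand `exp(-yz) ∏ (a_i - z)^{-θ}` of the right-directed contour integral. -/
def contourFnR (θ : ℝ) {N : ℕ} (a : Fin N → ℝ) (y z : ℂ) : ℂ :=
  Complex.exp (-y * z) *
    ∏ i : Fin N, Complex.exp (-(θ : ℂ) * Complex.log ((a i : ℂ) - z))

/-- `(y_1, …, y_m, y_{m+1})` with `y_{m+1} := y - (z_1 + ⋯ + z_m)`. -/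
def Yext {m : ℕ} (ys : Fin m → ℝ) (y : ℝ) (z : Fin m → ℝ) : Fin (m + 1) → ℝ :=
  fun j => if h : j.1 < m then ys ⟨j.1, h⟩ else y - ∑ i, z i

/-- `(z_1, …, z_m, z_{m+1})` with `z_{m+1} := 0`. -/
def Zext {m : ℕ} (z : Fin m → ℝ) : Fin (m + 1) → ℝ :=
  fun j => if h : j.1 < m then z ⟨j.1, h⟩ else 0

/-- The function `G_{θ, y_1, …, y_m, y}(z_1, …, z_m)`. -/
def Gfn (θ : ℝ) {m : ℕ} (ys : Fin m → ℝ) (y : ℝ) (z : Fin m → ℝ) : ℝ :=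
  (∏ i : Fin m, ∏ j : Fin m,
      if i < j then (ys i - ys j + z i) ^ (θ - 1) else 1) *
    ∏ i : Fin (m + 1), ∏ j : Fin (m + 1),
      if i < j then
        (Yext ys y z i - Yext ys y z j + Zext z i - Zext z j) *
          (Yext ys y z i - Yext ys y z j - Zext z j) ^ (θ - 1)
      else 1

/-- The function `F_{y_1, …, y_m, y}(z_1, …, z_m)`. -/
def Ffn {m : ℕ} (ys : Fin m → ℝ) (y : ℝ) (z : Fin m → ℝ) : ℝ :=
  (1 - (∑ i, z i) / y) * ∏ i, (1 + z i / ys i)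

set_option linter.unusedSectionVars false
set_option linter.unusedSimpArgs false

section ElementarySymmetric

open Finset

variable {A ι : Type*} [CommRing A] [DecidableEq ι]

/-- The `k`-th elementary symmetric polynomial in the values `v i`, `i ∈ T`. -/
def es (v : ι → A) (T : Finset ι) (k : ℕ) : A :=
  ∑ t ∈ T.powersetCard k, ∏ i ∈ t, v i

theorem es_zero (v : ι → A) (T : Finset ι) : es v T 0 = 1 := by
  simp [es]

theorem es_eq_zero (v : ι → A) {T : Finset ι} {k : ℕ} (h : #T < k) : es v T k = 0 := by
  simp [es, powersetCard_eq_empty.2 h]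

theorem es_insert (v : ι → A) {T : Finset ι} {l : ι} (hl : l ∉ T) (k : ℕ) :
    es v (insert l T) (k + 1) = es v T (k + 1) + v l * es v T k := by
  unfold es
  rw [powersetCard_succ_insert hl, sum_union, sum_image, mul_sum]
  · congr 1
    refine sum_congr rfl fun t ht => ?_
    rw [prod_insert]
    exact fun h => hl ((mem_powersetCard.1 ht).1 h)
  · intro s hs t ht h
    have h1 : l ∉ s := fun h => hl ((mem_powersetCard.1 hs).1 h)
    have h2 : l ∉ t := fun h => hl ((mem_powersetCard.1 ht).1 h)
    rw [← erase_insert h1, ← erase_insert h2, h]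
  · rw [disjoint_left]
    intro t ht ht'
    obtain ⟨u, _, rfl⟩ := mem_image.1 ht'
    exact hl ((mem_powersetCard.1 ht).1 (mem_insert_self _ _))

theorem es_succ_erase (v : ι → A) {T : Finset ι} {l : ι} (hl : l ∈ T) (k : ℕ) :
    es v T (k + 1) = es v (T.erase l) (k + 1) + v l * es v (T.erase l) k := by
  conv_lhs => rw [← insert_erase hl]
  exact es_insert v (notMem_erase l T) k

theorem sum_es_erase (v : ι → A) (T : Finset ι) (k : ℕ) :
    ∑ l ∈ T, es v (T.erase l) k = ((#T : A) - k) * es v T k := by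
  have : ∑ l ∈ T, es v (T.erase l) k
      = ∑ t ∈ T.powersetCard k, ∑ l ∈ T \ t, ∏ i ∈ t, v i := by
    unfold es
    refine sum_comm' fun l t => ?_
    simp only [mem_powersetCard, subset_erase, Finset.mem_sdiff]
    tauto
  rw [this, es, mul_sum]
  refine sum_congr rfl fun t ht => ?_
  obtain ⟨h1, h2⟩ := mem_powersetCard.1 ht
  rw [sum_const, card_sdiff_of_subset h1, h2, nsmul_eq_mul, Nat.cast_sub (h2 ▸ card_le_card h1)]

variable [Fintype ι]

/-- `es` over all indices but `i`. -/
def es1 (v : ι → A) (i : ι) (k : ℕ) : A := es v (univ.erase i) k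

/-- `es` over all indices but `i` and `l`. -/
def es2 (v : ι → A) (i l : ι) (k : ℕ) : A := es v ((univ.erase i).erase l) k

/-- `es` over all indices but `i`, `l` and `j`. -/
def es3 (v : ι → A) (i l j : ι) (k : ℕ) : A := es v (((univ.erase i).erase l).erase j) k

theorem es2_comm (v : ι → A) (i l : ι) (k : ℕ) : es2 v i l k = es2 v l i k := by
  rw [es2, es2, erase_right_comm]

theorem es3_comm (v : ι → A) (i l j : ι) (k : ℕ) : es3 v i l j k = es3 v i j l k := by
  rw [es3, es3, erase_right_comm]

theorem es_univ_succ (v : ι → A) (i : ι) (k : ℕ) :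
    es v univ (k + 1) = es1 v i (k + 1) + v i * es1 v i k :=
  es_succ_erase v (mem_univ i) k

theorem es1_succ (v : ι → A) {i l : ι} (h : l ≠ i) (k : ℕ) :
    es1 v i (k + 1) = es2 v i l (k + 1) + v l * es2 v i l k :=
  es_succ_erase v (mem_erase.2 ⟨h, mem_univ l⟩) k

theorem es2_succ (v : ι → A) {i l j : ι} (h : j ≠ i) (h' : j ≠ l) (k : ℕ) :
    es2 v i l (k + 1) = es3 v i l j (k + 1) + v j * es3 v i l j k :=
  es_succ_erase v (mem_erase.2 ⟨h', mem_erase.2 ⟨h, mem_univ j⟩⟩) k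

theorem card_pos_of_mem (i : ι) : 1 ≤ Fintype.card ι := Fintype.card_pos_iff.2 ⟨i⟩

theorem sum_es1 (v : ι → A) (k : ℕ) :
    ∑ i, es1 v i k = ((Fintype.card ι : A) - k) * es v univ k :=
  sum_es_erase v univ k

theorem sum_es2 (v : ι → A) (i : ι) (k : ℕ) :
    ∑ l ∈ univ.erase i, es2 v i l k = ((Fintype.card ι : A) - 1 - k) * es1 v i k := by
  have := sum_es_erase v (univ.erase i) k
  rw [card_erase_of_mem (mem_univ i), card_univ, Nat.cast_sub (card_pos_of_mem i)] at this
  simp only [Nat.cast_one] at this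
  exact this

theorem sum_es3 (v : ι → A) {i l : ι} (h : l ≠ i) (k : ℕ) :
    ∑ j ∈ (univ.erase i).erase l, es3 v i l j k
      = ((Fintype.card ι : A) - 2 - k) * es2 v i l k := by
  have h1 := card_erase_add_one (mem_erase.2 ⟨h, mem_univ l⟩ : l ∈ univ.erase i)
  have h2 := card_erase_add_one (mem_univ i)
  have h3 : (Fintype.card ι : A) - 2 = #((univ.erase i).erase l) := by
    rw [← card_univ, ← h2, ← h1]; push_cast; ring
  rw [h3]
  exact sum_es_erase v _ k

theorem es1_sub_es1 (v : ι → A) {i l : ι} (h : l ≠ i) (k : ℕ) :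
    es1 v i (k + 1) - es1 v l (k + 1) = (v l - v i) * es2 v i l k := by
  rw [es1_succ v h, es1_succ v h.symm, es2_comm v l i, es2_comm v l i]; ring

/-- The universal quadratic expressions `∑ⱼ e_p(a∖j) e_q(a∖j)` in the elementary symmetric
polynomials `u k = e_k(a)` of `n` variables. -/
def gq (n : A) (u : ℕ → A) : ℕ → ℕ → A
  | 0, q => (n - q) * u 0 * u q
  | p + 1, q => gq n u p (q + 1) - (n - p) * u p * u (q + 1) + (n - q) * u (p + 1) * u q

theorem eq_gq {n : A} {u : ℕ → A} {R : ℕ → ℕ → A} (h0 : ∀ q, R 0 q = (n - q) * u 0 * u q)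
    (hs : ∀ p q, R p (q + 1) - R (p + 1) q
      = (n - p) * u p * u (q + 1) - (n - q) * u (p + 1) * u q) (p q : ℕ) :
    R p q = gq n u p q := by
  induction p generalizing q with
  | zero => exact h0 q
  | succ p ih =>
    rw [gq, ← ih]
    linear_combination -hs p q

theorem sum_es1_mul_es1 (v : ι → A) (p q : ℕ) :
    ∑ l, es1 v l p * es1 v l q = gq (Fintype.card ι : A) (es v univ) p q := by
  refine eq_gq (R := fun p q => ∑ l, es1 v l p * es1 v l q) (fun q => ?_) (fun p q => ?_) p q
  · simp only [es1, es_zero, one_mul, mul_one]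
    exact sum_es1 v q
  · have h1 := sum_es1 v p
    have h2 := sum_es1 v q
    rw [mul_right_comm (_ - _) (es v univ (p + 1)), ← h1, ← h2, sum_mul, sum_mul, ← sum_sub_distrib, ← sum_sub_distrib]
    refine sum_congr rfl fun l _ => ?_
    have h3 := es_univ_succ v l p
    have h4 := es_univ_succ v l q
    linear_combination -es1 v l p * h4 + es1 v l q * h3

/-- The weighted sum `∑ᵢ γᵢ e_k(b∖i)`. -/
def eh (v γ : ι → A) (k : ℕ) : A := ∑ i, γ i * es1 v i k

/-- The coefficient of `γᵢ γⱼ` in the carré du champ of weighted sums. -/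
def cdcCoeff (v : ι → A) (p q : ℕ) (i j : ι) : A :=
  ∑ l ∈ (univ.erase i).erase j, es2 v i l p * es2 v j l q
    + if i = j then 0 else es2 v i j p * es2 v i j q

theorem cdcCoeff_zero (v : ι → A) (q : ℕ) (i j : ι) :
    cdcCoeff v 0 q i j = ((Fintype.card ι : A) - 1 - q) * es1 v j q := by
  rw [← sum_es2, cdcCoeff]
  have : ∀ i l : ι, es2 v i l 0 = 1 := fun i l => es_zero _ _
  simp only [this, one_mul]
  split_ifs with h
  · subst h; simp
  · rw [es2_comm v i j, add_comm, erase_right_comm, ← add_sum_erase _ _ (mem_erase.2 ⟨h, mem_univ i⟩)]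

theorem cdcCoeff_succ (v : ι → A) (p q : ℕ) (i j : ι) :
    cdcCoeff v p (q + 1) i j - cdcCoeff v (p + 1) q i j
      = ((Fintype.card ι : A) - 1 - p) * es1 v i p * es1 v j (q + 1)
        - ((Fintype.card ι : A) - 1 - q) * es1 v i (p + 1) * es1 v j q
        + (if i = j then 0 else (v j - v i) * es2 v i j p * es2 v i j q) := by
  have key : ∑ l ∈ (univ.erase i).erase j, es2 v i l p * es2 v j l (q + 1)
      - ∑ l ∈ (univ.erase i).erase j, es2 v i l (p + 1) * es2 v j l q
      = (∑ l ∈ (univ.erase i).erase j, es2 v i l p) * es1 v j (q + 1)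
        - (∑ l ∈ (univ.erase i).erase j, es2 v j l q) * es1 v i (p + 1) := by
    rw [sum_mul, sum_mul, ← sum_sub_distrib, ← sum_sub_distrib]
    refine sum_congr rfl fun l hl => ?_
    simp only [mem_erase, mem_univ, and_true] at hl
    have h1 := es1_succ v hl.2 p
    have h2 := es1_succ v hl.1 q
    linear_combination -es2 v i l p * h2 + es2 v j l q * h1
  have e1 := sum_es2 v i p
  have e2 := sum_es2 v j q
  unfold cdcCoeff
  by_cases h : i = j
  · subst h
    simp only [erase_idem, if_true, add_zero] at key ⊢
    rw [key, e1, e2]; ring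
  · simp only [h, if_false]
    have hj : j ∈ univ.erase i := mem_erase.2 ⟨Ne.symm h, mem_univ j⟩
    have hi : i ∈ univ.erase j := mem_erase.2 ⟨h, mem_univ i⟩
    rw [← add_sum_erase _ _ hj] at e1
    rw [← add_sum_erase _ _ hi, erase_right_comm, es2_comm v j i] at e2
    have f1 := es1_succ v (Ne.symm h) p
    have f2 := es1_succ v h q
    rw [es2_comm v j i, es2_comm v j i] at f2
    linear_combination key + es1 v j (q + 1) * e1 - es1 v i (p + 1) * e2
      - es2 v i j p * f2 + es2 v i j q * f1

theorem mul_eh_mul_eh (v γ : ι → A) (c : A) (p q : ℕ) :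
    c * eh v γ p * eh v γ q = ∑ i, ∑ j, γ i * γ j * (c * es1 v i p * es1 v j q) := by
  rw [mul_assoc, eh, eh, sum_mul_sum, mul_sum]
  refine sum_congr rfl fun i _ => ?_
  rw [mul_sum]
  refine sum_congr rfl fun j _ => ?_
  ring

theorem sum_cdcCoeff (v γ : ι → A) (p q : ℕ) :
    ∑ i, ∑ j, γ i * γ j * cdcCoeff v p q i j = gq ((Fintype.card ι : A) - 1) (eh v γ) p q := by
  refine eq_gq (R := fun p q => ∑ i, ∑ j, γ i * γ j * cdcCoeff v p q i j)
    (fun q => ?_) (fun p q => ?_) p q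
  · rw [mul_eh_mul_eh]
    refine sum_congr rfl fun i _ => sum_congr rfl fun j _ => ?_
    have : es1 v i 0 = 1 := es_zero _ _
    rw [this, cdcCoeff_zero]; ring
  · have anti : ∑ i, ∑ j, γ i * γ j *
        (if i = j then 0 else (v j - v i) * es2 v i j p * es2 v i j q)
        = ∑ i, ∑ j, γ i * γ j * (if i = j then 0 else v j * es2 v i j p * es2 v i j q)
        - ∑ i, ∑ j, γ i * γ j * (if i = j then 0 else v i * es2 v i j p * es2 v i j q) := by
      simp only [← sum_sub_distrib]
      refine sum_congr rfl fun i _ => sum_congr rfl fun j _ => ?_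
      split_ifs <;> ring
    have swap : ∑ i, ∑ j, γ i * γ j * (if i = j then 0 else v j * es2 v i j p * es2 v i j q)
        = ∑ i, ∑ j, γ i * γ j * (if i = j then 0 else v i * es2 v i j p * es2 v i j q) := by
      rw [sum_comm]
      refine sum_congr rfl fun i _ => sum_congr rfl fun j _ => ?_
      rw [es2_comm v j i, es2_comm v j i]
      simp only [eq_comm (a := j)]
      ring
    rw [swap, sub_self] at anti
    rw [mul_eh_mul_eh, mul_eh_mul_eh, ← sub_zero (_ - _ : A), ← anti]
    simp only [← sum_sub_distrib, ← sum_add_distrib]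
    refine sum_congr rfl fun i _ => sum_congr rfl fun j _ => ?_
    linear_combination γ i * γ j * cdcCoeff_succ v p q i j

end ElementarySymmetric

section GammaFunctional

open MvPolynomial

variable {ι : Type*} [Fintype ι] [DecidableEq ι]

/-- The rising factorial `x (x + 1) ⋯ (x + k - 1)`. -/
def rf (x : ℝ) (k : ℕ) : ℝ := ∏ i ∈ Finset.range k, (x + i)

theorem rf_zero (x : ℝ) : rf x 0 = 1 := by simp [rf]

theorem rf_succ (x : ℝ) (k : ℕ) : rf x (k + 1) = rf x k * (x + k) := by
  simp [rf, Finset.prod_range_succ]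

theorem rf_pos {x : ℝ} (hx : 0 < x) (k : ℕ) : 0 < rf x k :=
  Finset.prod_pos fun i _ => by positivity

/-- Formal expectation over independent `Gamma(θ)` variables, represented by the left
variables; the right variables are kept. -/
def gE (θ : ℝ) : MvPolynomial (ι ⊕ ι) ℂ →ₗ[ℂ] MvPolynomial ι ℂ :=
  (basisMonomials (ι ⊕ ι) ℂ).constr ℂ fun α =>
    C ((∏ i, rf θ (α (Sum.inl i)) : ℝ) : ℂ) * ∏ i, X i ^ α (Sum.inr i)

theorem gE_monomial (θ : ℝ) (α : ι ⊕ ι →₀ ℕ) (c : ℂ) :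
    gE θ (monomial α c)
      = C c * (C ((∏ i, rf θ (α (Sum.inl i)) : ℝ) : ℂ) * ∏ i, X i ^ α (Sum.inr i)) := by
  have h : monomial α c = c • basisMonomials (ι ⊕ ι) ℂ α := by
    simp [smul_monomial]
  rw [h, map_smul, gE, Module.Basis.constr_basis, smul_eq_C_mul]

theorem gE_X_inr_mul (θ : ℝ) (i : ι) (φ : MvPolynomial (ι ⊕ ι) ℂ) :
    gE θ (X (Sum.inr i) * φ) = X i * gE θ φ := by
  induction φ using MvPolynomial.induction_on' with
  | monomial α c =>
    rw [X, monomial_mul, gE_monomial, gE_monomial]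
    have h1 : ∀ j, (Finsupp.single (Sum.inr i : ι ⊕ ι) 1 + α : ι ⊕ ι →₀ ℕ) (Sum.inl j) = α (Sum.inl j) := by
      intro j; simp
    have h2 : ∏ j, (X j : MvPolynomial ι ℂ) ^
        (Finsupp.single (Sum.inr i : ι ⊕ ι) 1 + α : ι ⊕ ι →₀ ℕ) (Sum.inr j)
        = X i * ∏ j, X j ^ α (Sum.inr j) := by
      simp only [Finsupp.add_apply, pow_add, Finset.prod_mul_distrib]
      congr 1
      rw [Finset.prod_eq_single i]
      · simp
      · intro j _ hj
        rw [Finsupp.single_apply, if_neg (by simpa using hj.symm), pow_zero]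
      · simp
    simp only [h1, h2, one_mul]
    ring
  | add p q hp hq => rw [mul_add, map_add, map_add, hp, hq, mul_add]

theorem gE_X_inl_mul (θ : ℝ) (i : ι) (φ : MvPolynomial (ι ⊕ ι) ℂ) :
    gE θ (X (Sum.inl i) * φ)
      = (θ : ℂ) • gE θ φ + gE θ (X (Sum.inl i) * pderiv (Sum.inl i) φ) := by
  induction φ using MvPolynomial.induction_on' with
  | monomial α c =>
    have h3 : X (Sum.inl i) * pderiv (Sum.inl i) (monomial α c)
        = ((α (Sum.inl i) : ℂ)) • monomial α c := by
      rw [pderiv_monomial, X, monomial_mul, smul_monomial]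
      rcases Nat.eq_zero_or_pos (α (Sum.inl i)) with h | h
      · simp [h]
      · congr 1
        · congr 1
          ext j
          by_cases hj : j = Sum.inl i
          · subst hj; simp; omega
          · simp [Finsupp.single_apply, Ne.symm hj]
        · simp [mul_comm]
    rw [h3, X, monomial_mul, map_smul, gE_monomial, gE_monomial]
    have h1 : ∀ j, (Finsupp.single (Sum.inl i : ι ⊕ ι) 1 + α : ι ⊕ ι →₀ ℕ) (Sum.inr j) = α (Sum.inr j) := by
      intro j; simp
    have h2 : ∏ j, rf θ ((Finsupp.single (Sum.inl i : ι ⊕ ι) 1 + α : ι ⊕ ι →₀ ℕ) (Sum.inl j))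
        = (θ + α (Sum.inl i)) * ∏ j, rf θ (α (Sum.inl j)) := by
      rw [← Finset.mul_prod_erase _ _ (Finset.mem_univ i),
        ← Finset.mul_prod_erase Finset.univ (fun j => rf θ (α (Sum.inl j))) (Finset.mem_univ i),
        ← mul_assoc]
      congr 1
      · simp only [Finsupp.add_apply, Finsupp.single_eq_same, add_comm 1, rf_succ]
        ring
      · refine Finset.prod_congr rfl fun j hj => ?_
        have : i ≠ j := (Finset.ne_of_mem_erase hj).symm
        simp [Finsupp.single_apply, this]
    simp only [h1, h2, one_mul, smul_eq_C_mul]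
    push_cast
    simp only [C_mul, C_add]
    ring
  | add p q hp hq =>
    rw [mul_add, map_add, map_add, hp, hq, map_add, mul_add, map_add, smul_add]; abel

theorem pderiv_gE (θ : ℝ) (l : ι) (φ : MvPolynomial (ι ⊕ ι) ℂ) :
    pderiv l (gE θ φ) = gE θ (pderiv (Sum.inr l) φ) := by
  induction φ using MvPolynomial.induction_on' with
  | monomial α c =>
    rw [pderiv_monomial, gE_monomial, gE_monomial]
    have h1 : ∀ j, (α - Finsupp.single (Sum.inr l : ι ⊕ ι) 1 : ι ⊕ ι →₀ ℕ) (Sum.inl j) = α (Sum.inl j) := by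
      intro j; simp
    have h2 : pderiv l (∏ j, (X j : MvPolynomial ι ℂ) ^ α (Sum.inr j))
        = C (α (Sum.inr l) : ℂ) *
          ∏ j, X j ^ (α - Finsupp.single (Sum.inr l : ι ⊕ ι) 1 : ι ⊕ ι →₀ ℕ) (Sum.inr j) := by
      rw [← Finset.mul_prod_erase _ _ (Finset.mem_univ l),
        ← Finset.mul_prod_erase Finset.univ
          (fun j => (X j : MvPolynomial ι ℂ) ^
            (α - Finsupp.single (Sum.inr l : ι ⊕ ι) 1 : ι ⊕ ι →₀ ℕ) (Sum.inr j)) (Finset.mem_univ l)]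
      have h3 : pderiv l (∏ j ∈ Finset.univ.erase l, (X j : MvPolynomial ι ℂ) ^ α (Sum.inr j))
          = 0 := by
        refine Finset.prod_induction _ (fun p : MvPolynomial ι ℂ => pderiv l p = 0)
          (fun p q hp hq => ?_) (by simp) fun j hj => ?_
        · rw [Derivation.leibniz, hp, hq]; simp
        rw [Derivation.leibniz_pow, pderiv_X_of_ne (Finset.ne_of_mem_erase hj)]
        simp
      have h4 : ∏ j ∈ Finset.univ.erase l, (X j : MvPolynomial ι ℂ) ^
            (α - Finsupp.single (Sum.inr l : ι ⊕ ι) 1 : ι ⊕ ι →₀ ℕ) (Sum.inr j)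
          = ∏ j ∈ Finset.univ.erase l, (X j : MvPolynomial ι ℂ) ^ α (Sum.inr j) := by
        refine Finset.prod_congr rfl fun j hj => ?_
        have : l ≠ j := (Finset.ne_of_mem_erase hj).symm
        simp [Finsupp.single_apply, this]
      rw [h4, Derivation.leibniz, h3, Derivation.leibniz_pow, pderiv_X_self]
      simp
      ring
    rw [Derivation.leibniz, Derivation.leibniz, pderiv_C, pderiv_C, h2]
    simp only [h1, smul_eq_mul, mul_zero, add_zero, C_mul]
    ring
  | add p q hp hq => simp only [map_add, hp, hq]

theorem gE_X_sub_X (θ : ℝ) (k l : ι) (φ : MvPolynomial (ι ⊕ ι) ℂ) :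
    (θ : ℂ) • gE θ ((X (Sum.inl k) - X (Sum.inl l)) * φ)
      = gE θ (X (Sum.inl k) * X (Sum.inl l) *
          (pderiv (Sum.inl k) φ - pderiv (Sum.inl l) φ)) := by
  by_cases h : k = l
  · subst h; simp
  have h1 := gE_X_inl_mul θ k (X (Sum.inl l) * φ)
  have h2 := gE_X_inl_mul θ l (X (Sum.inl k) * φ)
  have hkl : (Sum.inl l : ι ⊕ ι) ≠ Sum.inl k := by simpa using Ne.symm h
  rw [Derivation.leibniz, pderiv_X_of_ne hkl, smul_zero, add_zero, smul_eq_mul] at h1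
  rw [Derivation.leibniz, pderiv_X_of_ne hkl.symm, smul_zero, add_zero, smul_eq_mul] at h2
  rw [mul_sub, map_sub, sub_mul, map_sub, smul_sub]
  have e1 : (X (Sum.inl k) * (X (Sum.inl l) * φ) : MvPolynomial (ι ⊕ ι) ℂ)
      = X (Sum.inl l) * (X (Sum.inl k) * φ) := by ring
  have e2 : (X (Sum.inl k) * X (Sum.inl l) * pderiv (Sum.inl k) φ : MvPolynomial (ι ⊕ ι) ℂ)
      = X (Sum.inl k) * (X (Sum.inl l) * pderiv (Sum.inl k) φ) := by ring
  have e3 : (X (Sum.inl k) * X (Sum.inl l) * pderiv (Sum.inl l) φ : MvPolynomial (ι ⊕ ι) ℂ)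
      = X (Sum.inl l) * (X (Sum.inl k) * pderiv (Sum.inl l) φ) := by ring
  rw [e1, h2] at h1
  rw [e2, e3]
  linear_combination (exp := 1) h1

end GammaFunctional

section Intertwining

open MvPolynomial Finset

variable {ι : Type*} [Fintype ι] [DecidableEq ι]

theorem derivation_es_of_notMem {B : Type*} [CommRing B] [Algebra ℂ B] (D : Derivation ℂ B B)
    (v : ι → B) (T : Finset ι) (h : ∀ i ∈ T, D (v i) = 0) (k : ℕ) : D (es v T k) = 0 := by
  rw [es, map_sum]
  refine sum_eq_zero fun t ht => ?_
  refine prod_induction _ (fun p : B => D p = 0)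
    (fun p q hp hq => ?_) (by simp) fun j hj => h j ((mem_powersetCard.1 ht).1 hj)
  rw [Derivation.leibniz, hp, hq]; simp

theorem derivation_es_succ {B : Type*} [CommRing B] [Algebra ℂ B] (D : Derivation ℂ B B)
    (v : ι → B) (l : ι) (hD : ∀ i, D (v i) = if i = l then 1 else 0) {T : Finset ι}
    (hl : l ∈ T) (k : ℕ) : D (es v T (k + 1)) = es v (T.erase l) k := by
  have h0 : ∀ k, D (es v (T.erase l) k) = 0 := derivation_es_of_notMem D v _ fun i hi => by
    rw [hD, if_neg (ne_of_mem_erase hi)]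
  rw [es_succ_erase v hl, map_add, Derivation.leibniz, h0, h0, hD, if_pos rfl]
  simp

theorem derivation_aeval {B : Type*} [CommRing B] [Algebra ℂ B] (D : Derivation ℂ B B)
    (g : ℕ → B) (M : ℕ) (h0 : D (g 0) = 0) (hg : ∀ i, M < i → g i = 0) (f : MvPolynomial ℕ ℂ) :
    D (aeval g f) = ∑ p ∈ range M, aeval g (pderiv (p + 1) f) * D (g (p + 1)) := by
  induction f using MvPolynomial.induction_on with
  | C c => simp
  | add p q hp hq => simp only [map_add, hp, hq, add_mul, sum_add_distrib]
  | mul_X f i hf =>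
    have hX : D (g i) = ∑ p ∈ range M, aeval g (pderiv (p + 1) (X i : MvPolynomial ℕ ℂ))
        * D (g (p + 1)) := by
      rcases i with _ | i
      · rw [h0, eq_comm]
        refine sum_eq_zero fun p _ => ?_
        rw [pderiv_X_of_ne (by omega)]; simp
      · by_cases hi : i < M
        · rw [sum_eq_single i]
          · simp
          · intro p _ hp
            rw [pderiv_X_of_ne (by omega)]; simp
          · intro h; exact absurd (mem_range.2 hi) h
        · rw [hg _ (by omega), map_zero, eq_comm]
          refine sum_eq_zero fun p hp => ?_
          rw [pderiv_X_of_ne (by have := mem_range.1 hp; omega)]; simp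
    rw [map_mul, aeval_X, Derivation.leibniz, hf, hX, smul_eq_mul, smul_eq_mul, mul_sum, mul_sum,
      ← sum_add_distrib]
    refine sum_congr rfl fun p _ => ?_
    rw [Derivation.leibniz, map_add, smul_eq_mul, smul_eq_mul, map_mul, map_mul, aeval_X]
    ring

/-- The sequence `u` shifted by one step, with a zero inserted in front. -/
def shiftSeq {B : Type*} [Zero B] (u : ℕ → B) : ℕ → B
  | 0 => 0
  | k + 1 => u k

/-- The Dunkl-type Laplacian `∑ ∂ₗ² + θ ∑_{l ≠ k} (∂ₗ - ∂ₖ) / (bₗ - bₖ)` of a polynomial,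
evaluated at `b`. -/
def dunklLap (θ : ℝ) (b : ι → ℂ) : MvPolynomial ι ℂ →ₗ[ℂ] ℂ where
  toFun F := ∑ l, eval b (pderiv l (pderiv l F)) + θ * ∑ l, ∑ k ∈ univ.erase l,
    (eval b (pderiv l F) - eval b (pderiv k F)) / (b l - b k)
  map_add' F G := by
    simp only [map_add, sum_add_distrib]
    have : ∀ l, ∑ k ∈ univ.erase l, (eval b (pderiv l F) + eval b (pderiv l G)
        - (eval b (pderiv k F) + eval b (pderiv k G))) / (b l - b k)
        = ∑ k ∈ univ.erase l, (eval b (pderiv l F) - eval b (pderiv k F)) / (b l - b k)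
        + ∑ k ∈ univ.erase l, (eval b (pderiv l G) - eval b (pderiv k G)) / (b l - b k) := by
      intro l
      rw [← sum_add_distrib]
      exact sum_congr rfl fun k _ => by ring
    simp only [this, sum_add_distrib]
    ring
  map_smul' c F := by
    simp only [Derivation.map_smul, smul_eval, RingHom.id_apply, smul_eq_mul, mul_add, mul_sum]
    congr 1
    refine sum_congr rfl fun l _ => sum_congr rfl fun k _ => ?_
    ring

theorem dunklLap_apply (θ : ℝ) (b : ι → ℂ) (F : MvPolynomial ι ℂ) :
    dunklLap θ b F = ∑ l, eval b (pderiv l (pderiv l F)) + θ * ∑ l, ∑ k ∈ univ.erase l,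
      (eval b (pderiv l F) - eval b (pderiv k F)) / (b l - b k) := rfl

theorem dunklLap_eq {θ : ℝ} {b : ι → ℂ} (hb : Function.Injective b) {F : MvPolynomial ι ℂ}
    (W : ι → ι → MvPolynomial ι ℂ) (hW : ∀ l, ∀ k ∈ univ.erase l,
      (θ : ℂ) • (pderiv l F - pderiv k F) = (X l - X k) * W l k) :
    dunklLap θ b F
      = eval b (∑ l, pderiv l (pderiv l F) + ∑ l, ∑ k ∈ univ.erase l, W l k) := by
  rw [dunklLap_apply, map_add, map_sum, map_sum, mul_sum]
  congr 1
  refine sum_congr rfl fun l _ => ?_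
  rw [map_sum, mul_sum]
  refine sum_congr rfl fun k hk => ?_
  have h := congrArg (eval b) (hW l k hk)
  simp only [smul_eval, map_sub, map_mul, eval_X] at h
  have hne : b l - b k ≠ 0 := sub_ne_zero.2 fun e => ne_of_mem_erase hk (hb e).symm
  rw [mul_div_assoc', h, mul_div_cancel_left₀ _ hne]

/-- The expression of the Dunkl-type Laplacian in `n` variables on functions of the elementary
symmetric polynomials. -/
def lapOp (θ : ℝ) (n : ℂ) (M : ℕ) (f : MvPolynomial ℕ ℂ) : MvPolynomial ℕ ℂ :=
  ∑ p ∈ range M, pderiv (p + 1) f * (C (-θ * ((n - p) * (n - p + 1))) * shiftSeq X p)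
    + ∑ p ∈ range M, ∑ q ∈ range M, pderiv (q + 1) (pderiv (p + 1) f) * gq (C n) X p q

/-- The expression of `∑ ∂ₗ` in `n` variables on functions of the elementary symmetric
polynomials. -/
def transOp (n : ℂ) (M : ℕ) (f : MvPolynomial ℕ ℂ) : MvPolynomial ℕ ℂ :=
  ∑ p ∈ range M, pderiv (p + 1) f * (C (n - p) * X p)

theorem map_gq {A B : Type*} [CommRing A] [CommRing B] (φ : A →+* B) (n : A) (u : ℕ → A)
    (p q : ℕ) : φ (gq n u p q) = gq (φ n) (φ ∘ u) p q := by
  induction p generalizing q with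
  | zero => simp [gq]
  | succ p ih => simp [gq, ih]

theorem map_shiftSeq {A B : Type*} [CommRing A] [CommRing B] (φ : A →+* B) (u : ℕ → A)
    (p : ℕ) : φ (shiftSeq u p) = shiftSeq (φ ∘ u) p := by
  cases p <;> simp [shiftSeq]

theorem aeval_lapOp {B : Type*} [CommRing B] [Algebra ℂ B] (θ : ℝ) (n : ℂ) (M : ℕ)
    (f : MvPolynomial ℕ ℂ) (g : ℕ → B) :
    aeval g (lapOp θ n M f) = ∑ p ∈ range M, aeval g (pderiv (p + 1) f) *
        (algebraMap ℂ B (-θ * ((n - p) * (n - p + 1))) * shiftSeq g p)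
      + ∑ p ∈ range M, ∑ q ∈ range M, aeval g (pderiv (q + 1) (pderiv (p + 1) f)) *
        gq (algebraMap ℂ B n) g p q := by
  have h1 : ∀ p, aeval g (shiftSeq (X : ℕ → MvPolynomial ℕ ℂ) p) = shiftSeq g p := by
    intro p; cases p <;> simp [shiftSeq]
  have h2 : ∀ p q, aeval g (gq (C n) (X : ℕ → MvPolynomial ℕ ℂ) p q)
      = gq (algebraMap ℂ B n) g p q := by
    intro p q
    have := map_gq (aeval g : MvPolynomial ℕ ℂ →ₐ[ℂ] B).toRingHom (C n) X p q
    rw [AlgHom.toRingHom_eq_coe, RingHom.coe_coe] at this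
    rw [this, algHom_C]
    congr 1
    funext k; simp
  simp only [lapOp, map_add, map_sum, map_mul, h1, h2, algHom_C]

theorem aeval_transOp {B : Type*} [CommRing B] [Algebra ℂ B] (n : ℂ) (M : ℕ)
    (f : MvPolynomial ℕ ℂ) (g : ℕ → B) :
    aeval g (transOp n M f)
      = ∑ p ∈ range M, aeval g (pderiv (p + 1) f) * (algebraMap ℂ B (n - p) * g p) := by
  simp only [transOp, map_sum, map_mul, algHom_C, aeval_X]

/-- `es` over all indices but two, shifted down by two. -/
theorem es1_sub_es1_shift {A : Type*} [CommRing A] (v : ι → A) {i l : ι} (h : l ≠ i) (k : ℕ) :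
    es1 v i k - es1 v l k = (v l - v i) * shiftSeq (es2 v i l) k := by
  cases k with
  | zero => simp [es1, es_zero, shiftSeq]
  | succ k => exact es1_sub_es1 v h k

theorem es2_sub_es2_shift {A : Type*} [CommRing A] (v : ι → A) {i l k : ι} (hl : l ≠ i)
    (hk : k ≠ i) (hkl : k ≠ l) (p : ℕ) :
    es2 v i l p - es2 v i k p = (v k - v l) * shiftSeq (es3 v i l k) p := by
  cases p with
  | zero => simp [es2, es_zero, shiftSeq]
  | succ p =>
    rw [es2_succ v hk hkl, es2_succ v hl hkl.symm, es3_comm v i k l, es3_comm v i k l, shiftSeq]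
    ring

theorem sum_sum_shift_es2 {A : Type*} [CommRing A] (v : ι → A) (p : ℕ) :
    ∑ l, ∑ k ∈ univ.erase l, shiftSeq (es2 v l k) p
      = (((Fintype.card ι : A) - p) * ((Fintype.card ι : A) - p + 1)) *
        shiftSeq (es v univ) p := by
  cases p with
  | zero => simp [shiftSeq]
  | succ p =>
    simp only [shiftSeq, sum_es2, ← mul_sum, sum_es1]
    push_cast; ring

theorem sum_sum_shift_es3 {A : Type*} [CommRing A] (v : ι → A) (i : ι) (p : ℕ) :
    ∑ l ∈ univ.erase i, ∑ k ∈ (univ.erase i).erase l, shiftSeq (es3 v i l k) p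
      = (((Fintype.card ι : A) - 1 - p) * ((Fintype.card ι : A) - 1 - p + 1)) *
        shiftSeq (es1 v i) p := by
  cases p with
  | zero => simp [shiftSeq]
  | succ p =>
    simp only [shiftSeq]
    have : ∀ l ∈ univ.erase i, ∑ k ∈ (univ.erase i).erase l, es3 v i l k p
        = ((Fintype.card ι : A) - 2 - p) * es2 v i l p :=
      fun l hl => sum_es3 v (ne_of_mem_erase hl) p
    rw [sum_congr rfl this, ← mul_sum, sum_es2]
    push_cast; ring

/-- Substitution of the elementary symmetric polynomials in `ι`. -/
def toSym : MvPolynomial ℕ ℂ →ₐ[ℂ] MvPolynomial ι ℂ :=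
  aeval fun k => es (X : ι → MvPolynomial ι ℂ) univ k

theorem pderiv_es_univ_succ (l : ι) (p : ℕ) :
    pderiv l (es (X : ι → MvPolynomial ι ℂ) univ (p + 1)) = es1 X l p :=
  derivation_es_succ (pderiv l) X l (fun i => by
    rw [pderiv_X, Pi.single_apply]) (mem_univ l) p

theorem pderiv_es1 (l : ι) (p : ℕ) :
    pderiv l (es1 (X : ι → MvPolynomial ι ℂ) l p) = 0 :=
  derivation_es_of_notMem _ _ _ (fun _ hi => pderiv_X_of_ne (ne_of_mem_erase hi)) p

theorem pderiv_toSym (l : ι) (f : MvPolynomial ℕ ℂ) :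
    pderiv l (toSym f : MvPolynomial ι ℂ)
      = ∑ p ∈ range (Fintype.card ι), toSym (pderiv (p + 1) f) * es1 X l p := by
  rw [toSym, derivation_aeval (pderiv l) _ (Fintype.card ι)]
  · simp only [pderiv_es_univ_succ]
  · simp [es_zero]
  · intro i hi
    exact es_eq_zero _ (by simpa using hi)

theorem sum_pderiv_toSym (f : MvPolynomial ℕ ℂ) :
    ∑ l, pderiv l (toSym f : MvPolynomial ι ℂ)
      = toSym (transOp (Fintype.card ι) (Fintype.card ι) f) := by
  simp only [pderiv_toSym]
  rw [sum_comm, toSym, aeval_transOp]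
  refine sum_congr rfl fun p _ => ?_
  rw [← mul_sum, sum_es1]
  simp [algebraMap_eq]

theorem dunklLap_toSym {θ : ℝ} {b : ι → ℂ} (hb : Function.Injective b) (f : MvPolynomial ℕ ℂ) :
    dunklLap θ b (toSym f)
      = eval b (toSym (lapOp θ (Fintype.card ι) (Fintype.card ι) f)) := by
  rw [dunklLap_eq hb fun l k => ∑ p ∈ range (Fintype.card ι),
    toSym (pderiv (p + 1) f) * (C (-(θ : ℂ)) * shiftSeq (es2 X l k) p)]
  · congr 1
    have h1 : ∀ l : ι, pderiv l (pderiv l (toSym f : MvPolynomial ι ℂ))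
        = ∑ p ∈ range (Fintype.card ι), ∑ q ∈ range (Fintype.card ι),
          toSym (pderiv (q + 1) (pderiv (p + 1) f)) * (es1 X l p * es1 X l q) := by
      intro l
      rw [pderiv_toSym, map_sum]
      refine sum_congr rfl fun p _ => ?_
      rw [Derivation.leibniz, pderiv_es1, smul_zero, zero_add, pderiv_toSym, smul_eq_mul, mul_sum]
      exact sum_congr rfl fun q _ => by ring
    simp only [h1]
    have hc : (Fintype.card ι : MvPolynomial ι ℂ) = C (Fintype.card ι : ℂ) := by simp
    rw [toSym, aeval_lapOp, add_comm]
    congr 1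
    · rw [sum_congr rfl fun l _ => sum_comm, sum_comm]
      refine sum_congr rfl fun p _ => ?_
      simp only [← mul_sum]
      rw [sum_sum_shift_es2]
      rw [algebraMap_eq, hc, ← map_natCast (C : ℂ →+* MvPolynomial ι ℂ) p]
      simp only [C_mul, C_sub, C_add, C_neg, C_1]
      ring
    · rw [sum_comm]
      refine sum_congr rfl fun p _ => ?_
      rw [sum_comm]
      refine sum_congr rfl fun q _ => ?_
      rw [← mul_sum, sum_es1_mul_es1, hc, algebraMap_eq]
  · intro l k hk
    rw [pderiv_toSym, pderiv_toSym, ← sum_sub_distrib, smul_sum, mul_sum]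
    refine sum_congr rfl fun p _ => ?_
    rw [← mul_sub, es1_sub_es1_shift _ (ne_of_mem_erase hk), smul_eq_C_mul, C_neg]
    ring

end Intertwining

section IntertwiningGamma

open MvPolynomial Finset

variable {ι : Type*} [Fintype ι] [DecidableEq ι]

/-- The generic points. -/
def bX (i : ι) : MvPolynomial (ι ⊕ ι) ℂ := X (Sum.inr i)

/-- The generic weights. -/
def gX (i : ι) : MvPolynomial (ι ⊕ ι) ℂ := X (Sum.inl i)

/-- Substitution of the weighted sums `∑ᵢ γᵢ e_k(b∖i)`. -/
def hatSub : MvPolynomial ℕ ℂ →ₐ[ℂ] MvPolynomial (ι ⊕ ι) ℂ := aeval (eh (bX (ι := ι)) gX)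

theorem pderiv_inr_bX (l i : ι) :
    pderiv (Sum.inr l) (bX i : MvPolynomial (ι ⊕ ι) ℂ) = if i = l then 1 else 0 := by
  rw [bX, pderiv_X, Pi.single_apply]
  simp

theorem pderiv_inr_gX (l i : ι) : pderiv (Sum.inr l) (gX i : MvPolynomial (ι ⊕ ι) ℂ) = 0 :=
  pderiv_X_of_ne (by simp)

theorem pderiv_inl_bX (l i : ι) : pderiv (Sum.inl l) (bX i : MvPolynomial (ι ⊕ ι) ℂ) = 0 :=
  pderiv_X_of_ne (by simp)

theorem pderiv_inl_gX (l i : ι) :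
    pderiv (Sum.inl l) (gX i : MvPolynomial (ι ⊕ ι) ℂ) = if i = l then 1 else 0 := by
  rw [gX, pderiv_X, Pi.single_apply]
  simp

theorem pderiv_inl_es (l : ι) (T : Finset ι) (p : ℕ) :
    pderiv (Sum.inl l) (es (bX (ι := ι)) T p) = 0 :=
  derivation_es_of_notMem _ _ _ (fun i _ => pderiv_inl_bX l i) p

theorem pderiv_inr_es (l : ι) {T : Finset ι} (hT : l ∉ T) (p : ℕ) :
    pderiv (Sum.inr l) (es (bX (ι := ι)) T p) = 0 :=
  derivation_es_of_notMem _ _ _ (fun i hi => by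
    rw [pderiv_inr_bX, if_neg]; rintro rfl; exact hT hi) p

theorem pderiv_inl_eh (l : ι) (p : ℕ) :
    pderiv (Sum.inl l) (eh (bX (ι := ι)) gX p) = es1 bX l p := by
  rw [eh, map_sum, sum_eq_single l]
  · rw [Derivation.leibniz, es1, pderiv_inl_es, pderiv_inl_gX]; simp
  · intro i _ hi
    rw [Derivation.leibniz, es1, pderiv_inl_es, pderiv_inl_gX, if_neg hi]; simp
  · simp

/-- The derivative of `∑ᵢ γᵢ e_{p+1}(b∖i)` with respect to `bₗ`. -/
def ehDeriv (l : ι) (p : ℕ) : MvPolynomial (ι ⊕ ι) ℂ :=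
  ∑ i ∈ univ.erase l, gX i * es2 bX i l p

theorem pderiv_inr_eh_succ (l : ι) (p : ℕ) :
    pderiv (Sum.inr l) (eh (bX (ι := ι)) gX (p + 1)) = ehDeriv l p := by
  rw [eh, map_sum, ← add_sum_erase _ _ (mem_univ l), Derivation.leibniz, pderiv_inr_gX, es1,
    pderiv_inr_es _ (notMem_erase _ _), smul_zero, smul_zero, add_zero, zero_add, ehDeriv]
  refine sum_congr rfl fun i hi => ?_
  rw [Derivation.leibniz, pderiv_inr_gX, smul_zero, add_zero, smul_eq_mul, es1, es2,
    derivation_es_succ _ _ l (pderiv_inr_bX l)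
      (mem_erase.2 ⟨(ne_of_mem_erase hi).symm, mem_univ l⟩)]

theorem pderiv_inr_ehDeriv (l : ι) (p : ℕ) :
    pderiv (Sum.inr l) (ehDeriv l p) = 0 := by
  rw [ehDeriv, map_sum]
  refine sum_eq_zero fun i hi => ?_
  rw [Derivation.leibniz, pderiv_inr_gX, es2, pderiv_inr_es _ (notMem_erase _ _)]; simp

theorem eh_eq_zero {A : Type*} [CommRing A] (v γ : ι → A) {k : ℕ} (h : Fintype.card ι ≤ k) :
    eh v γ k = 0 := by
  refine sum_eq_zero fun i _ => ?_
  rw [es1, es_eq_zero, mul_zero]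
  rw [card_erase_of_mem (mem_univ i), card_univ]
  have := card_pos_of_mem i
  omega

theorem pderiv_inr_hatSub (l : ι) (f : MvPolynomial ℕ ℂ) :
    pderiv (Sum.inr l) (hatSub f)
      = ∑ p ∈ range (Fintype.card ι), hatSub (pderiv (p + 1) f) * ehDeriv l p := by
  rw [hatSub, derivation_aeval _ _ (Fintype.card ι)]
  · simp only [pderiv_inr_eh_succ]
  · rw [eh, map_sum]
    refine sum_eq_zero fun i _ => ?_
    rw [es1, es_zero, mul_one, pderiv_inr_gX]
  · intro i hi
    exact eh_eq_zero _ _ hi.le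

/-- Chain rule for a derivation all of whose generators matter. -/
theorem derivation_aeval_all {B : Type*} [CommRing B] [Algebra ℂ B] (D : Derivation ℂ B B)
    (g : ℕ → B) (M : ℕ) (hg : ∀ i, M < i → g i = 0) (f : MvPolynomial ℕ ℂ) :
    D (aeval g f) = aeval g (pderiv 0 f) * D (g 0)
      + ∑ p ∈ range M, aeval g (pderiv (p + 1) f) * D (g (p + 1)) := by
  have : D (aeval g f) = ∑ p ∈ range (M + 1), aeval g (pderiv p f) * D (g p) := by
    induction f using MvPolynomial.induction_on with
    | C c => simp
    | add p q hp hq => simp only [map_add, hp, hq, add_mul, sum_add_distrib]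
    | mul_X f i hf =>
      have hX : D (g i) = ∑ p ∈ range (M + 1), aeval g (pderiv p (X i : MvPolynomial ℕ ℂ))
          * D (g p) := by
        by_cases hi : i < M + 1
        · rw [sum_eq_single i]
          · simp
          · intro p _ hp
            rw [pderiv_X_of_ne (by omega)]; simp
          · intro h; exact absurd (mem_range.2 hi) h
        · rw [hg _ (by omega), map_zero, eq_comm]
          refine sum_eq_zero fun p hp => ?_
          rw [pderiv_X_of_ne (by have := mem_range.1 hp; omega)]; simp
      rw [map_mul, aeval_X, Derivation.leibniz, hf, hX, smul_eq_mul, smul_eq_mul, mul_sum,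
        mul_sum, ← sum_add_distrib]
      refine sum_congr rfl fun p _ => ?_
      rw [Derivation.leibniz, map_add, smul_eq_mul, smul_eq_mul, map_mul, map_mul, aeval_X]
      ring
  rw [this, sum_range_succ', add_comm]

theorem pderiv_inl_sub_hatSub {k l : ι} (h : k ≠ l) (f : MvPolynomial ℕ ℂ) :
    pderiv (Sum.inl k) (hatSub f) - pderiv (Sum.inl l) (hatSub f)
      = (bX l - bX k) *
        ∑ q ∈ range (Fintype.card ι), hatSub (pderiv (q + 1) f) * es2 bX k l q := by
  have hz : ∀ i, Fintype.card ι < i → eh (bX (ι := ι)) gX i = 0 := fun i hi =>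
    eh_eq_zero _ _ hi.le
  rw [hatSub, derivation_aeval_all _ _ _ hz, derivation_aeval_all _ _ _ hz]
  simp only [pderiv_inl_eh]
  have h0 : ∀ i, es1 (bX (ι := ι)) i 0 = 1 := fun i => es_zero _ _
  rw [h0, h0, add_sub_add_left_eq_sub, ← sum_sub_distrib, mul_sum]
  refine sum_congr rfl fun q _ => ?_
  rw [← mul_sub, es1_sub_es1 _ h.symm]
  ring

theorem ehDeriv_sub {k l : ι} (h : k ≠ l) (p : ℕ) :
    ehDeriv l p - ehDeriv k p
      = (bX k - bX l) * ∑ i ∈ (univ.erase l).erase k, gX i * shiftSeq (es3 bX i l k) p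
        + (gX k - gX l) * es2 bX k l p := by
  rw [ehDeriv, ehDeriv, ← add_sum_erase _ _ (mem_erase.2 ⟨h, mem_univ k⟩),
    ← add_sum_erase (univ.erase k) _ (mem_erase.2 ⟨h.symm, mem_univ l⟩),
    erase_right_comm (a := k) (b := l), es2_comm bX l k, mul_sum]
  have : ∑ i ∈ (univ.erase l).erase k, gX i * es2 bX i l p
      - ∑ i ∈ (univ.erase l).erase k, gX i * es2 bX i k p
      = ∑ i ∈ (univ.erase l).erase k,
        (bX k - bX l) * (gX i * shiftSeq (es3 (bX (ι := ι)) i l k) p) := by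
    rw [← sum_sub_distrib]
    refine sum_congr rfl fun i hi => ?_
    simp only [mem_erase, mem_univ, and_true] at hi
    rw [← mul_sub, es2_sub_es2_shift _ (Ne.symm hi.2) (Ne.symm hi.1) h]
    ring
  rw [← this]
  ring

theorem sum_pderiv_gE_hatSub (θ : ℝ) (f : MvPolynomial ℕ ℂ) :
    ∑ l : ι, pderiv l (gE θ (hatSub f))
      = gE θ (hatSub (transOp (Fintype.card ι - 1) (Fintype.card ι) f)) := by
  simp only [pderiv_gE, ← map_sum, pderiv_inr_hatSub]
  rw [sum_comm, hatSub, aeval_transOp]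
  congr 1
  refine sum_congr rfl fun p _ => ?_
  rw [← mul_sum]
  congr 1
  have : ∑ l : ι, ehDeriv l p = ∑ i : ι, ∑ l ∈ univ.erase i, gX i * es2 bX i l p := by
    unfold ehDeriv
    refine sum_comm' fun l i => ?_
    simp [eq_comm]
  rw [this, eh, mul_sum]
  refine sum_congr rfl fun i _ => ?_
  rw [← mul_sum, sum_es2]
  simp [algebraMap_eq]
  ring

theorem sum_ehDeriv_mul (p q : ℕ) :
    ∑ l : ι, ehDeriv l p * ehDeriv l q
      + ∑ l : ι, ∑ k ∈ univ.erase l, gX k * gX l * (es2 bX k l p * es2 bX k l q)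
      = gq ((Fintype.card ι : MvPolynomial (ι ⊕ ι) ℂ) - 1) (eh bX gX) p q := by
  rw [← sum_cdcCoeff]
  have h1 : ∑ l : ι, ehDeriv l p * ehDeriv l q
      = ∑ i, ∑ j, ∑ l ∈ (univ.erase i).erase j,
        gX i * gX j * (es2 (bX (ι := ι)) i l p * es2 bX j l q) := by
    have : ∀ l : ι, ehDeriv l p * ehDeriv l q = ∑ i ∈ univ.erase l, ∑ j ∈ univ.erase l,
        gX i * gX j * (es2 (bX (ι := ι)) i l p * es2 bX j l q) := by
      intro l
      rw [ehDeriv, ehDeriv, sum_mul_sum]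
      exact sum_congr rfl fun i _ => sum_congr rfl fun j _ => by ring
    simp only [this]
    rw [sum_comm' (t' := univ) (s' := fun i => univ.erase i) (by simp [eq_comm])]
    refine sum_congr rfl fun i _ => ?_
    refine sum_comm' fun l j => ?_
    simp only [mem_erase, mem_univ, and_true]
    constructor
    · rintro ⟨h1, h2⟩; exact ⟨Ne.symm h2, h1⟩
    · rintro ⟨h1, h2⟩; exact ⟨h2, Ne.symm h1⟩
  have h2 : ∑ l : ι, ∑ k ∈ univ.erase l, gX k * gX l * (es2 bX k l p * es2 bX k l q)
      = ∑ i, ∑ j, gX i * gX j *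
        (if i = j then 0 else es2 (bX (ι := ι)) i j p * es2 bX i j q) := by
    rw [sum_comm' (t' := univ) (s' := fun i => univ.erase i) (by simp [eq_comm])]
    refine sum_congr rfl fun i _ => ?_
    rw [← add_sum_erase _ _ (mem_univ i), if_pos rfl, mul_zero, zero_add]
    refine sum_congr rfl fun j hj => ?_
    rw [if_neg (ne_of_mem_erase hj).symm]
  rw [h1, h2, ← sum_add_distrib]
  refine sum_congr rfl fun i _ => ?_
  rw [← sum_add_distrib]
  refine sum_congr rfl fun j _ => ?_
  rw [cdcCoeff, mul_add, mul_sum]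

theorem sum_sum_sum_es3 (p : ℕ) :
    ∑ l : ι, ∑ k ∈ univ.erase l, ∑ i ∈ (univ.erase l).erase k,
        gX i * shiftSeq (es3 (bX (ι := ι)) i l k) p
      = (((Fintype.card ι : MvPolynomial (ι ⊕ ι) ℂ) - 1 - p) *
        ((Fintype.card ι : MvPolynomial (ι ⊕ ι) ℂ) - 1 - p + 1)) *
          shiftSeq (eh (bX (ι := ι)) gX) p := by
  have h1 : ∑ l : ι, ∑ k ∈ univ.erase l, ∑ i ∈ (univ.erase l).erase k,
        gX i * shiftSeq (es3 (bX (ι := ι)) i l k) p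
      = ∑ i : ι, ∑ l ∈ univ.erase i, ∑ k ∈ (univ.erase i).erase l,
        gX i * shiftSeq (es3 (bX (ι := ι)) i l k) p := by
    rw [eq_comm, sum_comm' (t' := univ) (s' := fun l => univ.erase l) (by simp [eq_comm])]
    refine sum_congr rfl fun l _ => ?_
    refine sum_comm' fun i k => ?_
    simp only [mem_erase, mem_univ, and_true]
    constructor
    · rintro ⟨h1, h2, h3⟩; exact ⟨⟨Ne.symm h3, h1⟩, h2⟩
    · rintro ⟨⟨h1, h2⟩, h3⟩; exact ⟨h2, h3, Ne.symm h1⟩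
  rw [h1]
  simp only [← mul_sum, sum_sum_shift_es3]
  have h2 : shiftSeq (eh (bX (ι := ι)) gX) p = ∑ i, gX i * shiftSeq (es1 (bX (ι := ι)) i) p := by
    cases p <;> simp [shiftSeq, eh]
  rw [h2, mul_sum]
  exact sum_congr rfl fun i _ => by ring

theorem smul_gE_hatSub_mul_ehDeriv_sub (θ : ℝ) {k l : ι} (h : k ≠ l) (p : ℕ)
    (g : MvPolynomial ℕ ℂ) :
    (θ : ℂ) • gE θ (hatSub g * (ehDeriv l p - ehDeriv k p))
      = gE θ ((bX l - bX k) *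
        (hatSub g * (C (-(θ : ℂ)) *
            ∑ i ∈ (univ.erase l).erase k, gX i * shiftSeq (es3 bX i l k) p)
          + ∑ q ∈ range (Fintype.card ι), hatSub (pderiv (q + 1) g) *
            (gX k * gX l * (es2 bX k l p * es2 bX k l q)))) := by
  have h1 := gE_X_sub_X θ k l (hatSub g * es2 bX k l p)
  have e1 : hatSub g * ((gX k - gX l) * es2 bX k l p)
      = (X (Sum.inl k) - X (Sum.inl l)) * (hatSub g * es2 bX k l p) := by
    simp only [gX]; ring
  have e2 : ∀ j : ι, pderiv (Sum.inl j) (es2 (bX (ι := ι)) k l p) = 0 := fun j =>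
    pderiv_inl_es j _ p
  rw [Derivation.leibniz, Derivation.leibniz, e2, e2, smul_zero, zero_add, zero_add,
    smul_eq_mul, smul_eq_mul, ← mul_sub, pderiv_inl_sub_hatSub h] at h1
  rw [ehDeriv_sub h, mul_add, map_add, smul_add, mul_add (bX l - bX k), map_add, e1, h1]
  refine congrArg₂ (· + ·) ?_ ?_
  · rw [← map_smul, smul_eq_C_mul, C_neg]
    refine congrArg (gE θ) ?_
    ring
  · refine congrArg (gE θ) ?_
    simp only [mul_sum, gX]
    exact sum_congr rfl fun q _ => by ring

theorem smul_pderiv_sub_gE_hatSub (θ : ℝ) {k l : ι} (h : k ≠ l) (f : MvPolynomial ℕ ℂ) :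
    (θ : ℂ) • (pderiv l (gE θ (hatSub f)) - pderiv k (gE θ (hatSub f)))
      = (X l - X k) * gE θ (∑ p ∈ range (Fintype.card ι), (hatSub (pderiv (p + 1) f) *
          (C (-(θ : ℂ)) * ∑ i ∈ (univ.erase l).erase k, gX i * shiftSeq (es3 bX i l k) p)
        + ∑ q ∈ range (Fintype.card ι), hatSub (pderiv (q + 1) (pderiv (p + 1) f)) *
          (gX k * gX l * (es2 bX k l p * es2 bX k l q)))) := by
  have hmul : ∀ φ : MvPolynomial (ι ⊕ ι) ℂ,
      (X l - X k) * gE θ φ = gE θ ((bX l - bX k) * φ) := by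
    intro φ
    rw [sub_mul, sub_mul, map_sub, bX, bX, gE_X_inr_mul, gE_X_inr_mul]
  rw [pderiv_gE, pderiv_gE, ← map_sub, pderiv_inr_hatSub, pderiv_inr_hatSub, ← sum_sub_distrib,
    map_sum, smul_sum, hmul, mul_sum, map_sum]
  refine sum_congr rfl fun p _ => ?_
  rw [← mul_sub, smul_gE_hatSub_mul_ehDeriv_sub θ h]

theorem dunklLap_gE_hatSub {θ : ℝ} {b : ι → ℂ} (hb : Function.Injective b)
    (f : MvPolynomial ℕ ℂ) :
    dunklLap θ b (gE θ (hatSub f))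
      = eval b (gE θ (hatSub (lapOp θ (Fintype.card ι - 1) (Fintype.card ι) f))) := by
  rw [dunklLap_eq hb _ fun l k hk => smul_pderiv_sub_gE_hatSub θ (ne_of_mem_erase hk) f]
  set N := Fintype.card ι with hN
  congr 1
  have h1 : ∀ l : ι, pderiv l (pderiv l (gE θ (hatSub f)))
      = gE θ (∑ p ∈ range N, ∑ q ∈ range N,
        hatSub (pderiv (q + 1) (pderiv (p + 1) f)) * (ehDeriv l p * ehDeriv l q)) := by
    intro l
    rw [pderiv_gE, pderiv_gE, pderiv_inr_hatSub, map_sum]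
    congr 1
    refine sum_congr rfl fun p _ => ?_
    rw [Derivation.leibniz, pderiv_inr_ehDeriv, smul_zero, zero_add, pderiv_inr_hatSub,
      smul_eq_mul, mul_sum]
    exact sum_congr rfl fun q _ => by ring
  simp only [h1, ← map_sum, ← map_add]
  congr 1
  have hc : (N : MvPolynomial (ι ⊕ ι) ℂ) = C (N : ℂ) := by simp
  have e1 : ∀ p : ℕ, algebraMap ℂ (MvPolynomial (ι ⊕ ι) ℂ)
        (-(θ : ℂ) * (((N : ℂ) - 1 - p) * ((N : ℂ) - 1 - p + 1))) *
        shiftSeq (eh (bX (ι := ι)) gX) p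
      = ∑ l : ι, ∑ k ∈ univ.erase l, C (-(θ : ℂ)) *
        ∑ i ∈ (univ.erase l).erase k, gX i * shiftSeq (es3 (bX (ι := ι)) i l k) p := by
    intro p
    simp only [← mul_sum]
    rw [sum_sum_sum_es3, algebraMap_eq, ← hN, hc,
      ← map_natCast (C : ℂ →+* MvPolynomial (ι ⊕ ι) ℂ) p]
    simp only [C_mul, C_sub, C_add, C_neg, C_1]
    ring
  have e2 : ∀ p q : ℕ, gq (algebraMap ℂ (MvPolynomial (ι ⊕ ι) ℂ) ((N : ℂ) - 1))
        (eh (bX (ι := ι)) gX) p q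
      = ∑ l : ι, ehDeriv l p * ehDeriv l q
        + ∑ l : ι, ∑ k ∈ univ.erase l, gX k * gX l * (es2 bX k l p * es2 bX k l q) := by
    intro p q
    rw [sum_ehDeriv_mul, algebraMap_eq, C_sub, C_1, ← hN, hc]
  rw [hatSub, aeval_lapOp]
  simp only [e1, e2]
  have swap : ∀ F : ι → ι → ℕ → MvPolynomial (ι ⊕ ι) ℂ,
      ∑ l, ∑ k ∈ univ.erase l, ∑ p ∈ range N, F l k p
        = ∑ p ∈ range N, ∑ l, ∑ k ∈ univ.erase l, F l k p := by
    intro F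
    rw [sum_comm (s := range N)]
    exact sum_congr rfl fun l _ => sum_comm
  rw [sum_comm, swap, ← sum_add_distrib, ← sum_add_distrib]
  refine sum_congr rfl fun p _ => ?_
  rw [sum_comm (s := univ)]
  simp only [sum_add_distrib]
  rw [add_left_comm]
  congr 1
  · rw [mul_sum]
    exact sum_congr rfl fun l _ => by rw [mul_sum]
  · rw [swap, ← sum_add_distrib]
    refine sum_congr rfl fun q _ => ?_
    rw [mul_add, mul_sum, mul_sum]
    congr 1
    exact sum_congr rfl fun l _ => by rw [mul_sum]

end IntertwiningGamma

section VandermondeDet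

open Finset

/-- The product of all distances `|aᵢ - aⱼ|`, `i < j`. -/
def vdm {n : ℕ} (a : Fin n → ℝ) : ℝ :=
  ∏ i : Fin n, ∏ j : Fin n, if i < j then |a i - a j| else 1

theorem vdm_pos {n : ℕ} {a : Fin n → ℝ} (ha : Function.Injective a) : 0 < vdm a := by
  refine prod_pos fun i _ => prod_pos fun j _ => ?_
  split_ifs with h
  · exact abs_pos.2 (sub_ne_zero.2 fun e => h.ne (ha e))
  · exact one_pos

theorem abs_det_vandermonde {n : ℕ} (a : Fin n → ℝ) : |(Matrix.vandermonde a).det| = vdm a := by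
  rw [Matrix.det_vandermonde, abs_prod, vdm]
  refine prod_congr rfl fun i _ => ?_
  rw [abs_prod, ← prod_filter]
  refine prod_congr (by ext; simp) fun j _ => abs_sub_comm _ _

theorem vdm_cons {n : ℕ} (q : ℝ) (a : Fin n → ℝ) :
    vdm (Fin.cons q a : Fin (n + 1) → ℝ) = (∏ j, |q - a j|) * vdm a := by
  simp [vdm, Fin.prod_univ_succ]

theorem prod_prod_abs_sub_ite {n : ℕ} (a : Fin n → ℝ) :
    ∏ i : Fin n, ∏ j ∈ univ.erase i, |a i - a j| = vdm a ^ 2 := by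
  have h1 : ∀ i, ∏ j ∈ univ.erase i, |a i - a j|
      = (∏ j, if i < j then |a i - a j| else 1) * ∏ j, if j < i then |a i - a j| else 1 := by
    intro i
    rw [← prod_mul_distrib, ← mul_prod_erase univ _ (mem_univ i)]
    simp only [lt_irrefl, if_false, mul_one, one_mul]
    refine prod_congr rfl fun j hj => ?_
    rcases lt_or_gt_of_ne (ne_of_mem_erase hj) with h | h
    · simp [h, h.not_gt]
    · simp [h, h.not_gt]
  simp only [h1, prod_mul_distrib]
  rw [prod_comm (f := fun i j : Fin n => if j < i then |a i - a j| else 1), sq, vdm]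
  congr 1
  refine prod_congr rfl fun i _ => prod_congr rfl fun j _ => ?_
  rw [abs_sub_comm]

theorem prod_prod_abs_sub_succAbove {n : ℕ} (b : Fin (n + 1) → ℝ) :
    ∏ i, ∏ j : Fin n, |b i - b (i.succAbove j)| = vdm b ^ 2 := by
  rw [← prod_prod_abs_sub_ite]
  refine prod_congr rfl fun i _ => ?_
  have : univ.erase i = univ.map (Fin.succAboveEmb i) := by
    ext j
    simp only [mem_erase, mem_univ, and_true, Finset.mem_map, true_and, Fin.succAboveEmb_apply]
    exact ⟨fun h => Fin.exists_succAbove_eq h, fun ⟨k, hk⟩ => hk ▸ Fin.succAbove_ne i k⟩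
  rw [this, prod_map]
  rfl

open Polynomial in
/-- The polynomials `∏ⱼ (X - aⱼ)` and `∏_{k ≠ j} (X - a_k)`. -/
def interPoly {n : ℕ} (a : Fin n → ℝ) : Fin (n + 1) → Polynomial ℝ :=
  Fin.cons (∏ j, (Polynomial.X - Polynomial.C (a j)))
    fun j => ∏ k ∈ univ.erase j, (Polynomial.X - Polynomial.C (a k))

theorem natDegree_interPoly {n : ℕ} (a : Fin n → ℝ) (k : Fin (n + 1)) :
    (interPoly a k).natDegree < n + 1 := by
  refine Fin.cases ?_ (fun j => ?_) k
  · simp [interPoly, Polynomial.natDegree_prod_of_monic _ _ fun j _ => Polynomial.monic_X_sub_C (a j)]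
  · simp only [interPoly, Fin.cons_succ]
    rw [Polynomial.natDegree_prod_of_monic _ _ fun j _ => Polynomial.monic_X_sub_C (a j)]
    simp

/-- The matrix of values of the interlacing polynomials. -/
def interMat {n : ℕ} (a : Fin n → ℝ) (q : Fin (n + 1) → ℝ) : Matrix (Fin (n + 1)) (Fin (n + 1)) ℝ :=
  Matrix.of fun i k => (interPoly a k).eval (q i)

theorem interMat_eq_mul {n : ℕ} (a : Fin n → ℝ) (q : Fin (n + 1) → ℝ) :
    interMat a q = Matrix.vandermonde q *
      Matrix.of fun i k : Fin (n + 1) => (interPoly a k).coeff i := by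
  ext i k
  rw [interMat, Matrix.of_apply, Matrix.mul_apply,
    Polynomial.eval_eq_sum_range' (natDegree_interPoly a k), ← Fin.sum_univ_eq_sum_range
      (fun e => (interPoly a k).coeff e * q i ^ e)]
  exact sum_congr rfl fun e _ => by simp [Matrix.vandermonde, mul_comm]

theorem abs_det_interMat_cons {n : ℕ} (a : Fin n → ℝ) (q : ℝ) :
    |(interMat a (Fin.cons q a)).det| = (∏ j, |q - a j|) * vdm a ^ 2 := by
  rw [Matrix.det_succ_column_zero, sum_eq_single 0]
  · have h : (interMat a (Fin.cons q a)).submatrix ((0 : Fin (n + 1)).succAbove) Fin.succ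
        = Matrix.diagonal fun k => ∏ j ∈ univ.erase k, (a k - a j) := by
      ext k j
      simp only [interMat, Matrix.submatrix_apply, Fin.succAbove_zero, Matrix.of_apply, interPoly,
        Fin.cons_succ, Polynomial.eval_prod, Polynomial.eval_sub, Polynomial.eval_X,
        Polynomial.eval_C, Matrix.diagonal_apply]
      split_ifs with hkj
      · subst hkj; rfl
      · exact prod_eq_zero (mem_erase.2 ⟨hkj, mem_univ k⟩) (sub_self _)
    rw [h, Matrix.det_diagonal, ← prod_prod_abs_sub_ite]
    simp [interMat, interPoly, Polynomial.eval_prod, abs_mul, abs_prod]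
  · intro i _ hi
    obtain ⟨k, rfl⟩ := Fin.exists_succ_eq.2 hi
    have : interMat a (Fin.cons q a) k.succ 0 = 0 := by
      simp only [interMat, Matrix.of_apply, interPoly, Fin.cons_zero, Fin.cons_succ,
        Polynomial.eval_prod]
      exact prod_eq_zero (mem_univ k) (by simp)
    rw [this]; ring
  · simp

theorem abs_det_interMat {n : ℕ} {a : Fin n → ℝ} (ha : Function.Injective a)
    (b : Fin (n + 1) → ℝ) : |(interMat a b).det| = vdm b * vdm a := by
  obtain ⟨q, hq⟩ := Infinite.exists_notMem_finset (univ.image a)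
  have hq' : 0 < ∏ j, |q - a j| := prod_pos fun j _ => abs_pos.2 (sub_ne_zero.2 fun e =>
    hq (mem_image.2 ⟨j, mem_univ j, e.symm⟩))
  have h := abs_det_interMat_cons a q
  rw [interMat_eq_mul, Matrix.det_mul, abs_mul, abs_det_vandermonde, vdm_cons] at h
  have hv := vdm_pos ha
  rw [interMat_eq_mul, Matrix.det_mul, abs_mul, abs_det_vandermonde]
  congr 1
  have : ((∏ j, |q - a j|) * vdm a) *
      |(Matrix.of fun i k : Fin (n + 1) => (interPoly a k).coeff i).det|
      = ((∏ j, |q - a j|) * vdm a) * vdm a := by rw [h]; ring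
  exact mul_left_cancel₀ (by positivity) this

end VandermondeDet

section DixonAnderson

open Finset

variable {n : ℕ}

theorem Interlaces.lt_of_le {a : Fin n → ℝ} {b : Fin (n + 1) → ℝ} (h : Interlaces a b)
    (hb : StrictAnti b) {i : Fin (n + 1)} {j : Fin n} (hij : i ≤ j.castSucc) : a j < b i :=
  (h j).1.trans_le (hb.antitone hij)

theorem Interlaces.lt_of_lt {a : Fin n → ℝ} {b : Fin (n + 1) → ℝ} (h : Interlaces a b)
    (hb : StrictAnti b) {i : Fin (n + 1)} {j : Fin n} (hij : j.castSucc < i) : b i < a j :=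
  (hb.antitone (Fin.castSucc_lt_iff_succ_le.1 hij)).trans_lt (h j).2

theorem Interlaces.strictAnti {a : Fin n → ℝ} {b : Fin (n + 1) → ℝ} (h : Interlaces a b)
    (hb : StrictAnti b) : StrictAnti a := fun i j hij =>
  (h.lt_of_le hb (i := i.succ) (j := j) (by
    rw [← Fin.castSucc_lt_iff_succ_le]; exact hij)).trans (h i).2

theorem ne_succAbove_sub {b : Fin (n + 1) → ℝ} (hb : StrictAnti b) (i : Fin (n + 1)) (j : Fin n) :
    b i - b (i.succAbove j) ≠ 0 :=
  sub_ne_zero.2 fun e => (Fin.succAbove_ne i j) (hb.injective e).symm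

/-- The weights `γᵢ = s ∏ⱼ (bᵢ - aⱼ) / ∏_{l ≠ i} (bᵢ - b_l)` for `z = (s, a)`. -/
def daMap (b : Fin (n + 1) → ℝ) (z : Fin (n + 1) → ℝ) (i : Fin (n + 1)) : ℝ :=
  (z 0 * ∏ j : Fin n, (b i - z j.succ)) / ∏ j : Fin n, (b i - b (i.succAbove j))

/-- The Jacobian matrix of `daMap`. -/
def daJac (b : Fin (n + 1) → ℝ) (z : Fin (n + 1) → ℝ) : Matrix (Fin (n + 1)) (Fin (n + 1)) ℝ :=
  Matrix.of fun i k => (∏ j : Fin n, (b i - b (i.succAbove j)))⁻¹ *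
    ((Fin.cons 1 (fun _ => -z 0) : Fin (n + 1) → ℝ) k * interMat (Fin.tail z) b i k)

/-- The domain of `daMap`. -/
def daSet (b : Fin (n + 1) → ℝ) : Set (Fin (n + 1) → ℝ) :=
  {z | 0 < z 0 ∧ Interlaces (Fin.tail z) b}

theorem hasFDerivAt_daMap (b z : Fin (n + 1) → ℝ) :
    HasFDerivAt (daMap b) (Matrix.toLin' (daJac b z)).toContinuousLinearMap z := by
  rw [hasFDerivAt_pi']
  intro i
  have h0 : HasFDerivAt (fun z : Fin (n + 1) → ℝ => z 0)
      (ContinuousLinearMap.proj (R := ℝ) (φ := fun _ : Fin (n + 1) => ℝ) 0) z :=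
    (ContinuousLinearMap.proj (R := ℝ) (φ := fun _ : Fin (n + 1) => ℝ) 0).hasFDerivAt
  have h1 : ∀ j ∈ (univ : Finset (Fin n)), HasFDerivAt (fun z : Fin (n + 1) → ℝ => b i - z j.succ)
      (-ContinuousLinearMap.proj (R := ℝ) (φ := fun _ : Fin (n + 1) => ℝ) j.succ) z := fun j _ =>
    ((ContinuousLinearMap.proj (R := ℝ) (φ := fun _ : Fin (n + 1) => ℝ) j.succ).hasFDerivAt).const_sub
      (b i)
  have h2 := (h0.mul (HasFDerivAt.finsetProd h1)).mul_const
    (∏ j : Fin n, (b i - b (i.succAbove j)))⁻¹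
  refine (h2.congr_fderiv ?_).congr_of_eventuallyEq ?_
  · ext v
    simp [daJac, Matrix.mulVec, dotProduct, Fin.sum_univ_succ, interMat, interPoly,
      Polynomial.eval_prod, Fin.tail, mul_sum]
    ring_nf
  · exact Eventually.of_forall fun z => by simp [daMap, div_eq_mul_inv]

theorem abs_det_daJac {b z : Fin (n + 1) → ℝ} (hb : StrictAnti b) (hz : z ∈ daSet b) :
    |(daJac b z).det| = z 0 ^ n * vdm (Fin.tail z) / vdm b := by
  have h1 : daJac b z = Matrix.of fun i k => (∏ j : Fin n, (b i - b (i.succAbove j)))⁻¹ *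
      (Matrix.of fun i k => (Fin.cons 1 (fun _ => -z 0) : Fin (n + 1) → ℝ) k *
        interMat (Fin.tail z) b i k) i k := rfl
  have hv := vdm_pos hb.injective
  rw [h1, Matrix.det_mul_column, Matrix.det_mul_row, abs_mul, abs_mul,
    abs_det_interMat (hz.2.strictAnti hb).injective, abs_prod, abs_prod]
  have h2 : ∏ k, |(Fin.cons 1 (fun _ => -z 0) : Fin (n + 1) → ℝ) k| = z 0 ^ n := by
    simp [Fin.prod_univ_succ, abs_of_pos hz.1]
  rw [h2]
  simp only [Fin.cons_zero, Fin.cons_succ, prod_const, card_univ, Fintype.card_fin, one_mul,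
    abs_pow, abs_neg, abs_of_pos hz.1, abs_inv, prod_inv_distrib, abs_prod,
    prod_prod_abs_sub_succAbove]
  field_simp

end DixonAnderson

section DixonAndersonBijection

open Finset

variable {n : ℕ}

/-- The monic polynomial with roots `c`. -/
def rootPoly (c : Fin n → ℝ) : Polynomial ℝ := ∏ j, (Polynomial.X - Polynomial.C (c j))

theorem natDegree_rootPoly (c : Fin n → ℝ) : (rootPoly c).natDegree = n := by
  rw [rootPoly, Polynomial.natDegree_prod_of_monic _ _ fun j _ => Polynomial.monic_X_sub_C (c j)]
  simp

theorem coeff_rootPoly (c : Fin n → ℝ) {k : ℕ} (hk : k ≤ n) :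
    (rootPoly c).coeff (n - k) = (-1) ^ k * es c univ k := by
  have h : rootPoly c = ∏ j, (Polynomial.X + Polynomial.C (-c j)) :=
    prod_congr rfl fun j _ => by rw [Polynomial.C_neg, sub_eq_add_neg]
  rw [h, Finset.prod_X_add_C_coeff _ _ (by simp), es, mul_sum, card_univ, Fintype.card_fin,
    Nat.sub_sub_self hk]
  refine sum_congr rfl fun t ht => ?_
  rw [prod_neg, (mem_powersetCard.1 ht).2]

theorem eval_rootPoly (c : Fin n → ℝ) (x : ℝ) : (rootPoly c).eval x = ∏ j, (x - c j) := by
  simp [rootPoly, Polynomial.eval_prod]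

/-- The polynomial `∑ᵢ γᵢ ∏_{l ≠ i} (X - b_l)`. -/
def daPoly (b γ : Fin (n + 1) → ℝ) : Polynomial ℝ :=
  ∑ i, Polynomial.C (γ i) * rootPoly fun j => b (i.succAbove j)

theorem natDegree_daPoly_le (b γ : Fin (n + 1) → ℝ) : (daPoly b γ).natDegree ≤ n := by
  refine Polynomial.natDegree_sum_le_of_forall_le _ _ fun i _ => ?_
  exact (Polynomial.natDegree_C_mul_le _ _).trans (natDegree_rootPoly _).le

theorem coeff_daPoly (b γ : Fin (n + 1) → ℝ) {k : ℕ} (hk : k ≤ n) :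
    (daPoly b γ).coeff (n - k)
      = (-1) ^ k * ∑ i, γ i * es (fun j => b (i.succAbove j)) univ k := by
  rw [daPoly, Polynomial.finsetSum_coeff, mul_sum]
  refine sum_congr rfl fun i _ => ?_
  rw [Polynomial.coeff_C_mul, coeff_rootPoly _ hk]
  ring

theorem eval_daPoly (b γ : Fin (n + 1) → ℝ) (i : Fin (n + 1)) :
    (daPoly b γ).eval (b i) = γ i * ∏ j : Fin n, (b i - b (i.succAbove j)) := by
  rw [daPoly, Polynomial.eval_finsetSum, sum_eq_single i]
  · rw [Polynomial.eval_mul, Polynomial.eval_C, eval_rootPoly]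
  · intro l _ hl
    obtain ⟨j, hj⟩ := Fin.exists_succAbove_eq hl.symm
    rw [Polynomial.eval_mul, eval_rootPoly, prod_eq_zero (mem_univ j), mul_zero]
    rw [hj, sub_self]
  · simp

theorem daPoly_daMap {b : Fin (n + 1) → ℝ} (hb : StrictAnti b) (z : Fin (n + 1) → ℝ) :
    daPoly b (daMap b z) = Polynomial.C (z 0) * rootPoly (Fin.tail z) := by
  refine Polynomial.eq_of_degrees_lt_of_eval_index_eq (s := univ) (v := b) hb.injective.injOn
    ?_ ?_ fun i _ => ?_
  · rw [card_univ, Fintype.card_fin]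
    exact (Polynomial.degree_lt_iff_coeff_zero _ _).2 fun m hm =>
      Polynomial.coeff_eq_zero_of_natDegree_lt ((natDegree_daPoly_le _ _).trans_lt hm)
  · rw [card_univ, Fintype.card_fin]
    exact (Polynomial.degree_lt_iff_coeff_zero _ _).2 fun m hm =>
      Polynomial.coeff_eq_zero_of_natDegree_lt (((Polynomial.natDegree_C_mul_le _ _).trans
        (natDegree_rootPoly _).le).trans_lt hm)
  · rw [eval_daPoly, Polynomial.eval_mul, Polynomial.eval_C, eval_rootPoly, daMap,
      div_mul_cancel₀]
    · rfl
    · exact prod_ne_zero_iff.2 fun j _ => ne_succAbove_sub hb i j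

theorem sum_daMap_mul_es {b : Fin (n + 1) → ℝ} (hb : StrictAnti b) (z : Fin (n + 1) → ℝ) (k : ℕ) :
    ∑ i, daMap b z i * es (fun j => b (i.succAbove j)) univ k
      = z 0 * es (Fin.tail z) univ k := by
  rcases le_or_gt k n with hk | hk
  · have h := congrArg (fun p => Polynomial.coeff p (n - k)) (daPoly_daMap hb z)
    simp only [coeff_daPoly _ _ hk, Polynomial.coeff_C_mul, coeff_rootPoly _ hk] at h
    have h1 : ((-1 : ℝ) ^ k) ≠ 0 := by positivity
    exact mul_left_cancel₀ h1 (by rw [h]; ring)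
  · rw [es_eq_zero _ (by simpa using hk), mul_zero]
    exact sum_eq_zero fun i _ => by rw [es_eq_zero _ (by simpa using hk), mul_zero]

theorem sum_daMap {b : Fin (n + 1) → ℝ} (hb : StrictAnti b) (z : Fin (n + 1) → ℝ) :
    ∑ i, daMap b z i = z 0 := by
  simpa [es_zero] using sum_daMap_mul_es hb z 0

theorem sum_daMap_mul_prod {b : Fin (n + 1) → ℝ} (hb : StrictAnti b) (z : Fin (n + 1) → ℝ)
    (x : ℝ) :
    ∑ i, daMap b z i * ∏ j : Fin n, (1 - x * b (i.succAbove j))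
      = z 0 * ∏ j : Fin n, (1 - x * z j.succ) := by
  by_cases hx : x = 0
  · simpa [hx] using sum_daMap hb z
  have h := congrArg (fun p => x ^ n * Polynomial.eval x⁻¹ p) (daPoly_daMap hb z)
  have hp : ∀ c : Fin n → ℝ, x ^ n * ∏ j, (x⁻¹ - c j) = ∏ j, (1 - x * c j) := by
    intro c
    have : x ^ n = ∏ _j : Fin n, x := by simp
    rw [this, ← prod_mul_distrib]
    exact prod_congr rfl fun j _ => by field_simp
  simp only [daPoly, Polynomial.eval_finsetSum, Polynomial.eval_mul, Polynomial.eval_C,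
    eval_rootPoly, mul_sum, mul_left_comm (x ^ n), hp] at h
  exact h

theorem daMap_pos {b : Fin (n + 1) → ℝ} (hb : StrictAnti b) {z : Fin (n + 1) → ℝ}
    (hz : z ∈ daSet b) (i : Fin (n + 1)) : 0 < daMap b z i := by
  rw [daMap, mul_div_assoc, ← prod_div_distrib]
  refine mul_pos hz.1 (prod_pos fun j _ => ?_)
  rcases lt_or_ge j.castSucc i with h | h
  · rw [Fin.succAbove_of_castSucc_lt _ _ h]
    exact div_pos_of_neg_of_neg (sub_neg.2 (hz.2.lt_of_lt hb h)) (sub_neg.2 (hb h))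
  · rw [Fin.succAbove_of_le_castSucc _ _ h]
    exact div_pos (sub_pos.2 (hz.2.lt_of_le hb h))
      (sub_pos.2 (hb (h.trans_lt (Fin.castSucc_lt_succ))))

theorem injOn_daMap {b : Fin (n + 1) → ℝ} (hb : StrictAnti b) :
    Set.InjOn (daMap b) (daSet b) := by
  intro z hz z' hz' h
  have h0 : z 0 = z' 0 := by rw [← sum_daMap hb z, h, sum_daMap hb]
  have h1 : ∀ j : Fin n, z j.succ = z' j.succ := by
    intro j
    have h2 := congrArg (Polynomial.eval (z j.succ)) (daPoly_daMap hb z)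
    rw [h, daPoly_daMap hb z', Polynomial.eval_mul, Polynomial.eval_mul, eval_rootPoly,
      eval_rootPoly, prod_eq_zero (i := j) (mem_univ j) (f := fun k => z j.succ - Fin.tail z k)
        (sub_self _), mul_zero, Polynomial.eval_C] at h2
    obtain ⟨k, _, hk⟩ := prod_eq_zero_iff.1 ((mul_eq_zero.1 h2).resolve_left hz'.1.ne')
    have hk' : Fin.tail z j = Fin.tail z' k := sub_eq_zero.1 hk
    rcases lt_trichotomy j k with hjk | hjk | hjk
    · have e1 := hz'.2.lt_of_le hb (i := j.succ) (j := k) (Fin.castSucc_lt_iff_succ_le.1 hjk)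
      have e2 := (hz.2 j).2
      linarith
    · subst hjk; exact hk'
    · have e1 := hz.2.lt_of_le hb (i := k.succ) (j := j) (Fin.castSucc_lt_iff_succ_le.1 hjk)
      have e2 := (hz'.2 k).2
      linarith
  ext i
  exact Fin.cases h0 h1 i

theorem prod_mul_prod_neg {b : Fin (n + 1) → ℝ} (hb : StrictAnti b) (j : Fin n) :
    (∏ k : Fin n, (b j.castSucc - b (j.castSucc.succAbove k))) *
      ∏ k : Fin n, (b j.succ - b (j.succ.succAbove k)) < 0 := by
  rw [← prod_mul_distrib, ← mul_prod_erase _ _ (mem_univ j)]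
  refine mul_neg_of_neg_of_pos ?_ (prod_pos fun k hk => ?_)
  · rw [Fin.succAbove_castSucc_self, Fin.succAbove_succ_self]
    have := hb (Fin.castSucc_lt_succ (i := j))
    exact mul_neg_of_pos_of_neg (by linarith) (by linarith)
  · rcases lt_or_gt_of_ne (ne_of_mem_erase hk) with h | h
    · have h1 : k.castSucc < j.castSucc := h
      have h2 : k.castSucc < j.succ := h1.trans Fin.castSucc_lt_succ
      rw [Fin.succAbove_of_castSucc_lt _ _ h1, Fin.succAbove_of_castSucc_lt _ _ h2]
      exact mul_pos_of_neg_of_neg (sub_neg.2 (hb h1)) (sub_neg.2 (hb h2))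
    · have h1 : j.succ ≤ k.castSucc := Fin.castSucc_lt_iff_succ_le.1 h
      have h2 : j.castSucc ≤ k.castSucc := le_of_lt h
      rw [Fin.succAbove_of_le_castSucc _ _ h1, Fin.succAbove_of_le_castSucc _ _ h2]
      exact mul_pos (sub_pos.2 (hb (h2.trans_lt Fin.castSucc_lt_succ)))
        (sub_pos.2 (hb (h1.trans_lt Fin.castSucc_lt_succ)))

theorem exists_root_daPoly {b γ : Fin (n + 1) → ℝ} (hb : StrictAnti b) (hγ : ∀ i, 0 < γ i)
    (j : Fin n) : ∃ x, (x < b j.castSucc ∧ b j.succ < x) ∧ (daPoly b γ).eval x = 0 := by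
  have hlt : b j.succ < b j.castSucc := hb Fin.castSucc_lt_succ
  have hc : ContinuousOn (fun x => (daPoly b γ).eval x) (Set.Icc (b j.succ) (b j.castSucc)) :=
    (daPoly b γ).continuous.continuousOn
  have hm : (daPoly b γ).eval (b j.castSucc) * (daPoly b γ).eval (b j.succ) < 0 := by
    rw [eval_daPoly, eval_daPoly, mul_mul_mul_comm]
    exact mul_neg_of_pos_of_neg (mul_pos (hγ _) (hγ _)) (prod_mul_prod_neg hb j)
  rcases mul_neg_iff.1 hm with ⟨h1, h2⟩ | ⟨h1, h2⟩
  · obtain ⟨x, hx, hx'⟩ := intermediate_value_Ioo hlt.le hc ⟨h2, h1⟩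
    exact ⟨x, ⟨hx.2, hx.1⟩, hx'⟩
  · obtain ⟨x, hx, hx'⟩ := intermediate_value_Ioo' hlt.le hc ⟨h1, h2⟩
    exact ⟨x, ⟨hx.2, hx.1⟩, hx'⟩

theorem image_daMap {b : Fin (n + 1) → ℝ} (hb : StrictAnti b) :
    daMap b '' daSet b = {γ | ∀ i, 0 < γ i} := by
  ext γ
  constructor
  · rintro ⟨z, hz, rfl⟩ i
    exact daMap_pos hb hz i
  intro hγ
  choose a ha har using exists_root_daPoly hb hγ
  have hI : Interlaces a b := fun j => ha j
  have hs : 0 < ∑ i, γ i := sum_pos (fun i _ => hγ i) univ_nonempty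
  refine ⟨Fin.cons (∑ i, γ i) a, ⟨by simpa using hs, by simpa using hI⟩, ?_⟩
  have hQ : daPoly b γ = Polynomial.C (∑ i, γ i) * rootPoly a := by
    refine Polynomial.eq_of_degree_sub_lt_of_eval_index_eq (s := univ) (v := a)
      (hI.strictAnti hb).injective.injOn ?_ fun j _ => ?_
    · rw [card_univ, Fintype.card_fin]
      refine (Polynomial.degree_lt_iff_coeff_zero _ _).2 fun m hm => ?_
      rw [Polynomial.coeff_sub, Polynomial.coeff_C_mul]
      rcases hm.eq_or_lt with rfl | hm
      · have h1 := coeff_daPoly b γ (Nat.zero_le n)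
        have h2 := coeff_rootPoly a (Nat.zero_le n)
        simp only [Nat.sub_zero, pow_zero, one_mul, es_zero, mul_one] at h1 h2
        rw [h1, h2]; ring
      · rw [Polynomial.coeff_eq_zero_of_natDegree_lt ((natDegree_daPoly_le _ _).trans_lt hm),
          Polynomial.coeff_eq_zero_of_natDegree_lt ((natDegree_rootPoly _).le.trans_lt hm)]
        ring
    · rw [har, Polynomial.eval_mul, eval_rootPoly, prod_eq_zero (mem_univ j) (sub_self _), mul_zero]
  ext i
  have h := eval_daPoly b γ i
  rw [hQ, Polynomial.eval_mul, Polynomial.eval_C, eval_rootPoly] at h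
  rw [daMap, div_eq_iff (prod_ne_zero_iff.2 fun j _ => ne_succAbove_sub hb i j), ← h]
  simp

end DixonAndersonBijection

section DixonAndersonMeasure

open Finset

variable {n : ℕ}

/-- The density of the Gamma distribution with shape `α`. -/
def gamD (α x : ℝ) : ℝ := (Set.Ioi 0).indicator (fun x => x ^ (α - 1) * Real.exp (-x) / Real.Gamma α) x

/-- The Gamma distribution with shape `α`. -/
def gamM (α : ℝ) : Measure ℝ := volume.withDensity fun x => ENNReal.ofReal (gamD α x)

/-- The distribution of independent `Gamma(θ)` variables. -/
def gamPi (θ : ℝ) (n : ℕ) : Measure (Fin n → ℝ) :=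
  volume.withDensity fun γ => ENNReal.ofReal (∏ i, gamD θ (γ i))

/-- The Dixon–Anderson density. -/
def daD (θ : ℝ) (b : Fin (n + 1) → ℝ) (a : Fin n → ℝ) : ℝ :=
  {a : Fin n → ℝ | Interlaces a b}.indicator (fun a =>
    Real.Gamma ((n + 1) * θ) / Real.Gamma θ ^ (n + 1) * vdm b ^ (1 - 2 * θ) *
      (vdm a * ∏ i, ∏ j, |b i - a j| ^ (θ - 1))) a

/-- The Dixon–Anderson kernel: the conditional law of level `n` given level `n + 1`. -/
def daK (θ : ℝ) (b : Fin (n + 1) → ℝ) : Measure (Fin n → ℝ) :=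
  volume.withDensity fun a => ENNReal.ofReal (daD θ b a)

theorem measurable_gamD (α : ℝ) : Measurable (gamD α) := by
  refine Measurable.indicator ?_ measurableSet_Ioi
  fun_prop

theorem gamD_nonneg {α : ℝ} (hα : 0 < α) (x : ℝ) : 0 ≤ gamD α x := by
  refine Set.indicator_nonneg (fun x hx => ?_) x
  have : (0 : ℝ) < x := hx
  have := Real.Gamma_pos_of_pos hα
  positivity

theorem gamD_of_pos (α : ℝ) {x : ℝ} (hx : 0 < x) :
    gamD α x = x ^ (α - 1) * Real.exp (-x) / Real.Gamma α := Set.indicator_of_mem hx _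

theorem gamD_of_not_pos (α : ℝ) {x : ℝ} (hx : ¬ 0 < x) : gamD α x = 0 :=
  Set.indicator_of_notMem hx _

theorem isOpen_interlaces (b : Fin (n + 1) → ℝ) : IsOpen {a : Fin n → ℝ | Interlaces a b} := by
  simp only [Interlaces, Set.ofPred_forall]
  refine isOpen_iInter_of_finite fun i => IsOpen.inter ?_ ?_
  · exact isOpen_lt (continuous_apply i) continuous_const
  · exact isOpen_lt continuous_const (continuous_apply i)

theorem measurable_vdm : Measurable (vdm (n := n)) := by
  unfold vdm
  refine Finset.measurable_prod _ fun i _ => Finset.measurable_prod _ fun j _ => ?_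
  split_ifs
  · fun_prop
  · fun_prop

theorem measurable_daD_uncurry (θ : ℝ) :
    Measurable fun p : (Fin (n + 1) → ℝ) × (Fin n → ℝ) => daD θ p.1 p.2 := by
  have h : (fun p : (Fin (n + 1) → ℝ) × (Fin n → ℝ) => daD θ p.1 p.2)
      = {p : (Fin (n + 1) → ℝ) × (Fin n → ℝ) | Interlaces p.2 p.1}.indicator (fun p =>
    Real.Gamma ((n + 1) * θ) / Real.Gamma θ ^ (n + 1) * vdm p.1 ^ (1 - 2 * θ) *
      (vdm p.2 * ∏ i, ∏ j, |p.1 i - p.2 j| ^ (θ - 1))) := by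
    ext p
    simp [daD, Set.indicator]
  rw [h]
  refine Measurable.indicator ?_ ?_
  · have h1 := measurable_vdm (n := n)
    have h2 := measurable_vdm (n := n + 1)
    refine Measurable.mul (by fun_prop) (Measurable.mul (by fun_prop) ?_)
    refine Finset.measurable_prod _ fun i _ => Finset.measurable_prod _ fun j _ => ?_
    fun_prop
  · simp only [Interlaces, Set.ofPred_forall]
    refine MeasurableSet.iInter fun i => MeasurableSet.inter ?_ ?_
    · exact measurableSet_lt (f := fun p : (Fin (n + 1) → ℝ) × (Fin n → ℝ) => p.2 i)
        (g := fun p => p.1 i.castSucc) (by fun_prop) (by fun_prop)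
    · exact measurableSet_lt (f := fun p : (Fin (n + 1) → ℝ) × (Fin n → ℝ) => p.1 i.succ)
        (g := fun p => p.2 i) (by fun_prop) (by fun_prop)

theorem measurable_daD (θ : ℝ) (b : Fin (n + 1) → ℝ) : Measurable (daD θ b) :=
  (measurable_daD_uncurry θ).comp (measurable_const.prodMk measurable_id)

theorem vdm_nonneg (a : Fin n → ℝ) : 0 ≤ vdm a := by
  refine prod_nonneg fun i _ => prod_nonneg fun j _ => ?_
  split_ifs <;> positivity

theorem daD_nonneg {θ : ℝ} (hθ : 0 < θ) (b : Fin (n + 1) → ℝ) (a : Fin n → ℝ) : 0 ≤ daD θ b a := by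
  refine Set.indicator_nonneg (fun a _ => ?_) a
  have h1 := Real.Gamma_pos_of_pos hθ
  have h2 : 0 < Real.Gamma ((n + 1) * θ) := Real.Gamma_pos_of_pos (by positivity)
  have h3 := vdm_nonneg a
  have h4 := vdm_nonneg b
  have h5 : 0 ≤ ∏ i, ∏ j, |b i - a j| ^ (θ - 1) :=
    prod_nonneg fun i _ => prod_nonneg fun j _ => by positivity
  positivity

theorem isOpen_daSet (b : Fin (n + 1) → ℝ) : IsOpen (daSet b) := by
  refine IsOpen.inter (isOpen_lt continuous_const (continuous_apply 0)) ?_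
  exact (isOpen_interlaces b).preimage (by unfold Fin.tail; fun_prop)

theorem prod_daMap {b : Fin (n + 1) → ℝ} (hb : StrictAnti b) {z : Fin (n + 1) → ℝ}
    (hz : z ∈ daSet b) :
    ∏ i, daMap b z i = z 0 ^ (n + 1) * (∏ i, ∏ j : Fin n, |b i - z j.succ|) / vdm b ^ 2 := by
  have h : ∀ i, daMap b z i = z 0 * (∏ j : Fin n, |b i - z j.succ|) /
      ∏ j : Fin n, |b i - b (i.succAbove j)| := by
    intro i
    rw [← abs_of_pos (daMap_pos hb hz i), daMap, abs_div, abs_mul, abs_prod, abs_prod,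
      abs_of_pos hz.1]
  simp only [h, prod_div_distrib, prod_mul_distrib, prod_prod_abs_sub_succAbove, prod_const,
    card_univ, Fintype.card_fin]

theorem density_daMap {θ : ℝ} (hθ : 0 < θ) {b : Fin (n + 1) → ℝ} (hb : StrictAnti b)
    {z : Fin (n + 1) → ℝ} (hz : z ∈ daSet b) :
    |(daJac b z).det| * ∏ i, gamD θ (daMap b z i)
      = gamD ((n + 1) * θ) (z 0) * daD θ b (Fin.tail z) := by
  have hz0 := hz.1
  have hv := vdm_pos hb.injective
  have hg : 0 < Real.Gamma ((n + 1) * θ) := Real.Gamma_pos_of_pos (by positivity)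
  have hg' := Real.Gamma_pos_of_pos hθ
  have hX : 0 < ∏ i, ∏ j : Fin n, |b i - z j.succ| := by
    refine prod_pos fun i _ => prod_pos fun j _ => abs_pos.2 (sub_ne_zero.2 ?_)
    rcases lt_or_ge j.castSucc i with h | h
    · exact (hz.2.lt_of_lt hb h).ne
    · exact (hz.2.lt_of_le hb h).ne'
  have h1 : ∏ i, gamD θ (daMap b z i)
      = (∏ i, daMap b z i) ^ (θ - 1) * Real.exp (-z 0) / Real.Gamma θ ^ (n + 1) := by
    simp only [fun i => gamD_of_pos θ (daMap_pos hb hz i), prod_div_distrib, prod_mul_distrib,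
      prod_const, card_univ, Fintype.card_fin]
    rw [Real.finsetProd_rpow _ _ fun i _ => (daMap_pos hb hz i).le, ← Real.exp_sum,
      sum_neg_distrib, sum_daMap hb]
  have h2 : ∏ i, ∏ j : Fin n, |b i - z j.succ| ^ (θ - 1)
      = (∏ i, ∏ j : Fin n, |b i - z j.succ|) ^ (θ - 1) := by
    rw [← Real.finsetProd_rpow _ _ fun i _ => by positivity]
    exact prod_congr rfl fun i _ => Real.finsetProd_rpow _ _ (fun j _ => abs_nonneg _) _
  have h3 : daD θ b (Fin.tail z) = Real.Gamma ((n + 1) * θ) / Real.Gamma θ ^ (n + 1) *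
      vdm b ^ (1 - 2 * θ) * (vdm (Fin.tail z) * (∏ i, ∏ j : Fin n, |b i - z j.succ|) ^ (θ - 1)) := by
    rw [daD, Set.indicator_of_mem hz.2, ← h2]
    rfl
  rw [h1, h3, abs_det_daJac hb hz, prod_daMap hb hz, gamD_of_pos _ hz0,
    Real.div_rpow (by positivity) (by positivity), Real.mul_rpow (by positivity) hX.le]
  have e1 : z 0 ^ ((n + 1) * θ - 1) = z 0 ^ n * (z 0 ^ (n + 1)) ^ (θ - 1) := by
    rw [← Real.rpow_natCast, ← Real.rpow_natCast, ← Real.rpow_mul hz0.le, ← Real.rpow_add hz0]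
    congr 1
    push_cast
    ring
  have e2 : vdm b ^ (1 - 2 * θ) = (vdm b)⁻¹ / (vdm b ^ 2) ^ (θ - 1) := by
    rw [← Real.rpow_natCast (vdm b) 2, ← Real.rpow_mul hv.le, ← Real.rpow_neg_one,
      ← Real.rpow_sub hv]
    congr 1
    push_cast
    ring
  rw [e1, e2]
  field_simp

theorem measurable_daMap (b : Fin (n + 1) → ℝ) : Measurable (daMap b) := by
  unfold daMap
  refine measurable_pi_lambda _ fun i => ?_
  refine Measurable.div_const (Measurable.mul (measurable_pi_apply 0) ?_) _
  exact Finset.measurable_prod _ fun j _ => by fun_prop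

theorem lintegral_gamPi_succ {θ : ℝ} (hθ : 0 < θ) {b : Fin (n + 1) → ℝ} (hb : StrictAnti b)
    {g : (Fin (n + 1) → ℝ) → ℝ≥0∞} (hg : Measurable g) :
    ∫⁻ γ, g γ ∂gamPi θ (n + 1)
      = ∫⁻ a, ∫⁻ s, g (daMap b (Fin.cons s a)) ∂gamM ((n + 1) * θ) ∂daK θ b := by
  have hm1 : Measurable fun γ : Fin (n + 1) → ℝ => ENNReal.ofReal (∏ i, gamD θ (γ i)) :=
    (Finset.measurable_prod _ fun i _ =>
      (measurable_gamD θ).comp (measurable_pi_apply i)).ennreal_ofReal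
  have hpos : MeasurableSet {γ : Fin (n + 1) → ℝ | ∀ i, 0 < γ i} := by
    simp only [Set.ofPred_forall]
    exact MeasurableSet.iInter fun i => measurableSet_lt measurable_const (measurable_pi_apply i)
  have h1 : ∫⁻ γ, g γ ∂gamPi θ (n + 1)
      = ∫⁻ γ in daMap b '' daSet b, ENNReal.ofReal (∏ i, gamD θ (γ i)) * g γ := by
    rw [gamPi, lintegral_withDensity_eq_lintegral_mul _ hm1 hg, image_daMap hb,
      ← lintegral_indicator hpos]
    refine lintegral_congr fun γ => ?_
    by_cases h : ∀ i, 0 < γ i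
    · rw [Set.indicator_of_mem (by exact h)]; rfl
    · rw [Set.indicator_of_notMem (by exact h)]
      push Not at h
      obtain ⟨i, hi⟩ := h
      simp [prod_eq_zero (f := fun i => gamD θ (γ i)) (mem_univ i) (gamD_of_not_pos θ hi.not_gt)]
  rw [h1, lintegral_image_eq_lintegral_abs_det_fderiv_mul _ (isOpen_daSet b).measurableSet
    (fun z _ => (hasFDerivAt_daMap b z).hasFDerivWithinAt) (injOn_daMap hb)]
  have hα : (0 : ℝ) < (n + 1) * θ := by positivity
  have h2 : ∫⁻ z in daSet b, ENNReal.ofReal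
        |((Matrix.toLin' (daJac b z)).toContinuousLinearMap : (Fin (n + 1) → ℝ) →L[ℝ] _).det| *
        (ENNReal.ofReal (∏ i, gamD θ (daMap b z i)) * g (daMap b z))
      = ∫⁻ z, ENNReal.ofReal (daD θ b (Fin.tail z)) *
        (ENNReal.ofReal (gamD ((n + 1) * θ) (z 0)) * g (daMap b z)) := by
    rw [← lintegral_indicator (isOpen_daSet b).measurableSet]
    refine lintegral_congr fun z => ?_
    by_cases h : z ∈ daSet b
    · rw [Set.indicator_of_mem h, ContinuousLinearMap.det, LinearMap.coe_toContinuousLinearMap,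
        LinearMap.det_toLin', ← mul_assoc, ← mul_assoc, ← ENNReal.ofReal_mul (abs_nonneg _),
        density_daMap hθ hb h, mul_comm (gamD _ _), ENNReal.ofReal_mul (daD_nonneg hθ _ _)]
    · rw [Set.indicator_of_notMem h]
      have : ¬ 0 < z 0 ∨ ¬ Interlaces (Fin.tail z) b := by
        by_contra hc
        push Not at hc
        exact h hc
      rcases this with h | h
      · simp [gamD_of_not_pos _ h]
      · rw [daD, Set.indicator_of_notMem (by exact h)]; simp
  rw [h2]
  have hmp := (volume_preserving_piFinSuccAbove (fun _ : Fin (n + 1) => ℝ) 0).symm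
  rw [← hmp.lintegral_comp_emb (MeasurableEquiv.measurableEmbedding _), Measure.volume_eq_prod]
  have hcons : ∀ p : ℝ × (Fin n → ℝ),
      (MeasurableEquiv.piFinSuccAbove (fun _ : Fin (n + 1) => ℝ) 0).symm p
        = (Fin.cons p.1 p.2 : Fin (n + 1) → ℝ) := by
    intro p
    simp [MeasurableEquiv.piFinSuccAbove, Fin.insertNthEquiv]
  have hcm : Measurable fun p : ℝ × (Fin n → ℝ) => (Fin.cons p.1 p.2 : Fin (n + 1) → ℝ) := by
    simp only [← hcons]
    exact MeasurableEquiv.measurable _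
  have hgm : Measurable fun p : ℝ × (Fin n → ℝ) => g (daMap b (Fin.cons p.1 p.2)) :=
    hg.comp ((measurable_daMap b).comp hcm)
  simp only [hcons, Fin.tail_cons, Fin.cons_zero]
  have hD := (measurable_daD θ b).ennreal_ofReal
  have hG := (measurable_gamD ((n + 1) * θ)).ennreal_ofReal
  rw [lintegral_prod_symm']
  · rw [daK, lintegral_withDensity_eq_lintegral_mul _ hD]
    · refine lintegral_congr fun a => ?_
      have hga : Measurable fun s => g (daMap b (Fin.cons s a)) :=
        hgm.comp (measurable_id.prodMk measurable_const)
      change ∫⁻ x, ENNReal.ofReal (daD θ b a) * (ENNReal.ofReal (gamD ((n + 1) * θ) x) *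
        g (daMap b (Fin.cons x a))) = ENNReal.ofReal (daD θ b a) *
          ∫⁻ s, g (daMap b (Fin.cons s a)) ∂gamM ((n + 1) * θ)
      rw [gamM, lintegral_withDensity_eq_lintegral_mul _ hG hga]
      exact lintegral_const_mul _ (hG.mul hga)
    · have : SFinite (gamM ((n + 1) * θ)) := by unfold gamM; infer_instance
      exact (hgm.comp measurable_swap).lintegral_prod_right'
  · exact (hD.comp measurable_snd).mul ((hG.comp measurable_fst).mul hgm)

end DixonAndersonMeasure

section GammaLaw

open Finset

variable {n : ℕ}

theorem lintegral_pi_prod {n : ℕ} (μ : Fin n → Measure ℝ) [∀ i, SigmaFinite (μ i)]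
    {f : Fin n → ℝ → ℝ≥0∞} (hf : ∀ i, Measurable (f i)) :
    ∫⁻ x, ∏ i, f i (x i) ∂Measure.pi μ = ∏ i, ∫⁻ x, f i x ∂μ i := by
  induction n with
  | zero => simp
  | succ n ih =>
    have hmp := (measurePreserving_piFinSuccAbove (α := fun _ => ℝ) μ 0).symm
    rw [← hmp.lintegral_comp_emb (MeasurableEquiv.measurableEmbedding _), Fin.prod_univ_succ,
      ← ih (fun i => μ i.succ) (fun i => hf i.succ)]
    have h := lintegral_prod_mul (μ := μ 0) (ν := Measure.pi fun i : Fin n => μ i.succ)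
      (f := f 0) (g := fun x => ∏ i : Fin n, f i.succ (x i)) (hf 0).aemeasurable
      (Finset.measurable_prod _ fun i _ => (hf _).comp (measurable_pi_apply i)).aemeasurable
    rw [← h]
    refine lintegral_congr fun p => ?_
    rw [Fin.prod_univ_succ]
    simp [MeasurableEquiv.piFinSuccAbove, Fin.insertNthEquiv]

theorem lintegral_rpow_mul_exp {p r : ℝ} (hp : 0 < p) (hr : 0 < r) :
    ∫⁻ x in Set.Ioi 0, ENNReal.ofReal (x ^ (p - 1) * Real.exp (-(r * x)))
      = ENNReal.ofReal (r ^ (-p) * Real.Gamma p) := by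
  have h := Real.integral_rpow_mul_exp_neg_mul_Ioi hp hr
  have hne : (1 / r) ^ p * Real.Gamma p ≠ 0 :=
    (mul_pos (by positivity) (Real.Gamma_pos_of_pos hp)).ne'
  rw [← ofReal_integral_eq_lintegral_ofReal, h, one_div, Real.inv_rpow hr.le, Real.rpow_neg hr.le]
  · by_contra hc
    exact hne (h.symm.trans (integral_undef hc))
  · refine (ae_restrict_iff' measurableSet_Ioi).2 (ae_of_all _ fun x hx => ?_)
    have : (0 : ℝ) < x := hx
    show 0 ≤ x ^ (p - 1) * Real.exp (-(r * x))
    positivity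

theorem lintegral_gamM (α : ℝ) {g : ℝ → ℝ≥0∞} (hg : Measurable g) :
    ∫⁻ x, g x ∂gamM α
      = ∫⁻ x in Set.Ioi 0, ENNReal.ofReal (x ^ (α - 1) * Real.exp (-x) / Real.Gamma α) * g x := by
  rw [gamM, lintegral_withDensity_eq_lintegral_mul _ (measurable_gamD α).ennreal_ofReal hg,
    ← lintegral_indicator measurableSet_Ioi]
  refine lintegral_congr fun x => ?_
  by_cases hx : x ∈ Set.Ioi (0 : ℝ)
  · rw [Set.indicator_of_mem hx, Pi.mul_apply, gamD_of_pos α hx]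
  · rw [Set.indicator_of_notMem hx, Pi.mul_apply, gamD_of_not_pos α hx]
    simp

theorem lintegral_rpow_mul_exp_gamM {α q t : ℝ} (hα : 0 < α) (hq : 0 < α + q) (ht : 0 < 1 + t) :
    ∫⁻ x, ENNReal.ofReal (x ^ q * Real.exp (-(t * x))) ∂gamM α
      = ENNReal.ofReal ((1 + t) ^ (-(α + q)) * (Real.Gamma (α + q) / Real.Gamma α)) := by
  have hG := Real.Gamma_pos_of_pos hα
  rw [lintegral_gamM α (by fun_prop), mul_div_assoc', div_eq_inv_mul,
    ENNReal.ofReal_mul (by positivity), ← lintegral_rpow_mul_exp hq ht,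
    ← lintegral_const_mul _ (by fun_prop)]
  refine setLIntegral_congr_fun measurableSet_Ioi fun x hx => ?_
  have hx : (0 : ℝ) < x := hx
  rw [← ENNReal.ofReal_mul (by positivity), ← ENNReal.ofReal_mul (by positivity)]
  congr 1
  rw [show α + q - 1 = (α - 1) + q by ring, Real.rpow_add hx,
    show -((1 + t) * x) = -x + -(t * x) by ring, Real.exp_add]
  ring

theorem lintegral_exp_gamM {α t : ℝ} (hα : 0 < α) (ht : 0 < 1 + t) :
    ∫⁻ x, ENNReal.ofReal (Real.exp (-(t * x))) ∂gamM α = ENNReal.ofReal ((1 + t) ^ (-α)) := by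
  have h := lintegral_rpow_mul_exp_gamM (q := 0) hα (by simpa using hα) ht
  simpa [div_self (Real.Gamma_pos_of_pos hα).ne'] using h

theorem lintegral_rpow_gamM {α q : ℝ} (hα : 0 < α) (hq : 0 < α + q) :
    ∫⁻ x, ENNReal.ofReal (x ^ q) ∂gamM α
      = ENNReal.ofReal (Real.Gamma (α + q) / Real.Gamma α) := by
  have h := lintegral_rpow_mul_exp_gamM (t := 0) hα hq (by simp)
  simpa using h

theorem isProbabilityMeasure_gamM {α : ℝ} (hα : 0 < α) : IsProbabilityMeasure (gamM α) := by
  constructor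
  have h := lintegral_exp_gamM (t := 0) hα (by simp)
  simpa using h

theorem gamM_Iic (α : ℝ) : gamM α (Set.Iic 0) = 0 := by
  rw [gamM, withDensity_apply _ measurableSet_Iic]
  refine (lintegral_eq_zero_iff (measurable_gamD α).ennreal_ofReal).2 ?_
  refine (ae_restrict_iff' measurableSet_Iic).2 (ae_of_all _ fun x hx => ?_)
  simp [gamD_of_not_pos α (not_lt.2 hx)]

theorem ae_pos_gamM (α : ℝ) : ∀ᵐ x ∂gamM α, 0 < x := by
  rw [ae_iff]
  simpa [Set.Iic, not_lt] using gamM_Iic α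

theorem Gamma_add_natCast_div {α : ℝ} (hα : 0 < α) (r : ℕ) :
    Real.Gamma (α + r) / Real.Gamma α = rf α r := by
  have hG := (Real.Gamma_pos_of_pos hα).ne'
  induction r with
  | zero => simp [rf_zero, div_self hG]
  | succ r ih =>
    rw [rf_succ, ← ih, Nat.cast_succ, ← add_assoc, Real.Gamma_add_one (by positivity)]
    ring

theorem lintegral_pow_gamM {α : ℝ} (hα : 0 < α) (r : ℕ) :
    ∫⁻ x, ENNReal.ofReal (x ^ r) ∂gamM α = ENNReal.ofReal (rf α r) := by
  have h := lintegral_rpow_gamM (q := r) hα (by positivity)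
  simpa [Gamma_add_natCast_div hα] using h

theorem integrable_pow_gamM {α : ℝ} (hα : 0 < α) (r : ℕ) :
    Integrable (fun x : ℝ => x ^ r) (gamM α) := by
  refine ⟨by fun_prop, ?_⟩
  have h : ∫⁻ x, ‖x ^ r‖ₑ ∂gamM α = ∫⁻ x, ENNReal.ofReal (x ^ r) ∂gamM α := by
    refine lintegral_congr_ae ((ae_pos_gamM α).mono fun x hx => ?_)
    exact Real.enorm_of_nonneg (by positivity)
  rw [HasFiniteIntegral, h, lintegral_pow_gamM hα]
  exact ENNReal.ofReal_lt_top

theorem integral_pow_gamM {α : ℝ} (hα : 0 < α) (r : ℕ) : ∫ x, x ^ r ∂gamM α = rf α r := by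
  rw [integral_eq_lintegral_of_nonneg_ae ((ae_pos_gamM α).mono fun x hx => by positivity)
    (by fun_prop), lintegral_pow_gamM hα, ENNReal.toReal_ofReal (rf_pos hα r).le]

theorem gamPi_eq_pi {θ : ℝ} (hθ : 0 < θ) (n : ℕ) :
    gamPi θ n = Measure.pi fun _ : Fin n => gamM θ := by
  have := isProbabilityMeasure_gamM hθ
  refine (Measure.pi_eq fun s hs => ?_).symm
  rw [gamPi, withDensity_apply _ (MeasurableSet.univ_pi hs),
    ← lintegral_indicator (MeasurableSet.univ_pi hs)]
  have h := lintegral_pi_prod (fun _ : Fin n => (volume : Measure ℝ))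
    (f := fun i => (s i).indicator fun x => ENNReal.ofReal (gamD θ x))
    (fun i => (measurable_gamD θ).ennreal_ofReal.indicator (hs i))
  rw [volume_pi]
  refine Eq.trans (lintegral_congr fun x => ?_) (h.trans (prod_congr rfl fun i _ => ?_))
  · by_cases hx : x ∈ Set.univ.pi s
    · rw [Set.indicator_of_mem hx, ENNReal.ofReal_prod_of_nonneg fun i _ => gamD_nonneg hθ _]
      exact prod_congr rfl fun i _ => by rw [Set.indicator_of_mem (hx i trivial)]
    · rw [Set.indicator_of_notMem hx]
      simp only [Set.mem_pi, Set.mem_univ, true_imp_iff, not_forall] at hx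
      obtain ⟨i, hi⟩ := hx
      exact (prod_eq_zero (mem_univ i) (by rw [Set.indicator_of_notMem hi])).symm
  · rw [lintegral_indicator (hs i), gamM, withDensity_apply _ (hs i)]

theorem isProbabilityMeasure_gamPi {θ : ℝ} (hθ : 0 < θ) (n : ℕ) :
    IsProbabilityMeasure (gamPi θ n) := by
  have := isProbabilityMeasure_gamM hθ
  rw [gamPi_eq_pi hθ]
  infer_instance

theorem ae_pos_gamPi {θ : ℝ} (hθ : 0 < θ) (n : ℕ) : ∀ᵐ γ ∂gamPi θ n, ∀ i, 0 < γ i := by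
  have := isProbabilityMeasure_gamM hθ
  rw [gamPi_eq_pi hθ, ae_all_iff]
  intro i
  exact (Measure.quasiMeasurePreserving_eval (μ := fun _ : Fin n => gamM θ) i).ae (ae_pos_gamM θ)

theorem lintegral_exp_gamPi {θ : ℝ} (hθ : 0 < θ) {t : Fin n → ℝ} (ht : ∀ i, 0 < 1 + t i) :
    ∫⁻ γ, ENNReal.ofReal (Real.exp (-∑ i, t i * γ i)) ∂gamPi θ n
      = ENNReal.ofReal (∏ i, (1 + t i) ^ (-θ)) := by
  have := isProbabilityMeasure_gamM hθ
  have h := lintegral_pi_prod (fun _ : Fin n => gamM θ)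
    (f := fun i x => ENNReal.ofReal (Real.exp (-(t i * x)))) (fun i => by fun_prop)
  rw [gamPi_eq_pi hθ, ENNReal.ofReal_prod_of_nonneg fun i _ => (Real.rpow_pos_of_pos (ht i) _).le]
  simp only [lintegral_exp_gamM hθ (ht _)] at h
  rw [← h]
  refine lintegral_congr fun x => ?_
  rw [← ENNReal.ofReal_prod_of_nonneg fun i _ => (Real.exp_pos _).le, ← Real.exp_sum,
    sum_neg_distrib]

theorem integrable_prod_pow_gamPi {θ : ℝ} (hθ : 0 < θ) (k : Fin n → ℕ) :
    Integrable (fun γ : Fin n → ℝ => ∏ i, γ i ^ k i) (gamPi θ n) := by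
  have := isProbabilityMeasure_gamM hθ
  rw [gamPi_eq_pi hθ]
  exact Integrable.fintype_prod (f := fun i (x : ℝ) => x ^ k i) fun i => integrable_pow_gamM hθ _

theorem integral_prod_pow_gamPi {θ : ℝ} (hθ : 0 < θ) (k : Fin n → ℕ) :
    ∫ γ, ∏ i, γ i ^ k i ∂gamPi θ n = ∏ i, rf θ (k i) := by
  have := isProbabilityMeasure_gamM hθ
  rw [gamPi_eq_pi hθ, integral_fintype_prod_eq_prod (fun i (x : ℝ) => x ^ k i)]
  simp only [integral_pow_gamM hθ]

theorem measurable_daMap_cons (b : Fin (n + 1) → ℝ) :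
    Measurable fun p : ℝ × (Fin n → ℝ) => daMap b (Fin.cons p.1 p.2) := by
  refine (measurable_daMap b).comp (measurable_pi_lambda _ fun i => ?_)
  induction i using Fin.cases <;> simp <;> fun_prop

theorem daMap_cons (b : Fin (n + 1) → ℝ) (s : ℝ) (a : Fin n → ℝ) :
    daMap b (Fin.cons s a) = s • daMap b (Fin.cons 1 a) := by
  ext i
  simp [daMap, mul_div_assoc]

instance sFinite_daK (θ : ℝ) (b : Fin (n + 1) → ℝ) : SFinite (daK θ b) := by
  unfold daK; infer_instance

instance sFinite_gamM (α : ℝ) : SFinite (gamM α) := by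
  unfold gamM; infer_instance

theorem lintegral_gamPi_mul {θ : ℝ} (hθ : 0 < θ) {b : Fin (n + 1) → ℝ} (hb : StrictAnti b)
    {g : ℝ → ℝ≥0∞} (hg : Measurable g) {h : (Fin (n + 1) → ℝ) → ℝ≥0∞} (hh : Measurable h)
    (hs : ∀ s : ℝ, 0 < s → ∀ γ, h (s • γ) = h γ) :
    ∫⁻ γ, g (∑ i, γ i) * h γ ∂gamPi θ (n + 1)
      = (∫⁻ s, g s ∂gamM ((n + 1) * θ)) * ∫⁻ a, h (daMap b (Fin.cons 1 a)) ∂daK θ b := by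
  rw [lintegral_gamPi_succ hθ hb (by fun_prop)]
  have hm : Measurable fun a : Fin n → ℝ => h (daMap b (Fin.cons 1 a)) :=
    hh.comp ((measurable_daMap_cons b).comp (measurable_const.prodMk measurable_id))
  rw [← lintegral_const_mul _ hm]
  refine lintegral_congr fun a => ?_
  rw [← lintegral_mul_const _ hg]
  refine lintegral_congr_ae ((ae_pos_gamM _).mono fun s hs0 => ?_)
  beta_reduce
  rw [sum_daMap hb, Fin.cons_zero, daMap_cons, hs s hs0]

theorem isProbabilityMeasure_daK {θ : ℝ} (hθ : 0 < θ) {b : Fin (n + 1) → ℝ} (hb : StrictAnti b) :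
    IsProbabilityMeasure (daK θ b) := by
  have h1 := isProbabilityMeasure_gamM (α := (n + 1) * θ) (by positivity)
  have h2 := isProbabilityMeasure_gamPi hθ (n + 1)
  have h := lintegral_gamPi_mul hθ hb (g := fun _ => 1) measurable_const (h := fun _ => 1)
    measurable_const (fun _ _ _ => rfl)
  simp only [lintegral_const, measure_univ, mul_one, one_mul] at h
  exact ⟨h.symm⟩

theorem ae_interlaces_daK (θ : ℝ) (b : Fin (n + 1) → ℝ) : ∀ᵐ a ∂daK θ b, Interlaces a b := by
  rw [ae_iff, daK]
  change (volume.withDensity fun a => ENNReal.ofReal (daD θ b a)) {a | Interlaces a b}ᶜ = 0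
  rw [withDensity_apply _ (isOpen_interlaces b).measurableSet.compl]
  refine (lintegral_eq_zero_iff (measurable_daD θ b).ennreal_ofReal).2 ?_
  refine (ae_restrict_iff' (isOpen_interlaces b).measurableSet.compl).2 (ae_of_all _ fun x hx => ?_)
  simp only [daD, Pi.zero_apply, Set.indicator_of_notMem hx, ENNReal.ofReal_zero]

theorem gamPi_eq_map {θ : ℝ} (hθ : 0 < θ) {b : Fin (n + 1) → ℝ} (hb : StrictAnti b) :
    gamPi θ (n + 1) = ((gamM ((n + 1) * θ)).prod (daK θ b)).map
      fun p => daMap b (Fin.cons p.1 p.2) := by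
  refine Measure.ext_of_lintegral _ fun g hg => ?_
  rw [lintegral_gamPi_succ hθ hb hg, lintegral_map hg (measurable_daMap_cons b)]
  exact (lintegral_prod_symm' _ (hg.comp (measurable_daMap_cons b))).symm

end GammaLaw

section DirichletMoments

open Finset ProbabilityTheory

variable {n : ℕ}

theorem Interlaces.norm_le {a : Fin n → ℝ} {b : Fin (n + 1) → ℝ} (h : Interlaces a b) :
    ‖a‖ ≤ ‖b‖ := by
  refine (pi_norm_le_iff_of_nonneg (norm_nonneg _)).2 fun i => ?_
  have h1 := abs_le.1 (norm_le_pi_norm b i.castSucc)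
  have h2 := abs_le.1 (norm_le_pi_norm b i.succ)
  exact abs_le.2 ⟨by linarith [(h i).2], by linarith [(h i).1]⟩

theorem one_sub_mul_pos {x : ℝ} {a : Fin n → ℝ} {B : ℝ} (ha : ‖a‖ ≤ B) (hx : |x| * B < 1)
    (j : Fin n) : 0 < 1 - x * a j := by
  have h1 : |x * a j| ≤ |x| * B := by
    rw [abs_mul]
    exact mul_le_mul_of_nonneg_left ((norm_le_pi_norm a j).trans ha) (abs_nonneg _)
  linarith [le_abs_self (x * a j)]

/-- The Laplace transform of `⟨γ, d⟩ ^ (-θ) exp ⟨γ, e⟩` for independent Gamma variables. -/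
theorem lintegral_rpow_neg_mul_exp_gamPi {θ : ℝ} (hθ : 0 < θ) (hn : 0 < n) {d e : Fin n → ℝ}
    (hd : ∀ i, 0 < d i) (he : ∀ i, e i < 1) :
    ENNReal.ofReal (Real.Gamma θ) * ∫⁻ γ, ENNReal.ofReal ((∑ i, d i * γ i) ^ (-θ) *
        Real.exp (∑ i, e i * γ i)) ∂gamPi θ n
      = ∫⁻ u in Set.Ioi 0, ENNReal.ofReal (u ^ (θ - 1) * ∏ i, (1 + (u * d i - e i)) ^ (-θ)) := by
  have hprob := isProbabilityMeasure_gamPi hθ n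
  have hΓ := Real.Gamma_pos_of_pos hθ
  rw [← lintegral_const_mul _ (by fun_prop)]
  have h1 : ∀ᵐ γ ∂gamPi θ n, ENNReal.ofReal (Real.Gamma θ) *
      ENNReal.ofReal ((∑ i, d i * γ i) ^ (-θ) * Real.exp (∑ i, e i * γ i))
      = ∫⁻ u in Set.Ioi 0, ENNReal.ofReal (u ^ (θ - 1) *
        Real.exp (-∑ i, (u * d i - e i) * γ i)) := by
    filter_upwards [ae_pos_gamPi hθ n] with γ hγ
    have hs : 0 < ∑ i, d i * γ i :=
      sum_pos (fun i _ => mul_pos (hd i) (hγ i)) ⟨⟨0, hn⟩, mem_univ _⟩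
    have h := lintegral_rpow_mul_exp hθ hs
    rw [← ENNReal.ofReal_mul hΓ.le, show Real.Gamma θ * ((∑ i, d i * γ i) ^ (-θ) *
        Real.exp (∑ i, e i * γ i)) = Real.exp (∑ i, e i * γ i) *
          ((∑ i, d i * γ i) ^ (-θ) * Real.Gamma θ) by ring,
      ENNReal.ofReal_mul (Real.exp_pos _).le, ← h, ← lintegral_const_mul _ (by fun_prop)]
    refine lintegral_congr fun u => ?_
    rw [← ENNReal.ofReal_mul (Real.exp_pos _).le, mul_left_comm, ← Real.exp_add]
    congr 3
    simp only [sub_mul, sum_sub_distrib, sum_mul]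
    rw [neg_sub, ← sub_eq_add_neg]
    congr 1
    exact sum_congr rfl fun i _ => by ring
  rw [lintegral_congr_ae h1, lintegral_lintegral_swap]
  · refine setLIntegral_congr_fun measurableSet_Ioi fun u hu => ?_
    have hu : (0 : ℝ) < u := hu
    have h2 := lintegral_exp_gamPi hθ (t := fun i => u * d i - e i)
      fun i => by nlinarith [mul_pos hu (hd i), he i]
    simp only [ENNReal.ofReal_mul (Real.rpow_nonneg hu.le _)]
    rw [lintegral_const_mul _ (by fun_prop), h2]
  · fun_prop

theorem lintegral_exp_daK_gamPi {θ : ℝ} (hθ : 0 < θ) (hn : 0 < n) {b : Fin (n + 1) → ℝ}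
    (hb : StrictAnti b) {x : ℝ} (hx : |x| * ‖b‖ < 1) :
    ENNReal.ofReal (Real.Gamma (n * θ) / Real.Gamma ((n + 1) * θ)) *
        ∫⁻ a, ∫⁻ γ, ENNReal.ofReal (Real.exp (x * ∑ i, γ i * a i)) ∂gamPi θ n ∂daK θ b
      = ∫⁻ γ, ENNReal.ofReal ((∑ i, γ i) ^ (-θ)) *
          ENNReal.ofReal (Real.exp (x * ∑ i, γ i * b i)) ∂gamPi θ (n + 1) := by
  have hΓ := Real.Gamma_pos_of_pos hθ
  have hnθ : 0 < n * θ := by positivity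
  have hb1 : ∀ i, 0 < 1 - x * b i := one_sub_mul_pos le_rfl hx
  set C : ℝ := ∏ i, (1 - x * b i) with hC
  have hC0 : 0 < C := prod_pos fun i _ => hb1 i
  have hsplit : ∀ i, C = (1 - x * b i) * ∏ j : Fin n, (1 - x * b (i.succAbove j)) := fun i =>
    Fin.prod_univ_succAbove _ i
  -- the left-hand side as an integral over Gamma variables
  have hL : ENNReal.ofReal (Real.Gamma (n * θ) / Real.Gamma ((n + 1) * θ)) *
        ∫⁻ a, ∫⁻ γ, ENNReal.ofReal (Real.exp (x * ∑ i, γ i * a i)) ∂gamPi θ n ∂daK θ b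
      = ∫⁻ γ, ENNReal.ofReal ((∑ i, γ i * ∏ j : Fin n, (1 - x * b (i.succAbove j))) ^ (-θ))
          ∂gamPi θ (n + 1) := by
    have hmom := lintegral_rpow_gamM (α := (n + 1) * θ) (q := -θ) (by positivity) (by linarith)
    rw [show ((n : ℝ) + 1) * θ + -θ = n * θ by ring] at hmom
    rw [lintegral_gamPi_succ hθ hb (by fun_prop), ← hmom,
      ← lintegral_const_mul' _ _ (by rw [hmom]; exact ENNReal.ofReal_ne_top)]
    refine lintegral_congr_ae ((ae_interlaces_daK θ b).mono fun a ha => ?_)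
    have ha1 : ∀ j, 0 < 1 - x * a j := one_sub_mul_pos ha.norm_le hx
    have h1 := lintegral_exp_gamPi hθ (t := fun i => -(x * a i)) fun i => by
      have := ha1 i; linarith
    have h2 : ∫⁻ γ, ENNReal.ofReal (Real.exp (x * ∑ i, γ i * a i)) ∂gamPi θ n
        = ENNReal.ofReal ((∏ j, (1 - x * a j)) ^ (-θ)) := by
      rw [← Real.finsetProd_rpow _ _ fun i _ => (ha1 i).le]
      simp only [sub_eq_add_neg]
      rw [← h1]
      refine lintegral_congr fun γ => ?_
      congr 2
      rw [mul_sum, ← sum_neg_distrib]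
      exact sum_congr rfl fun i _ => by ring
    beta_reduce
    rw [h2, ← lintegral_mul_const _ (by fun_prop)]
    refine lintegral_congr_ae ((ae_pos_gamM _).mono fun s hs => ?_)
    beta_reduce
    rw [sum_daMap_mul_prod hb, Fin.cons_zero,
      Real.mul_rpow hs.le (prod_nonneg fun j _ => by simpa using (ha1 j).le),
      ENNReal.ofReal_mul (by positivity)]
    simp
  rw [hL, ← ENNReal.mul_right_inj (a := ENNReal.ofReal (Real.Gamma θ)) (by simpa using hΓ)
    ENNReal.ofReal_ne_top]
  have hJ1 := lintegral_rpow_neg_mul_exp_gamPi hθ (Nat.succ_pos n) (d := fun i => (1 - x * b i)⁻¹)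
    (e := fun _ => 0) (fun i => inv_pos.2 (hb1 i)) (fun i => one_pos)
  have hJ2 := lintegral_rpow_neg_mul_exp_gamPi hθ (Nat.succ_pos n) (d := fun _ => 1)
    (e := fun i => x * b i) (fun i => one_pos) (fun i => by have := hb1 i; linarith)
  have hR : ∫⁻ γ, ENNReal.ofReal ((∑ i, γ i) ^ (-θ)) *
          ENNReal.ofReal (Real.exp (x * ∑ i, γ i * b i)) ∂gamPi θ (n + 1)
      = ∫⁻ γ, ENNReal.ofReal ((∑ i, (1 : ℝ) * γ i) ^ (-θ) * Real.exp (∑ i, x * b i * γ i))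
          ∂gamPi θ (n + 1) := by
    refine lintegral_congr_ae ((ae_pos_gamPi hθ _).mono fun γ hγ => ?_)
    have : 0 ≤ ∑ i, γ i := sum_nonneg fun i _ => (hγ i).le
    beta_reduce
    rw [← ENNReal.ofReal_mul (by positivity)]
    simp only [one_mul]
    congr 3
    rw [mul_sum]
    exact sum_congr rfl fun i _ => by ring
  have hL2 : ∫⁻ γ, ENNReal.ofReal ((∑ i, γ i * ∏ j : Fin n, (1 - x * b (i.succAbove j))) ^ (-θ))
          ∂gamPi θ (n + 1)
      = ENNReal.ofReal (C ^ (-θ)) * ∫⁻ γ, ENNReal.ofReal ((∑ i, (1 - x * b i)⁻¹ * γ i) ^ (-θ) *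
          Real.exp (∑ i, (0 : ℝ) * γ i)) ∂gamPi θ (n + 1) := by
    rw [← lintegral_const_mul _ (by fun_prop)]
    refine lintegral_congr_ae ((ae_pos_gamPi hθ _).mono fun γ hγ => ?_)
    have h0 : 0 ≤ ∑ i, (1 - x * b i)⁻¹ * γ i :=
      sum_nonneg fun i _ => mul_nonneg (inv_nonneg.2 (hb1 i).le) (hγ i).le
    beta_reduce
    rw [← ENNReal.ofReal_mul (by positivity)]
    simp only [zero_mul, sum_const_zero, Real.exp_zero, mul_one]
    rw [← Real.mul_rpow hC0.le h0, mul_sum]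
    congr 3 with i
    rw [hsplit i]
    field_simp [(hb1 i).ne']
  rw [hR, hJ2, hL2, mul_left_comm, hJ1, ← lintegral_const_mul' _ _ ENNReal.ofReal_ne_top]
  refine setLIntegral_congr_fun measurableSet_Ioi fun u hu => ?_
  have hu : (0 : ℝ) < u := hu
  have e1 : ∀ i, 0 < 1 + u * (1 - x * b i)⁻¹ := fun i => by have := hb1 i; positivity
  have e2 : ∀ i, 0 < 1 + (u * 1 - x * b i) := fun i => by have := hb1 i; linarith
  rw [← ENNReal.ofReal_mul (by positivity), mul_left_comm]
  simp only [sub_zero]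
  rw [Real.finsetProd_rpow _ _ fun i _ => (e1 i).le, Real.finsetProd_rpow _ _ fun i _ => (e2 i).le,
    ← Real.mul_rpow hC0.le (prod_nonneg fun i _ => (e1 i).le), hC, ← prod_mul_distrib]
  congr 3
  refine prod_congr rfl fun i _ => ?_
  have := (hb1 i).ne'
  field_simp
  ring

end DirichletMoments

section DirichletMomentIdentity

open Finset ProbabilityTheory

variable {n : ℕ}

/-- The moments of `∑ γᵢ bᵢ` for independent Gamma variables `γᵢ`. -/
def gamMoment (θ : ℝ) (d : ℕ) (b : Fin n → ℝ) : ℝ := ∫ γ, (∑ i, γ i * b i) ^ d ∂gamPi θ n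

/-- The moments of `∑ wᵢ bᵢ` for a Dirichlet vector `w`. -/
def dirMoment (θ : ℝ) (d : ℕ) (b : Fin n → ℝ) : ℝ := gamMoment θ d b / rf (n * θ) d

theorem integral_gamPi_succ {θ : ℝ} (hθ : 0 < θ) {b : Fin (n + 1) → ℝ} (hb : StrictAnti b)
    (q : ℝ) (d : ℕ) :
    ∫ γ, (∑ i, γ i) ^ q * (∑ i, γ i * b i) ^ d ∂gamPi θ (n + 1)
      = (∫ s, s ^ q * s ^ d ∂gamM ((n + 1) * θ)) *
        ∫ a, (∑ i, daMap b (Fin.cons 1 a) i * b i) ^ d ∂daK θ b := by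
  rw [gamPi_eq_map hθ hb, integral_map (measurable_daMap_cons b).aemeasurable (by fun_prop),
    ← integral_prod_mul]
  refine integral_congr_ae (ae_of_all _ fun p => ?_)
  beta_reduce
  rw [sum_daMap hb, Fin.cons_zero, daMap_cons, mul_assoc, ← mul_pow, mul_sum]
  congr 3
  simp only [Pi.smul_apply, smul_eq_mul, mul_assoc]

theorem dirMoment_succ {θ : ℝ} (hθ : 0 < θ) {b : Fin (n + 1) → ℝ} (hb : StrictAnti b) (d : ℕ) :
    dirMoment θ d b = ∫ a, (∑ i, daMap b (Fin.cons 1 a) i * b i) ^ d ∂daK θ b := by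
  have hα : 0 < ((n : ℝ) + 1) * θ := by positivity
  have h := integral_gamPi_succ hθ hb 0 d
  simp only [Real.rpow_zero, one_mul, integral_pow_gamM hα] at h
  rw [dirMoment, gamMoment, h, Nat.cast_succ, mul_div_cancel_left₀ _ (rf_pos hα d).ne']

theorem integral_rpow_mul_pow_gamM {α q : ℝ} (hα : 0 < α) (hq : 0 < α + q) (d : ℕ) :
    ∫ s, s ^ q * s ^ d ∂gamM α = Real.Gamma (α + q) / Real.Gamma α * rf (α + q) d := by
  have h := lintegral_rpow_gamM (q := q + d) hα (by linarith [(Nat.cast_nonneg d : (0 : ℝ) ≤ d)])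
  have h2 : ∫⁻ s, ENNReal.ofReal (s ^ q * s ^ d) ∂gamM α
      = ∫⁻ s, ENNReal.ofReal (s ^ (q + d)) ∂gamM α := by
    refine lintegral_congr_ae ((ae_pos_gamM α).mono fun s hs => ?_)
    beta_reduce
    rw [Real.rpow_add hs, Real.rpow_natCast]
  have hG := Real.Gamma_pos_of_pos hα
  have hG' := Real.Gamma_pos_of_pos hq
  have hG2 := rf_pos hq d
  rw [integral_eq_lintegral_of_nonneg_ae ((ae_pos_gamM α).mono fun s hs => by positivity)
    (by fun_prop), h2, h, ← add_assoc, ← Gamma_add_natCast_div hq] at *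
  rw [ENNReal.toReal_ofReal]
  · field_simp
  · refine div_nonneg (Real.Gamma_nonneg_of_nonneg ?_) hG.le
    positivity

variable {θ : ℝ} {b : Fin (n + 1) → ℝ}

theorem lintegral_exp_daK_gamPi_lt_top (hθ : 0 < θ) (hb : StrictAnti b)
    {x : ℝ} (hx : |x| * ‖b‖ < 1) :
    ∫⁻ a, ∫⁻ γ, ENNReal.ofReal (Real.exp (x * ∑ i, γ i * a i)) ∂gamPi θ n ∂daK θ b < ∞ := by
  have := isProbabilityMeasure_daK hθ hb
  have hle : ∀ᵐ a ∂daK θ b, ∫⁻ γ, ENNReal.ofReal (Real.exp (x * ∑ i, γ i * a i)) ∂gamPi θ n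
      ≤ ENNReal.ofReal (∏ _i : Fin n, (1 - |x| * ‖b‖) ^ (-θ)) := by
    filter_upwards [ae_interlaces_daK θ b] with a ha
    have ha1 : ∀ j, 0 < 1 - x * a j := one_sub_mul_pos ha.norm_le hx
    have h1 := lintegral_exp_gamPi hθ (t := fun i => -(x * a i)) fun i => by
      have := ha1 i; linarith
    have h2 : ∫⁻ γ, ENNReal.ofReal (Real.exp (x * ∑ i, γ i * a i)) ∂gamPi θ n
        = ENNReal.ofReal (∏ j, (1 + -(x * a j)) ^ (-θ)) := by
      rw [← h1]
      refine lintegral_congr fun γ => ?_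
      congr 2
      rw [mul_sum, ← sum_neg_distrib]
      exact sum_congr rfl fun i _ => by ring
    rw [h2]
    refine ENNReal.ofReal_le_ofReal (prod_le_prod (fun i _ => ?_) fun i _ => ?_)
    · exact Real.rpow_nonneg (by linarith [ha1 i]) _
    · refine Real.rpow_le_rpow_of_nonpos (by linarith) ?_ (by linarith)
      have h3 : |x * a i| ≤ |x| * ‖b‖ := by
        rw [abs_mul]
        exact mul_le_mul_of_nonneg_left ((norm_le_pi_norm a i).trans ha.norm_le) (abs_nonneg _)
      linarith [le_abs_self (x * a i)]
  refine (lintegral_mono_ae hle).trans_lt ?_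
  simp

theorem eventually_abs_mul_lt_one (B : ℝ) : ∀ᶠ x : ℝ in 𝓝 0, |x| * B < 1 := by
  have : Tendsto (fun x : ℝ => |x| * B) (𝓝 0) (𝓝 (|0| * B)) := by
    apply Continuous.tendsto; fun_prop
  rw [abs_zero, zero_mul] at this
  exact this.eventually (gt_mem_nhds one_pos)

theorem mem_integrableExpSet_iff {Ω : Type*} [MeasurableSpace Ω] {μ : Measure Ω} {X : Ω → ℝ}
    (hX : Measurable X) (x : ℝ) :
    x ∈ integrableExpSet X μ ↔ ∫⁻ ω, ENNReal.ofReal (Real.exp (x * X ω)) ∂μ < ∞ := by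
  have : ∫⁻ ω, ‖Real.exp (x * X ω)‖ₑ ∂μ = ∫⁻ ω, ENNReal.ofReal (Real.exp (x * X ω)) ∂μ :=
    lintegral_congr fun ω => Real.enorm_of_nonneg (Real.exp_pos _).le
  rw [← this]
  exact ⟨fun h => h.2, fun h => ⟨by fun_prop, h⟩⟩

theorem mgf_eq_toReal {Ω : Type*} [MeasurableSpace Ω] (μ : Measure Ω) {X : Ω → ℝ}
    (hX : Measurable X) (x : ℝ) :
    mgf X μ x = (∫⁻ ω, ENNReal.ofReal (Real.exp (x * X ω)) ∂μ).toReal :=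
  integral_eq_lintegral_of_nonneg_ae (ae_of_all _ fun _ => (Real.exp_pos _).le) (by fun_prop)

theorem integral_gamMoment (hθ : 0 < θ) (hn : 0 < n) (hb : StrictAnti b) (d : ℕ) :
    Integrable (fun a : Fin n → ℝ => gamMoment θ d a) (daK θ b) ∧
    ∫ a, gamMoment θ d a ∂daK θ b = rf (n * θ) d * dirMoment θ d b := by
  have hK := isProbabilityMeasure_daK hθ hb
  have hP := isProbabilityMeasure_gamPi hθ n
  have hP' := isProbabilityMeasure_gamPi hθ (n + 1)
  have hnθ : 0 < n * θ := by positivity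
  have hα : 0 < ((n : ℝ) + 1) * θ := by positivity
  set μ₁ := (daK θ b).prod (gamPi θ n)
  set X₁ : (Fin n → ℝ) × (Fin n → ℝ) → ℝ := fun p => ∑ i, p.2 i * p.1 i with hX₁
  have hX₁m : Measurable X₁ := by fun_prop
  set w : (Fin (n + 1) → ℝ) → ℝ≥0∞ := fun γ => ENNReal.ofReal ((∑ i, γ i) ^ (-θ)) with hw
  have hwm : Measurable w := by fun_prop
  set μ₂ := (gamPi θ (n + 1)).withDensity w
  set X₂ : (Fin (n + 1) → ℝ) → ℝ := fun γ => ∑ i, γ i * b i with hX₂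
  have hX₂m : Measurable X₂ := by fun_prop
  set c : ℝ := Real.Gamma (n * θ) / Real.Gamma ((n + 1) * θ) with hc
  have hc0 : 0 < c := div_pos (Real.Gamma_pos_of_pos hnθ) (Real.Gamma_pos_of_pos hα)
  have hl1 : ∀ x : ℝ, ∫⁻ p, ENNReal.ofReal (Real.exp (x * X₁ p)) ∂μ₁
      = ∫⁻ a, ∫⁻ γ, ENNReal.ofReal (Real.exp (x * ∑ i, γ i * a i)) ∂gamPi θ n ∂daK θ b :=
    fun x => lintegral_prod _ (by fun_prop)
  have hl2 : ∀ x : ℝ, |x| * ‖b‖ < 1 → ∫⁻ γ, ENNReal.ofReal (Real.exp (x * X₂ γ)) ∂μ₂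
      = ENNReal.ofReal c * ∫⁻ p, ENNReal.ofReal (Real.exp (x * X₁ p)) ∂μ₁ := by
    intro x hx
    rw [hl1, lintegral_exp_daK_gamPi hθ hn hb hx,
      lintegral_withDensity_eq_lintegral_mul _ hwm (by fun_prop)]
    rfl
  have hfin : ∀ x : ℝ, |x| * ‖b‖ < 1 → ∫⁻ p, ENNReal.ofReal (Real.exp (x * X₁ p)) ∂μ₁ < ∞ :=
    fun x hx => by rw [hl1]; exact lintegral_exp_daK_gamPi_lt_top hθ hb hx
  have hev := eventually_abs_mul_lt_one ‖b‖
  have h01 : (0 : ℝ) ∈ interior (integrableExpSet X₁ μ₁) := by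
    rw [mem_interior_iff_mem_nhds]
    filter_upwards [hev] with x hx
    exact (mem_integrableExpSet_iff hX₁m x).2 (hfin x hx)
  have h02 : (0 : ℝ) ∈ interior (integrableExpSet X₂ μ₂) := by
    rw [mem_interior_iff_mem_nhds]
    filter_upwards [hev] with x hx
    rw [mem_integrableExpSet_iff hX₂m, hl2 x hx]
    exact ENNReal.mul_lt_top ENNReal.ofReal_lt_top (hfin x hx)
  have hmgf : mgf X₂ μ₂ =ᶠ[𝓝 0] fun x => c * mgf X₁ μ₁ x := by
    filter_upwards [hev] with x hx
    rw [mgf_eq_toReal _ hX₂m, mgf_eq_toReal _ hX₁m, hl2 x hx, ENNReal.toReal_mul,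
      ENNReal.toReal_ofReal hc0.le]
  have hmom : ∫ γ, X₂ γ ^ d ∂μ₂ = c * ∫ p, X₁ p ^ d ∂μ₁ := by
    have h1 := iteratedDeriv_mgf_zero h01 d
    have h2 := iteratedDeriv_mgf_zero h02 d
    have h3 := hmgf.iteratedDeriv_eq d
    rw [h2, iteratedDeriv_const_mul_field, h1] at h3
    exact h3
  have hInt := integrable_pow_of_mem_interior_integrableExpSet h01 d
  have h2 : ∫ γ, X₂ γ ^ d ∂μ₂ = c * (rf (n * θ) d * dirMoment θ d b) := by
    rw [integral_withDensity_eq_integral_toReal_smul hwm (ae_of_all _ fun _ => ENNReal.ofReal_lt_top),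
      dirMoment_succ hθ hb]
    have h3 := integral_gamPi_succ hθ hb (-θ) d
    rw [integral_rpow_mul_pow_gamM hα (by linarith),
      show ((n : ℝ) + 1) * θ + -θ = n * θ by ring] at h3
    rw [← mul_assoc, ← h3]
    refine integral_congr_ae ((ae_pos_gamPi hθ _).mono fun γ hγ => ?_)
    have : 0 ≤ ∑ i, γ i := sum_nonneg fun i _ => (hγ i).le
    simp only [hw, hX₂, smul_eq_mul]
    rw [ENNReal.toReal_ofReal (by positivity)]
  refine ⟨hInt.integral_prod_left, ?_⟩
  rw [hmom, integral_prod _ hInt] at h2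
  exact mul_left_cancel₀ hc0.ne' h2

theorem integrable_dirMoment (hθ : 0 < θ) (hn : 0 < n) (hb : StrictAnti b) (d : ℕ) :
    Integrable (fun a : Fin n → ℝ => dirMoment θ d a) (daK θ b) :=
  (integral_gamMoment hθ hn hb d).1.div_const _

/-- The law of `⟨w, ·⟩` for Dirichlet `w` is preserved by the Dixon–Anderson kernel. -/
theorem integral_dirMoment (hθ : 0 < θ) (hn : 0 < n) (hb : StrictAnti b) (d : ℕ) :
    ∫ a, dirMoment θ d a ∂daK θ b = dirMoment θ d b := by
  have hnθ : 0 < n * θ := by positivity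
  simp only [dirMoment]
  rw [integral_div, (integral_gamMoment hθ hn hb d).2, mul_div_cancel_left₀ _ (rf_pos hnθ d).ne']
  rfl

end DirichletMomentIdentity

section Averaging

open MvPolynomial Finset

variable {n : ℕ} {θ : ℝ}

/-- Coordinatewise coercion of real vectors to complex vectors. -/
abbrev toC (b : Fin n → ℝ) : Fin n → ℂ := fun i => (b i : ℂ)

theorem toC_injective {b : Fin n → ℝ} (hb : StrictAnti b) : Function.Injective (toC b) :=
  fun _ _ h => hb.injective (Complex.ofReal_injective h)

theorem ringHom_es {A B ι : Type*} [CommRing A] [CommRing B] [DecidableEq ι] (φ : A →+* B)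
    (v : ι → A) (T : Finset ι) (k : ℕ) : φ (es v T k) = es (fun i => φ (v i)) T k := by
  simp only [es, map_sum, map_prod]

theorem eval_toSym (b : Fin n → ℂ) (f : MvPolynomial ℕ ℂ) :
    eval b (toSym f) = aeval (fun k => es b univ k) f := by
  rw [toSym, ← coe_aeval_eq_eval, RingHom.coe_coe, ← AlgHom.comp_apply, comp_aeval]
  congr 2
  funext k
  have := ringHom_es (aeval (R := ℂ) b : MvPolynomial (Fin n) ℂ →ₐ[ℂ] ℂ).toRingHom X univ k
  simpa using this

theorem eval_hatSub (γ b : Fin n → ℂ) (f : MvPolynomial ℕ ℂ) :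
    eval (Sum.elim γ b) (hatSub f) = aeval (fun k => eh b γ k) f := by
  rw [hatSub, ← coe_aeval_eq_eval, RingHom.coe_coe, ← AlgHom.comp_apply, comp_aeval]
  congr 2
  funext k
  simp only [eh, map_sum, map_mul, gX, aeval_X, Sum.elim_inl, es1]
  refine sum_congr rfl fun i _ => ?_
  have := ringHom_es (aeval (R := ℂ) (Sum.elim γ b) :
    MvPolynomial (Fin n ⊕ Fin n) ℂ →ₐ[ℂ] ℂ).toRingHom bX (univ.erase i) k
  simp only [AlgHom.toRingHom_eq_coe, RingHom.coe_coe] at this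
  rw [this]
  simp [bX]

theorem integral_eval_gamPi (hθ : 0 < θ) (b : Fin n → ℝ) (φ : MvPolynomial (Fin n ⊕ Fin n) ℂ) :
    Integrable (fun γ => eval (Sum.elim (toC γ) (toC b)) φ) (gamPi θ n) ∧
    ∫ γ, eval (Sum.elim (toC γ) (toC b)) φ ∂gamPi θ n = eval (toC b) (gE θ φ) := by
  induction φ using MvPolynomial.induction_on' with
  | monomial α c =>
    have h : ∀ γ : Fin n → ℝ, eval (Sum.elim (toC γ) (toC b)) (monomial α c)
        = ((∏ i, γ i ^ α (Sum.inl i) : ℝ) : ℂ) * (c * ∏ i, (b i : ℂ) ^ α (Sum.inr i)) := by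
      intro γ
      rw [eval_monomial, Finsupp.prod_fintype _ _ (by simp), Fintype.prod_sum_type]
      simp only [Sum.elim_inl, Sum.elim_inr]
      push_cast
      ring
    simp only [h]
    refine ⟨(integrable_prod_pow_gamPi hθ _).ofReal.mul_const _, ?_⟩
    rw [integral_mul_const, integral_complex_ofReal, integral_prod_pow_gamPi hθ, gE_monomial]
    simp only [map_mul, eval_C, map_prod, map_pow, eval_X]
    ring
  | add p q hp hq =>
    simp only [map_add]
    exact ⟨hp.1.add hq.1, by rw [integral_add hp.1 hq.1, hp.2, hq.2]⟩

theorem es1_eq_es_succAbove {A : Type*} [CommRing A] (b : Fin (n + 1) → A) (i : Fin (n + 1))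
    (k : ℕ) : es1 b i k = es (fun j => b (i.succAbove j)) univ k := by
  have h : (univ : Finset (Fin (n + 1))).erase i = univ.map i.succAboveEmb := by
    ext j
    simp only [mem_erase, mem_univ, and_true, Finset.mem_map, true_and, Fin.coe_succAboveEmb]
    exact Fin.exists_succAbove_eq_iff.symm
  rw [es1, es, h, powersetCard_map, sum_map]
  simp [es]

theorem eh_daMap {b : Fin (n + 1) → ℝ} (hb : StrictAnti b) (s : ℝ) (a : Fin n → ℝ) (k : ℕ) :
    eh (toC b) (toC (daMap b (Fin.cons s a))) k = s * es (toC a) univ k := by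
  have h := congrArg (fun x : ℝ => (x : ℂ)) (sum_daMap_mul_es hb (Fin.cons s a) k)
  have h1 := fun (l : ℕ) (v : Fin l → ℝ) => ringHom_es Complex.ofRealHom v univ k
  simp only [Complex.ofRealHom_eq_coe] at h1
  simp only [Complex.ofReal_sum, Complex.ofReal_mul, h1, Fin.cons_zero, Fin.tail_cons] at h
  rw [← h, eh]
  exact sum_congr rfl fun i _ => by rw [es1_eq_es_succAbove]

theorem aeval_smul_of_isHomogeneous {f : MvPolynomial ℕ ℂ} {r : ℕ} (hf : f.IsHomogeneous r)
    (s : ℂ) (u : ℕ → ℂ) : aeval (fun k => s * u k) f = s ^ r * aeval u f := by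
  rw [aeval_def, aeval_def, eval₂_eq, eval₂_eq, mul_sum]
  refine sum_congr rfl fun d hd => ?_
  have := hf (mem_support_iff.1 hd)
  change Finsupp.weight (fun _ => 1) d = r at this
  rw [← Finsupp.degree_eq_weight_one] at this
  simp only [mul_pow, prod_mul_distrib, prod_pow_eq_pow_sum]
  rw [← this, Finsupp.degree_apply]
  ring

/-- The action of the Dixon–Anderson kernel on a form of degree `r` in the elementary symmetric
polynomials. -/
def avg (θ : ℝ) (n r : ℕ) (f : MvPolynomial ℕ ℂ) : MvPolynomial (Fin (n + 1)) ℂ :=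
  ((rf ((n + 1) * θ) r : ℝ) : ℂ)⁻¹ • gE θ (hatSub f)

theorem integral_eval_toSym (hθ : 0 < θ) {b : Fin (n + 1) → ℝ} (hb : StrictAnti b)
    {f : MvPolynomial ℕ ℂ} {r : ℕ} (hf : f.IsHomogeneous r) :
    Integrable (fun a : Fin n → ℝ => eval (toC a) (toSym f)) (daK θ b) ∧
    ∫ a, eval (toC a) (toSym f) ∂daK θ b = eval (toC b) (avg θ n r f) := by
  have hα : 0 < ((n : ℝ) + 1) * θ := by positivity
  have h1 := isProbabilityMeasure_gamM hα
  have h2 := isProbabilityMeasure_daK hθ hb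
  have key : ∀ p : ℝ × (Fin n → ℝ),
      eval (Sum.elim (toC (daMap b (Fin.cons p.1 p.2))) (toC b)) (hatSub f)
        = (p.1 : ℂ) ^ r * eval (toC p.2) (toSym f) := by
    intro p
    rw [eval_hatSub]
    simp only [eh_daMap hb]
    rw [aeval_smul_of_isHomogeneous hf, eval_toSym]
  obtain ⟨hi, he⟩ := integral_eval_gamPi hθ b (hatSub f)
  have hm : AEMeasurable (fun p : ℝ × (Fin n → ℝ) => daMap b (Fin.cons p.1 p.2))
      ((gamM ((n + 1) * θ)).prod (daK θ b)) := (measurable_daMap_cons b).aemeasurable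
  rw [gamPi_eq_map hθ hb] at hi he
  have hi' := hi.comp_aemeasurable hm
  rw [integral_map hm hi.1] at he
  simp only [Function.comp_def, key] at hi' he
  have hmom : ∫ s, (s : ℂ) ^ r ∂gamM ((n + 1) * θ) = ((rf ((n + 1) * θ) r : ℝ) : ℂ) := by
    rw [← integral_pow_gamM hα, ← integral_complex_ofReal]
    simp
  have hne : ((rf ((n + 1) * θ) r : ℝ) : ℂ) ≠ 0 := by
    exact_mod_cast (rf_pos hα r).ne'
  constructor
  · have h3 := hi'.integral_prod_right
    simp only [integral_mul_const, hmom] at h3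
    simpa [hne] using h3.const_mul (((rf ((n + 1) * θ) r : ℝ) : ℂ)⁻¹)
  · rw [integral_prod_mul (fun s : ℝ => (s : ℂ) ^ r) (fun a => eval (toC a) (toSym f)), hmom] at he
    rw [avg, smul_eval, ← he, inv_mul_cancel_left₀ hne]

theorem aeval_es_transOp_succ (a : Fin n → ℂ) (c : ℂ) (f : MvPolynomial ℕ ℂ) (hc : c = n) :
    eval a (toSym (transOp c (n + 1) f)) = eval a (toSym (transOp c n f)) := by
  subst hc
  rw [eval_toSym, eval_toSym, aeval_transOp, aeval_transOp, sum_range_succ]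
  simp

theorem gq_es (a : Fin n → ℂ) (p q : ℕ) :
    gq (n : ℂ) (fun k => es a univ k) p q = ∑ i, es1 a i p * es1 a i q := by
  have := sum_es1_mul_es1 a p q
  simpa using this.symm

theorem aeval_es_lapOp_succ (θ : ℝ) (a : Fin n → ℂ) (f : MvPolynomial ℕ ℂ) :
    eval a (toSym (lapOp θ n (n + 1) f)) = eval a (toSym (lapOp θ n n f)) := by
  have hz : ∀ i, es1 a i n = 0 := fun i => es_eq_zero _ (by
    rw [card_erase_of_mem (mem_univ i), card_univ, Fintype.card_fin]
    have := i.pos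
    omega)
  rw [eval_toSym, eval_toSym, aeval_lapOp, aeval_lapOp]
  simp only [Algebra.algebraMap_self, RingHom.id_apply, gq_es, sum_range_succ, hz]
  simp

theorem isHomogeneous_pderiv_mul {f g : MvPolynomial ℕ ℂ} {r k : ℕ} (hf : f.IsHomogeneous r)
    (hg : g.IsHomogeneous (k + 1)) (i : ℕ) : (pderiv i f * g).IsHomogeneous (r + k) := by
  rcases r with _ | r
  · rw [totalDegree_eq_zero_iff_eq_C.1 (Nat.le_zero.1 hf.totalDegree_le), pderiv_C, zero_mul]
    exact isHomogeneous_zero _ _ _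
  · have := (hf.pderiv (i := i)).mul hg
    rwa [Nat.add_sub_cancel, show r + (k + 1) = r + 1 + k by ring] at this

theorem isHomogeneous_pderiv_pderiv_mul {f g : MvPolynomial ℕ ℂ} {r : ℕ}
    (hf : f.IsHomogeneous r) (hg : g.IsHomogeneous 2) (i j : ℕ) :
    (pderiv i (pderiv j f) * g).IsHomogeneous r := by
  rcases r with _ | r
  · rw [totalDegree_eq_zero_iff_eq_C.1 (Nat.le_zero.1 hf.totalDegree_le), pderiv_C, map_zero,
      zero_mul]
    exact isHomogeneous_zero _ _ _
  · exact isHomogeneous_pderiv_mul (k := 1) hf.pderiv hg i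

theorem isHomogeneous_gq (c : ℂ) (p q : ℕ) :
    (gq (C c) (X : ℕ → MvPolynomial ℕ ℂ) p q).IsHomogeneous 2 := by
  have h : ∀ k i j : ℕ, ((C c - (k : MvPolynomial ℕ ℂ)) * X i * X j).IsHomogeneous 2 := by
    intro k i j
    rw [← map_natCast (C : ℂ →+* MvPolynomial ℕ ℂ), ← C_sub, mul_assoc]
    exact ((isHomogeneous_X ℂ i).mul (isHomogeneous_X ℂ j)).C_mul _
  induction p generalizing q with
  | zero => exact h _ _ _
  | succ p ih => exact ((ih _).sub (h _ _ _)).add (h _ _ _)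

theorem isHomogeneous_lapOp {f : MvPolynomial ℕ ℂ} {r : ℕ} (hf : f.IsHomogeneous r) (θ : ℝ)
    (c : ℂ) (M : ℕ) : (lapOp θ c M f).IsHomogeneous r := by
  refine (IsHomogeneous.sum _ _ _ fun p _ => ?_).add (IsHomogeneous.sum _ _ _ fun p _ =>
    IsHomogeneous.sum _ _ _ fun q _ => isHomogeneous_pderiv_pderiv_mul hf (isHomogeneous_gq _ _ _)
      _ _)
  refine isHomogeneous_pderiv_mul (k := 0) hf (IsHomogeneous.C_mul ?_ _) _
  cases p with
  | zero => exact isHomogeneous_zero _ _ _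
  | succ p => exact isHomogeneous_X _ _

theorem isHomogeneous_transOp {f : MvPolynomial ℕ ℂ} {r : ℕ} (hf : f.IsHomogeneous r)
    (c : ℂ) (M : ℕ) : (transOp c M f).IsHomogeneous r :=
  IsHomogeneous.sum _ _ _ fun _ _ =>
    isHomogeneous_pderiv_mul (k := 0) hf ((isHomogeneous_X _ _).C_mul _) _

theorem eval_sum_pderiv_avg (hθ : 0 < θ) {b : Fin (n + 1) → ℝ} (hb : StrictAnti b)
    {f : MvPolynomial ℕ ℂ} {r : ℕ} (hf : f.IsHomogeneous r) :
    eval (toC b) (∑ l, pderiv l (avg θ n r f))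
      = ∫ a, eval (toC a) (∑ l, pderiv l (toSym f)) ∂daK θ b := by
  have h : ∑ l, pderiv l (avg θ n r f) = avg θ n r (transOp n (n + 1) f) := by
    have := sum_pderiv_gE_hatSub (ι := Fin (n + 1)) θ f
    simp only [Fintype.card_fin, Nat.cast_add, Nat.cast_one, add_sub_cancel_right] at this
    simp only [avg, Derivation.map_smul, ← smul_sum, this]
  rw [h, ← (integral_eval_toSym hθ hb (isHomogeneous_transOp hf _ _)).2]
  refine integral_congr_ae (ae_of_all _ fun a => ?_)
  simp only [aeval_es_transOp_succ _ _ _ rfl]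
  rw [sum_pderiv_toSym, Fintype.card_fin]

theorem dunklLap_avg (hθ : 0 < θ) {b : Fin (n + 1) → ℝ} (hb : StrictAnti b)
    {f : MvPolynomial ℕ ℂ} {r : ℕ} (hf : f.IsHomogeneous r) :
    dunklLap θ (toC b) (avg θ n r f) = ∫ a, dunklLap θ (toC a) (toSym f) ∂daK θ b := by
  have h : dunklLap θ (toC b) (avg θ n r f)
      = eval (toC b) (avg θ n r (lapOp θ n (n + 1) f)) := by
    have := dunklLap_gE_hatSub (ι := Fin (n + 1)) (θ := θ) (toC_injective hb) f
    simp only [Fintype.card_fin, Nat.cast_add, Nat.cast_one, add_sub_cancel_right] at this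
    simp only [avg, map_smul, this, smul_eval, smul_eq_mul]
  rw [h, ← (integral_eval_toSym hθ hb (isHomogeneous_lapOp hf _ _ _)).2]
  refine integral_congr_ae ((ae_interlaces_daK θ b).mono fun a ha => ?_)
  simp only [aeval_es_lapOp_succ]
  rw [dunklLap_toSym (toC_injective (ha.strictAnti hb)), Fintype.card_fin]

end Averaging

section SymmetricForms

open MvPolynomial Finset

variable {n : ℕ} {θ : ℝ}

theorem isWeightedHomogeneous_aeval {σ τ : Type*} {w : σ → ℕ} {w' : τ → ℕ}
    {g : σ → MvPolynomial τ ℂ} (hg : ∀ i, IsWeightedHomogeneous w' (g i) (w i))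
    {f : MvPolynomial σ ℂ} {d : ℕ} (hf : IsWeightedHomogeneous w f d) :
    IsWeightedHomogeneous w' (aeval g f) d := by
  rw [aeval_def, eval₂_eq]
  refine IsWeightedHomogeneous.sum _ _ _ fun s hs => IsWeightedHomogeneous.C_mul ?_ _
  have h := IsWeightedHomogeneous.prod s.support (fun i => g i ^ s i) (fun i => s i • w i)
    (w := w') fun i _ => (hg i).pow (s i)
  have h2 : ∑ i ∈ s.support, s i • w i = d := by
    rw [← hf (mem_support_iff.1 hs), Finsupp.weight_apply, Finsupp.sum]
  rwa [h2] at h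

theorem aeval_weightedHomogeneousComponent {σ τ : Type*} {w : σ → ℕ} {w' : τ → ℕ}
    {g : σ → MvPolynomial τ ℂ} (hg : ∀ i, IsWeightedHomogeneous w' (g i) (w i))
    (f : MvPolynomial σ ℂ) (d : ℕ) :
    aeval g (weightedHomogeneousComponent w d f)
      = weightedHomogeneousComponent w' d (aeval g f) := by
  induction f using MvPolynomial.induction_on' with
  | monomial s c =>
    have h1 := isWeightedHomogeneous_monomial w s c rfl
    have h2 := isWeightedHomogeneous_aeval hg h1
    rw [weightedHomogeneousComponent_of_mem h1, weightedHomogeneousComponent_of_mem h2]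
    split_ifs <;> simp
  | add p q hp hq => simp only [map_add, hp, hq]

theorem isWeightedHomogeneous_es {ι τ : Type*} [DecidableEq ι] {w : τ → ℕ}
    {v : ι → MvPolynomial τ ℂ} (hv : ∀ i, IsWeightedHomogeneous w (v i) 1) (T : Finset ι) (k : ℕ) :
    IsWeightedHomogeneous w (es v T k) k := by
  refine IsWeightedHomogeneous.sum _ _ _ fun t ht => ?_
  have := IsWeightedHomogeneous.prod t v (fun _ => 1) (w := w) fun i _ => hv i
  rwa [sum_const, (mem_powersetCard.1 ht).2, smul_eq_mul, mul_one] at this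

theorem exists_lift {F : MvPolynomial (Fin n) ℂ} (hF : F.IsSymmetric) {d : ℕ}
    (hd : F.IsHomogeneous d) :
    ∃ f : MvPolynomial ℕ ℂ, IsWeightedHomogeneous (fun k : ℕ => k) f d ∧
      (∀ s ∈ f.support, s 0 = 0) ∧ toSym f = F := by
  obtain ⟨q, hq⟩ := esymmAlgHom_fin_surjective (n := n) (m := n) ℂ le_rfl ⟨F, hF⟩
  have hq' : aeval (fun i : Fin n => esymm (Fin n) ℂ (i + 1)) q = F := by
    rw [← esymmAlgHom_apply, hq]
  refine ⟨weightedHomogeneousComponent (fun k => k) d (rename (fun i : Fin n => (i : ℕ) + 1) q),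
    weightedHomogeneousComponent_isWeightedHomogeneous _ _, fun s hs => ?_, ?_⟩
  · rw [support_weightedHomogeneousComponent, mem_filter] at hs
    by_contra h0
    have h1 : 0 ∈ (rename (fun i : Fin n => (i : ℕ) + 1) q).vars :=
      (mem_vars_iff_mem_support _).2 ⟨s, hs.1, Finsupp.mem_support_iff.2 h0⟩
    have h2 := vars_rename _ _ h1
    simp at h2
  · rw [toSym, aeval_weightedHomogeneousComponent
      (isWeightedHomogeneous_es (fun i => isHomogeneous_X ℂ i) univ), aeval_rename]
    have : aeval ((fun k => es (X : Fin n → MvPolynomial (Fin n) ℂ) univ k) ∘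
        fun i : Fin n => (i : ℕ) + 1) q = F := hq'
    rw [this]
    exact hd.weightedHomogeneousComponent_same

theorem exists_form {F : MvPolynomial (Fin n) ℂ} (hF : F.IsSymmetric) {d : ℕ}
    (hd : F.IsHomogeneous d) :
    ∃ (f : MvPolynomial ℕ ℂ) (r : ℕ), IsWeightedHomogeneous (fun k : ℕ => k) f d ∧
      f.IsHomogeneous r ∧ toSym f = F := by
  obtain ⟨f, h1, -, h3⟩ := exists_lift hF hd
  refine ⟨∑ i ∈ range (f.totalDegree + 1), X 0 ^ (f.totalDegree - i) * homogeneousComponent i f,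
    f.totalDegree, ?_, ?_, ?_⟩
  · refine IsWeightedHomogeneous.sum _ _ _ fun i _ => ?_
    have hX := (isWeightedHomogeneous_X ℂ (fun k : ℕ => k) 0).pow (f.totalDegree - i)
    have hc : IsWeightedHomogeneous (fun k : ℕ => k) (homogeneousComponent i f) d := by
      intro s hs
      rw [coeff_homogeneousComponent] at hs
      split_ifs at hs
      · exact h1 hs
      · exact absurd rfl hs
    simpa using hX.mul hc
  · refine IsHomogeneous.sum _ _ _ fun i hi => ?_
    have := ((isHomogeneous_X ℂ 0).pow (f.totalDegree - i)).mul
      (homogeneousComponent_isHomogeneous i f)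
    rwa [one_mul, Nat.sub_add_cancel (Nat.lt_succ_iff.1 (mem_range.1 hi))] at this
  · rw [map_sum]
    have : ∀ i, (toSym (X 0 ^ (f.totalDegree - i) * homogeneousComponent i f) :
        MvPolynomial (Fin n) ℂ) = toSym (homogeneousComponent i f) := by
      intro i
      have h0 : (toSym (X 0) : MvPolynomial (Fin n) ℂ) = 1 := by simp [toSym, es_zero]
      rw [map_mul, map_pow, h0, one_pow, one_mul]
    simp only [this]
    rw [← map_sum, sum_homogeneousComponent, h3]

theorem isHomogeneous_gE (θ : ℝ) {φ : MvPolynomial (Fin n ⊕ Fin n) ℂ} {d : ℕ}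
    (hφ : IsWeightedHomogeneous (Sum.elim (fun _ => 0) fun _ => 1) φ d) :
    (gE θ φ).IsHomogeneous d := by
  rw [φ.as_sum, map_sum]
  refine IsHomogeneous.sum _ _ _ fun α hα => ?_
  rw [gE_monomial]
  refine IsHomogeneous.C_mul (IsHomogeneous.C_mul ?_ _) _
  have h := IsHomogeneous.prod univ (fun i : Fin n => (X i : MvPolynomial (Fin n) ℂ) ^
    α (Sum.inr i)) (fun i => 1 * α (Sum.inr i)) fun i _ => (isHomogeneous_X ℂ i).pow _
  have h2 := hφ (mem_support_iff.1 hα)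
  rw [Finsupp.weight_apply, Finsupp.sum_fintype _ _ (by simp), Fintype.sum_sum_type] at h2
  simp only [Sum.elim_inl, Sum.elim_inr, smul_eq_mul, mul_zero, sum_const_zero, mul_one,
    zero_add] at h2
  simpa [h2] using h

theorem isHomogeneous_avg (θ : ℝ) (n r : ℕ) {f : MvPolynomial ℕ ℂ} {d : ℕ}
    (hf : IsWeightedHomogeneous (fun k : ℕ => k) f d) : (avg θ n r f).IsHomogeneous d := by
  rw [avg, smul_eq_C_mul]
  refine (isHomogeneous_gE θ (isWeightedHomogeneous_aeval (fun k => ?_) hf)).C_mul _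
  refine IsWeightedHomogeneous.sum _ _ _ fun i _ => ?_
  have h1 : IsWeightedHomogeneous (Sum.elim (fun _ => 0) fun _ => 1 :
      Fin (n + 1) ⊕ Fin (n + 1) → ℕ) (gX i) 0 := isWeightedHomogeneous_X _ _ _
  have h2 := isWeightedHomogeneous_es (w := (Sum.elim (fun _ => 0) fun _ => 1 :
      Fin (n + 1) ⊕ Fin (n + 1) → ℕ)) (v := bX)
      (fun i => isWeightedHomogeneous_X _ _ _) (univ.erase i) k
  simpa [es1] using h1.mul h2

theorem rename_gE (θ : ℝ) (σ : Equiv.Perm (Fin n)) (φ : MvPolynomial (Fin n ⊕ Fin n) ℂ) :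
    rename σ (gE θ φ) = gE θ (rename (Sum.map σ σ) φ) := by
  induction φ using MvPolynomial.induction_on' with
  | monomial α c =>
    have hinj : Function.Injective (Sum.map σ σ) := σ.injective.sumMap σ.injective
    rw [rename_monomial, gE_monomial, gE_monomial]
    simp only [map_mul, rename_C, map_prod, map_pow, rename_X]
    congr 2
    · congr 2
      conv_rhs => rw [← Equiv.prod_comp σ]
      refine prod_congr rfl fun i _ => ?_
      rw [← Finsupp.mapDomain_apply hinj α (Sum.inl i), Sum.map_inl]
    · conv_rhs => rw [← Equiv.prod_comp σ]
      refine prod_congr rfl fun i _ => ?_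
      rw [← Finsupp.mapDomain_apply hinj α (Sum.inr i), Sum.map_inr]
  | add p q hp hq => simp only [map_add, hp, hq]

theorem es_perm {A : Type*} [CommRing A] (v : Fin n → A) (σ : Equiv.Perm (Fin n))
    (T : Finset (Fin n)) (k : ℕ) : es (fun i => v (σ i)) T k = es v (T.map σ.toEmbedding) k := by
  simp [es, powersetCard_map]

theorem rename_hatSub (σ : Equiv.Perm (Fin n)) (f : MvPolynomial ℕ ℂ) :
    rename (Sum.map σ σ) (hatSub f) = (hatSub f : MvPolynomial (Fin n ⊕ Fin n) ℂ) := by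
  rw [hatSub, ← AlgHom.comp_apply, comp_aeval]
  congr 2
  funext k
  simp only [eh, map_sum, map_mul, es1]
  conv_rhs => rw [← Equiv.sum_comp σ]
  refine sum_congr rfl fun i _ => ?_
  congr 1
  · simp [gX]
  · have := ringHom_es (rename (R := ℂ) (Sum.map σ σ)).toRingHom (bX (ι := Fin n))
      (univ.erase i) k
    simp only [AlgHom.toRingHom_eq_coe, RingHom.coe_coe] at this
    rw [this]
    have h2 := es_perm (bX (ι := Fin n)) σ (univ.erase i) k
    have h3 : (univ.erase i).map σ.toEmbedding = univ.erase (σ i) := by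
      rw [map_erase]; simp
    rw [h3] at h2
    rw [← h2]
    simp [bX]

theorem isSymmetric_avg (θ : ℝ) (n r : ℕ) (f : MvPolynomial ℕ ℂ) : (avg θ n r f).IsSymmetric := by
  intro σ
  rw [avg, map_smul, rename_gE, rename_hatSub]

end SymmetricForms

section TaylorComponents

open MvPolynomial Finset

variable {n : ℕ} {θ : ℝ}

/-- The homogeneous components (in the top level) of the multivariate Bessel function, where level
`k` enters through the exponential weight `exp (xₖ |a⁽ᵏ⁾|)`. -/
def mbfComp (θ : ℝ) (x : ℕ → ℂ) : (n : ℕ) → ℕ → (Fin n → ℝ) → ℂ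
  | 0, d, _ => if d = 0 then 1 else 0
  | n + 1, d, b => ∑ p ∈ antidiagonal d, (x n * ((∑ i, b i : ℝ) : ℂ)) ^ p.1 / (p.1.factorial : ℂ) *
      ∫ a, mbfComp θ x n p.2 a ∂daK θ b

theorem sum_antidiagonal_shiftSeq_left {A : Type*} [CommRing A] (u v : ℕ → A) (d : ℕ) :
    ∑ p ∈ antidiagonal d, shiftSeq u p.1 * v p.2
      = shiftSeq (fun d => ∑ p ∈ antidiagonal d, u p.1 * v p.2) d := by
  cases d with
  | zero => simp [shiftSeq]
  | succ d => rw [Nat.sum_antidiagonal_succ]; simp [shiftSeq]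

theorem sum_antidiagonal_shiftSeq_right {A : Type*} [CommRing A] (u v : ℕ → A) (d : ℕ) :
    ∑ p ∈ antidiagonal d, u p.1 * shiftSeq v p.2
      = shiftSeq (fun d => ∑ p ∈ antidiagonal d, u p.1 * v p.2) d := by
  cases d with
  | zero => simp [shiftSeq]
  | succ d => rw [Nat.sum_antidiagonal_succ']; simp [shiftSeq]

theorem dunklLap_mul {ι : Type*} [Fintype ι] [DecidableEq ι] (b : ι → ℂ)
    {E E₁ E₂ : MvPolynomial ι ℂ} (h₁ : ∀ l, pderiv l E = E₁) (h₂ : ∀ l, pderiv l E₁ = E₂)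
    (W : MvPolynomial ι ℂ) :
    dunklLap θ b (E * W) = eval b E * dunklLap θ b W
      + 2 * eval b E₁ * eval b (∑ l, pderiv l W)
      + Fintype.card ι * eval b E₂ * eval b W := by
  simp only [dunklLap_apply, Derivation.leibniz, h₁, h₂, smul_eq_mul, map_add, map_mul, map_sum]
  have h : ∀ l k, (eval b E * eval b (pderiv l W) + eval b W * eval b E₁
      - (eval b E * eval b (pderiv k W) + eval b W * eval b E₁)) / (b l - b k)
      = eval b E * ((eval b (pderiv l W) - eval b (pderiv k W)) / (b l - b k)) := by
    intro l k; ring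
  simp only [h, ← mul_sum, ← sum_mul, sum_add_distrib, sum_const, card_univ, nsmul_eq_mul]
  ring

/-- The divided powers of `x ∑ᵢ Xᵢ`. -/
def expTerm (n : ℕ) (x : ℂ) (i : ℕ) : MvPolynomial (Fin n) ℂ :=
  C (x ^ i / (i.factorial : ℂ)) * (∑ j, X j) ^ i

theorem pderiv_expTerm (x : ℂ) (i : ℕ) (l : Fin n) :
    pderiv l (expTerm n x i) = C x * shiftSeq (expTerm n x) i := by
  cases i with
  | zero => simp [expTerm, shiftSeq]
  | succ i =>
    have h : pderiv l (∑ j, X j : MvPolynomial (Fin n) ℂ) = 1 := by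
      simp [pderiv_X, Pi.single_apply]
    rw [expTerm, pderiv_C_mul, Derivation.leibniz_pow, h]
    simp only [shiftSeq, expTerm, Nat.add_sub_cancel, smul_eq_mul, mul_one, nsmul_eq_mul]
    rw [← map_natCast (C : ℂ →+* MvPolynomial (Fin n) ℂ), ← mul_assoc, ← mul_assoc, ← map_mul,
      ← map_mul]
    congr 2
    rw [Nat.factorial_succ]
    have := Nat.cast_ne_zero (R := ℂ).2 i.factorial_ne_zero
    have := Nat.cast_ne_zero (R := ℂ).2 i.succ_ne_zero
    push_cast at *
    field_simp
    ring

theorem isHomogeneous_expTerm (x : ℂ) (i : ℕ) : (expTerm n x i).IsHomogeneous i := by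
  refine IsHomogeneous.C_mul ?_ _
  simpa using (IsHomogeneous.sum univ (fun j : Fin n => (X j : MvPolynomial (Fin n) ℂ)) 1
    fun j _ => isHomogeneous_X ℂ j).pow i

theorem isSymmetric_expTerm (x : ℂ) (i : ℕ) : (expTerm n x i).IsSymmetric := by
  intro σ
  simp only [expTerm, map_mul, rename_C, map_pow, map_sum, rename_X]
  rw [Equiv.sum_comp σ (fun j => (X j : MvPolynomial (Fin n) ℂ))]

theorem eval_expTerm (x : ℂ) (i : ℕ) (b : Fin n → ℝ) :
    eval (toC b) (expTerm n x i) = (x * ((∑ j, b j : ℝ) : ℂ)) ^ i / (i.factorial : ℂ) := by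
  simp only [expTerm, map_mul, eval_C, map_pow, map_sum, eval_X]
  push_cast
  ring

/-- `F` represents the homogeneous components `mbfComp` by symmetric polynomials. -/
structure IsCompRep (θ : ℝ) (y : ℕ → ℂ) (n : ℕ) (F : ℕ → MvPolynomial (Fin n) ℂ) : Prop where
  symm : ∀ d, (F d).IsSymmetric
  homog : ∀ d, (F d).IsHomogeneous d
  eval_eq : ∀ d {b : Fin n → ℝ}, StrictAnti b →
    mbfComp θ (fun k => y k - y (k + 1)) n d b = eval (toC b) (F d)
  trans : ∀ d {b : Fin n → ℝ}, StrictAnti b → eval (toC b) (∑ l, pderiv l (F d))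
    = (∑ k ∈ range n, (y k - y n)) * eval (toC b) (shiftSeq F d)
  lap : ∀ d {b : Fin n → ℝ}, StrictAnti b → dunklLap θ (toC b) (F d)
    = (∑ k ∈ range n, (y k - y n) ^ 2) * eval (toC b) (shiftSeq (shiftSeq F) d)

theorem exists_avg {y : ℕ → ℂ} (hθ : 0 < θ) {F : ℕ → MvPolynomial (Fin n) ℂ}
    (hF : IsCompRep θ y n F) : ∃ W : ℕ → MvPolynomial (Fin (n + 1)) ℂ,
      (∀ d, (W d).IsSymmetric) ∧ (∀ d, (W d).IsHomogeneous d) ∧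
      ∀ {b : Fin (n + 1) → ℝ}, StrictAnti b → 
        (∀ d, Integrable (fun a => eval (toC a) (F d)) (daK θ b)) ∧
        (∀ d, ∫ a, eval (toC a) (F d) ∂daK θ b = eval (toC b) (W d)) ∧
        (∀ d, eval (toC b) (∑ l, pderiv l (W d))
          = (∑ k ∈ range n, (y k - y n)) * eval (toC b) (shiftSeq W d)) ∧
        ∀ d, dunklLap θ (toC b) (W d)
          = (∑ k ∈ range n, (y k - y n) ^ 2) * eval (toC b) (shiftSeq (shiftSeq W) d) := by
  choose f r hw hr hs using fun d => exists_form (hF.symm d) (hF.homog d)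
  have hInt := fun (b : Fin (n + 1) → ℝ) (hb : StrictAnti b) d => integral_eval_toSym hθ hb (hr d)
  simp only [hs] at hInt
  refine ⟨fun d => avg θ n (r d) (f d), fun d => isSymmetric_avg _ _ _ _,
    fun d => isHomogeneous_avg _ _ _ (hw d), fun {b} hb => ⟨fun d => (hInt b hb d).1,
      fun d => (hInt b hb d).2, fun d => ?_, fun d => ?_⟩⟩
  · rw [eval_sum_pderiv_avg hθ hb (hr d), hs]
    rw [integral_congr_ae ((ae_interlaces_daK θ b).mono fun a ha => hF.trans d (ha.strictAnti hb)),
      integral_const_mul]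
    congr 1
    rcases d with _ | d
    · simp [shiftSeq]
    · exact (hInt b hb d).2
  · rw [dunklLap_avg hθ hb (hr d), hs]
    rw [integral_congr_ae ((ae_interlaces_daK θ b).mono fun a ha => hF.lap d (ha.strictAnti hb)),
      integral_const_mul]
    congr 1
    rcases d with _ | _ | d
    · simp [shiftSeq]
    · simp [shiftSeq]
    · exact (hInt b hb d).2

theorem eval_shiftSeq (b : Fin n → ℂ) (F : ℕ → MvPolynomial (Fin n) ℂ) (d : ℕ) :
    eval b (shiftSeq F d) = shiftSeq (fun d => eval b (F d)) d :=
  map_shiftSeq (eval b) F d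

theorem exists_isCompRep (hθ : 0 < θ) (y : ℕ → ℂ) (n : ℕ) : ∃ F, IsCompRep θ y n F := by
  induction n with
  | zero =>
    refine ⟨fun d => if d = 0 then 1 else 0, ⟨fun d => ?_, fun d => ?_, fun d b _ => ?_,
      fun d b _ => ?_, fun d b _ => ?_⟩⟩
    · intro σ; split_ifs <;> simp
    · split_ifs with h
      · rw [h]; exact isHomogeneous_one _ _
      · exact isHomogeneous_zero _ _ _
    · rw [mbfComp]; split_ifs <;> simp
    · simp
    · simp [dunklLap_apply]
  | succ n ih =>
    obtain ⟨F, hF⟩ := ih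
    obtain ⟨W, hWs, hWh, hW⟩ := exists_avg hθ hF
    set x := y n - y (n + 1) with hx
    have h₂ : ∀ i (l : Fin (n + 1)), pderiv l (C x * shiftSeq (expTerm (n + 1) x) i)
        = C x * (C x * shiftSeq (shiftSeq (expTerm (n + 1) x)) i) := by
      intro i l
      rw [pderiv_C_mul]
      cases i with
      | zero => simp [shiftSeq]
      | succ i => simp only [shiftSeq, pderiv_expTerm]
    refine ⟨fun d => ∑ p ∈ antidiagonal d, expTerm (n + 1) x p.1 * W p.2, ⟨fun d => ?_, fun d => ?_,
      fun d b hb => ?_, fun d b hb => ?_, fun d b hb => ?_⟩⟩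
    · intro σ
      rw [map_sum]
      refine sum_congr rfl fun p _ => ?_
      rw [map_mul, isSymmetric_expTerm x p.1 σ, hWs p.2 σ]
    · refine IsHomogeneous.sum _ _ _ fun p hp => ?_
      rw [← mem_antidiagonal.1 hp]
      exact (isHomogeneous_expTerm x p.1).mul (hWh p.2)
    · rw [mbfComp, map_sum]
      refine sum_congr rfl fun p _ => ?_
      rw [map_mul, eval_expTerm, ← (hW hb).2.1]
      congr 1
      exact integral_congr_ae ((ae_interlaces_daK θ b).mono fun a ha =>
        hF.eval_eq _ (ha.strictAnti hb))
    · have h1 : ∑ l, pderiv l (∑ p ∈ antidiagonal d, expTerm (n + 1) x p.1 * W p.2)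
          = ∑ p ∈ antidiagonal d, expTerm (n + 1) x p.1 * ∑ l, pderiv l (W p.2)
            + C ((n + 1 : ℂ) * x) * ∑ p ∈ antidiagonal d, shiftSeq (expTerm (n + 1) x) p.1 * W p.2 := by
        simp only [map_sum, Derivation.leibniz, pderiv_expTerm, smul_eq_mul, mul_sum]
        rw [sum_comm, ← sum_add_distrib]
        refine sum_congr rfl fun p _ => ?_
        rw [sum_add_distrib]
        simp only [sum_const, card_univ, Fintype.card_fin, nsmul_eq_mul, map_mul, map_add, map_one,
          map_natCast, Nat.cast_add, Nat.cast_one]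
        ring
      rw [h1, map_add, map_sum, map_mul, eval_C, sum_antidiagonal_shiftSeq_left]
      simp only [map_mul, (hW hb).2.2.1, eval_shiftSeq]
      have h3 : ∀ p : ℕ × ℕ, eval (toC b) (expTerm (n + 1) x p.1) *
          ((∑ k ∈ range n, (y k - y n)) * shiftSeq (fun d => eval (toC b) (W d)) p.2)
          = (∑ k ∈ range n, (y k - y n)) * (eval (toC b) (expTerm (n + 1) x p.1) *
          shiftSeq (fun d => eval (toC b) (W d)) p.2) := fun p => by ring
      simp only [h3, ← mul_sum]
      rw [sum_antidiagonal_shiftSeq_right (fun d => eval (toC b) (expTerm (n + 1) x d))]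
      simp only [map_sum, map_mul]
      rw [← add_mul]
      congr 1
      simp only [sum_range_succ, sum_sub_distrib, sum_const, card_range, nsmul_eq_mul, hx]
      push_cast
      ring
    · simp only [map_sum]
      simp only [dunklLap_mul (toC b) (pderiv_expTerm x _) (h₂ _), (hW hb).2.2.1, (hW hb).2.2.2,
        eval_shiftSeq, map_mul, eval_C, Fintype.card_fin]
      set e := fun d => eval (toC b) (expTerm (n + 1) x d) with he
      set w := fun d => eval (toC b) (W d) with hw
      have h3 : ∀ Z Y : ℂ, ∀ p : ℕ × ℕ, e p.1 * (Z * shiftSeq (shiftSeq w) p.2)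
          + 2 * (x * shiftSeq e p.1) * (Y * shiftSeq w p.2)
          + ((n + 1 : ℕ) : ℂ) * (x * (x * shiftSeq (shiftSeq e) p.1)) * w p.2
          = Z * (e p.1 * shiftSeq (shiftSeq w) p.2) + 2 * x * Y * (shiftSeq e p.1 * shiftSeq w p.2)
            + (n + 1 : ℂ) * x ^ 2 * (shiftSeq (shiftSeq e) p.1 * w p.2) := by
        intro Z Y p; push_cast; ring
      trans ∑ p ∈ antidiagonal d, (e p.1 * ((∑ k ∈ range n, (y k - y n) ^ 2) * shiftSeq (shiftSeq w) p.2)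
          + 2 * (x * shiftSeq e p.1) * ((∑ k ∈ range n, (y k - y n)) * shiftSeq w p.2)
          + ((n + 1 : ℕ) : ℂ) * (x * (x * shiftSeq (shiftSeq e) p.1)) * w p.2)
      · rfl
      simp only [h3, sum_add_distrib, ← mul_sum]
      rw [sum_antidiagonal_shiftSeq_left (shiftSeq e) w, sum_antidiagonal_shiftSeq_left e (shiftSeq w),
        sum_antidiagonal_shiftSeq_right e (shiftSeq w)]
      have h4 := funext (sum_antidiagonal_shiftSeq_right e w)
      have h5 := funext (sum_antidiagonal_shiftSeq_left e w)
      rw [h4, h5, ← add_mul, ← add_mul]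
      congr 1
      swap
      · simp only [map_sum, map_mul]
        rfl
      have h6 : ∀ k, (y k - y (n + 1)) ^ 2 = (y k - y n) ^ 2 + 2 * x * (y k - y n) + x ^ 2 := by
        intro k; rw [hx]; ring
      simp only [h6, sum_range_succ _ n, sum_add_distrib, ← mul_sum, sum_const, card_range,
        nsmul_eq_mul]
      ring

end TaylorComponents

section Domination

open Finset

variable {n : ℕ} {θ : ℝ}

theorem gamM_pos_of_isOpen {α : ℝ} (hα : 0 < α) {s : Set ℝ} (ho : IsOpen s) (hs : s.Nonempty)
    (hpos : ∀ x ∈ s, 0 < x) : 0 < gamM α s := by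
  rw [gamM, withDensity_apply _ ho.measurableSet,
    setLIntegral_pos_iff (measurable_gamD α).ennreal_ofReal]
  refine (ho.measure_pos volume hs).trans_le (measure_mono fun x hx => ⟨?_, hx⟩)
  have := hpos x hx
  have h2 := Real.Gamma_pos_of_pos hα
  rw [Function.mem_support, gamD_of_pos _ this]
  exact ne_of_gt (ENNReal.ofReal_pos.2 (by positivity))

/-- The event that the `j`-th coordinate carries at least three quarters of the total mass. -/
def dominatingSet (n : ℕ) (j : Fin (n + 1)) : Set (Fin (n + 1) → ℝ) :=
  {γ | 3 / 4 * ∑ i, γ i ≤ γ j}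

theorem measurableSet_dominatingSet (j : Fin (n + 1)) : MeasurableSet (dominatingSet n j) :=
  measurableSet_le (by fun_prop) (by fun_prop)

theorem gamPi_dominatingSet_pos (hθ : 0 < θ) (j : Fin (n + 1)) :
    0 < gamPi θ (n + 1) (dominatingSet n j) := by
  have := isProbabilityMeasure_gamM hθ
  set B : Set (Fin (n + 1) → ℝ) :=
    Set.univ.pi fun i => if i = j then Set.Ioi (3 * (n : ℝ)) else Set.Ioo 0 1
  have hB : 0 < gamPi θ (n + 1) B := by
    rw [gamPi_eq_pi hθ, Measure.pi_pi]
    refine CanonicallyOrderedAdd.prod_pos.2 fun i _ => ?_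
    split_ifs
    · exact gamM_pos_of_isOpen hθ isOpen_Ioi Set.nonempty_Ioi fun x hx =>
        lt_of_le_of_lt (by positivity) hx
    · exact gamM_pos_of_isOpen hθ isOpen_Ioo (Set.nonempty_Ioo.2 one_pos) fun x hx => hx.1
  refine hB.trans_le (measure_mono fun γ hγ => ?_)
  have h1 : 3 * (n : ℝ) < γ j := by simpa using hγ j (Set.mem_univ _)
  have h2 : ∑ i ∈ univ.erase j, γ i ≤ n := by
    calc ∑ i ∈ univ.erase j, γ i ≤ ∑ i ∈ univ.erase j, (1 : ℝ) := by
          refine sum_le_sum fun i hi => ?_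
          have := hγ i (Set.mem_univ _)
          simp only [if_neg (ne_of_mem_erase hi)] at this
          exact this.2.le
      _ = n := by simp
  have h3 := add_sum_erase univ γ (mem_univ j)
  change 3 / 4 * ∑ i, γ i ≤ γ j
  linarith

theorem half_norm_mul_le_abs_sum {a γ : Fin (n + 1) → ℝ} {j : Fin (n + 1)} (hj : ‖a‖ = |a j|)
    (hγ : ∀ i, 0 < γ i) (h : γ ∈ dominatingSet n j) :
    ‖a‖ / 2 * ∑ i, γ i ≤ |∑ i, γ i * a i| := by
  have h3 := add_sum_erase univ γ (mem_univ j)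
  have h4 := add_sum_erase univ (fun i => γ i * a i) (mem_univ j)
  have h5 : |∑ i ∈ univ.erase j, γ i * a i| ≤ (∑ i ∈ univ.erase j, γ i) * ‖a‖ := by
    rw [sum_mul]
    refine (abs_sum_le_sum_abs _ _).trans (sum_le_sum fun i _ => ?_)
    rw [abs_mul, abs_of_pos (hγ i)]
    exact mul_le_mul_of_nonneg_left (norm_le_pi_norm a i) (hγ i).le
  have h6 : |γ j * a j| = γ j * ‖a‖ := by rw [abs_mul, abs_of_pos (hγ j), hj]
  have h7 := abs_sub_abs_le_abs_sub (γ j * a j) (-∑ i ∈ univ.erase j, γ i * a i)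
  rw [sub_neg_eq_add, h4, abs_neg, h6] at h7
  have h8 : 3 / 4 * ∑ i, γ i ≤ γ j := h
  have h9 : ∑ i ∈ univ.erase j, γ i = ∑ i, γ i - γ j := by linarith
  rw [h9] at h5
  nlinarith [mul_le_mul_of_nonneg_right h8 (norm_nonneg a)]

theorem strictAnti_neg_coe (n : ℕ) : StrictAnti fun i : Fin n => -(i : ℝ) := by
  intro i j h
  have : (i : ℝ) < j := by exact_mod_cast h
  simpa using this

theorem integrable_sum_mul_pow_gamPi (hθ : 0 < θ) (d : ℕ) (a : Fin n → ℝ) :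
    Integrable (fun γ : Fin n → ℝ => (∑ i, γ i * a i) ^ d) (gamPi θ n) := by
  have h := (integral_eval_gamPi hθ a
    ((∑ i, MvPolynomial.X (Sum.inl i) * MvPolynomial.X (Sum.inr i)) ^ d)).1.re
  refine h.congr (ae_of_all _ fun γ => ?_)
  simp only [map_pow, map_sum, map_mul, MvPolynomial.eval_X, Sum.elim_inl, Sum.elim_inr]
  norm_cast

theorem ofReal_gamMoment (hθ : 0 < θ) (k : ℕ) (a : Fin n → ℝ) :
    ENNReal.ofReal (gamMoment θ (2 * k) a)
      = ∫⁻ γ, ENNReal.ofReal ((∑ i, γ i * a i) ^ (2 * k)) ∂gamPi θ n := by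
  rw [gamMoment, ofReal_integral_eq_lintegral_ofReal (integrable_sum_mul_pow_gamPi hθ _ a)]
  exact ae_of_all _ fun γ => (even_two_mul k).pow_nonneg _

theorem gamMoment_even_nonneg (θ : ℝ) (k : ℕ) (a : Fin n → ℝ) : 0 ≤ gamMoment θ (2 * k) a :=
  integral_nonneg fun _ => (even_two_mul k).pow_nonneg _

theorem exists_le_dirMoment (hθ : 0 < θ) (n : ℕ) : ∃ c : ℝ, 0 < c ∧ ∀ (k : ℕ)
    (a : Fin (n + 1) → ℝ), c * (‖a‖ / 2) ^ (2 * k) ≤ dirMoment θ (2 * k) a := by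
  have hP := isProbabilityMeasure_gamPi hθ (n + 1)
  obtain ⟨j₀, hj₀⟩ := Finite.exists_min fun j => (gamPi θ (n + 1) (dominatingSet n j)).toReal
  refine ⟨(gamPi θ (n + 1) (dominatingSet n j₀)).toReal,
    ENNReal.toReal_pos (gamPi_dominatingSet_pos hθ j₀).ne' (measure_ne_top _ _), fun k a => ?_⟩
  obtain ⟨j, hj⟩ : ∃ j, ‖a‖ = |a j| := by
    obtain ⟨j, -, hj⟩ := exists_mem_eq_sup' (univ_nonempty) fun i => ‖a i‖₊
    refine ⟨j, ?_⟩
    rw [Pi.norm_def, ← sup'_eq_sup univ_nonempty, hj]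
    rfl
  have hα : 0 < ((n : ℝ) + 1) * θ := by positivity
  have hrf := rf_pos hα (2 * k)
  refine (mul_le_mul_of_nonneg_right (hj₀ j) (by positivity)).trans ?_
  rw [dirMoment, Nat.cast_succ, le_div_iff₀ hrf]
  have hA := measurableSet_dominatingSet j
  have hinv : ∀ s : ℝ, 0 < s → ∀ γ, (dominatingSet n j).indicator (1 : (Fin (n + 1) → ℝ) → ℝ≥0∞) (s • γ)
      = (dominatingSet n j).indicator 1 γ := by
    intro s hs γ
    have : s • γ ∈ dominatingSet n j ↔ γ ∈ dominatingSet n j := by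
      change 3 / 4 * ∑ i, s * γ i ≤ s * γ j ↔ 3 / 4 * ∑ i, γ i ≤ γ j
      rw [← mul_sum, mul_left_comm]
      exact mul_le_mul_iff_right₀ hs
    by_cases h : γ ∈ dominatingSet n j
    · rw [Set.indicator_of_mem h, Set.indicator_of_mem (this.2 h)]; rfl
    · rw [Set.indicator_of_notMem h, Set.indicator_of_notMem (mt this.1 h)]
  have hg := fun (g : ℝ → ℝ≥0∞) (hg : Measurable g) => lintegral_gamPi_mul hθ
    (strictAnti_neg_coe (n + 1)) hg ((measurable_one (α := ℝ≥0∞)).indicator hA) hinv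
  have h1 := hg (fun _ => 1) measurable_const
  have h2 := hg (fun s => ENNReal.ofReal (s ^ (2 * k))) (by fun_prop)
  have := isProbabilityMeasure_gamM hα
  simp only [one_mul, lintegral_indicator_one hA, lintegral_const, measure_univ] at h1
  rw [← h1, lintegral_pow_gamM hα] at h2
  have h3 : ENNReal.ofReal ((‖a‖ / 2) ^ (2 * k)) * ∫⁻ γ, ENNReal.ofReal ((∑ i, γ i) ^ (2 * k)) *
      (dominatingSet n j).indicator 1 γ ∂gamPi θ (n + 1)
      ≤ ∫⁻ γ, ENNReal.ofReal ((∑ i, γ i * a i) ^ (2 * k)) ∂gamPi θ (n + 1) := by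
    rw [← lintegral_const_mul' _ _ ENNReal.ofReal_ne_top]
    refine lintegral_mono_ae ((ae_pos_gamPi hθ (n + 1)).mono fun γ hγ => ?_)
    by_cases hm : γ ∈ dominatingSet n j
    · rw [Set.indicator_of_mem hm, Pi.one_apply, mul_one, ← ENNReal.ofReal_mul (by positivity),
        ← mul_pow]
      refine ENNReal.ofReal_le_ofReal ?_
      rw [← (even_two_mul k).pow_abs (∑ i, γ i * a i)]
      have := sum_nonneg fun i (_ : i ∈ univ) => (hγ i).le
      exact pow_le_pow_left₀ (by positivity) (half_norm_mul_le_abs_sum hj hγ hm) _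
    · simp [Set.indicator_of_notMem hm]
  rw [h2] at h3
  rw [← ofReal_gamMoment hθ, ← ENNReal.ofReal_toReal (measure_ne_top (gamPi θ (n + 1)) (dominatingSet n j)),
    ← ENNReal.ofReal_mul hrf.le, ← ENNReal.ofReal_mul (by positivity),
    ENNReal.ofReal_le_ofReal_iff (gamMoment_even_nonneg _ _ _)] at h3
  linarith

theorem pow_div_factorial_le (x : ℝ) (k : ℕ) :
    x ^ (2 * k) / ((2 * k).factorial : ℝ) ≤ Real.exp x + Real.exp (-x) := by
  rw [← (even_two_mul k).pow_abs]
  refine (Real.pow_div_factorial_le_exp _ (abs_nonneg x) _).trans ?_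
  rcases abs_cases x with ⟨h, -⟩ | ⟨h, -⟩ <;> rw [h]
  · linarith [Real.exp_pos (-x)]
  · linarith [Real.exp_pos x]

theorem one_sub_rpow_neg_le (hθ : 0 < θ) {x : ℝ} (hx : |x| ≤ 1 / 2) :
    (1 - x) ^ (-θ) ≤ Real.exp (θ * (x + 2 * x ^ 2)) := by
  have h1 := abs_le.1 hx
  have h2 : 0 < 1 - x := by linarith
  rw [Real.rpow_def_of_pos h2]
  refine Real.exp_le_exp.2 ?_
  have h3 : -(x + 2 * x ^ 2) ≤ Real.log (1 - x) := by
    have h : Real.exp (-(x + 2 * x ^ 2)) ≤ 1 - x := by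
      rw [Real.exp_neg, inv_le_comm₀ (Real.exp_pos _) h2]
      refine le_trans ?_ (Real.add_one_le_exp _)
      rw [inv_le_iff_one_le_mul₀ h2]
      nlinarith [sq_nonneg x, mul_nonneg (sq_nonneg x) (by linarith : (0 : ℝ) ≤ 1 / 2 - x)]
    rw [Real.le_log_iff_exp_le h2]; exact h
  nlinarith

theorem lintegral_exp_gamPi_le (hθ : 0 < θ) {b : Fin n → ℝ} {l : ℝ}
    (hl : ∀ i, |l * b i| ≤ 1 / 2) :
    ∫⁻ γ, ENNReal.ofReal (Real.exp (l * ∑ i, γ i * b i)) ∂gamPi θ n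
      ≤ ENNReal.ofReal (Real.exp (θ * (|l * ∑ i, b i| + 2 * l ^ 2 * ∑ i, b i ^ 2))) := by
  have h := lintegral_exp_gamPi hθ (t := fun i => -(l * b i)) fun i => by
    have := abs_le.1 (hl i); linarith
  have h2 : ∀ γ : Fin n → ℝ, -∑ i, -(l * b i) * γ i = l * ∑ i, γ i * b i := by
    intro γ
    rw [mul_sum, ← sum_neg_distrib]
    exact sum_congr rfl fun i _ => by ring
  simp only [h2] at h
  rw [h]
  refine ENNReal.ofReal_le_ofReal ?_
  calc ∏ i, (1 + -(l * b i)) ^ (-θ) ≤ ∏ i, Real.exp (θ * (l * b i + 2 * (l * b i) ^ 2)) := by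
        refine prod_le_prod (fun i _ => ?_) fun i _ => ?_
        · refine Real.rpow_nonneg ?_ _
          have := abs_le.1 (hl i); linarith
        · rw [← sub_eq_add_neg]; exact one_sub_rpow_neg_le hθ (hl i)
    _ = Real.exp (θ * (l * ∑ i, b i + 2 * l ^ 2 * ∑ i, b i ^ 2)) := by
        rw [← Real.exp_sum]
        congr 1
        simp only [mul_sum, mul_add, sum_add_distrib, mul_pow, mul_assoc]
    _ ≤ _ := by
        refine Real.exp_le_exp.2 (mul_le_mul_of_nonneg_left ?_ hθ.le)
        gcongr
        exact le_abs_self _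

theorem gamMoment_even_le (hθ : 0 < θ) {b : Fin n → ℝ} {l : ℝ} (hl : ∀ i, |l * b i| ≤ 1 / 2)
    (k : ℕ) : l ^ (2 * k) * gamMoment θ (2 * k) b / ((2 * k).factorial : ℝ)
      ≤ 2 * Real.exp (θ * (|l * ∑ i, b i| + 2 * l ^ 2 * ∑ i, b i ^ 2)) := by
  have hf : (0 : ℝ) < ((2 * k).factorial : ℝ) := by exact_mod_cast Nat.factorial_pos _
  have hl0 := (even_two_mul k).pow_nonneg l
  rw [← ENNReal.ofReal_le_ofReal_iff (by positivity)]
  have h1 := lintegral_exp_gamPi_le hθ hl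
  have h2 := lintegral_exp_gamPi_le hθ (b := b) (l := -l) (by simpa using hl)
  rw [neg_sq, neg_mul, abs_neg] at h2
  calc _ = ENNReal.ofReal (l ^ (2 * k) / ((2 * k).factorial : ℝ))
          * ENNReal.ofReal (gamMoment θ (2 * k) b) := by
        rw [← ENNReal.ofReal_mul (by positivity)]; congr 1; ring
    _ = ENNReal.ofReal (l ^ (2 * k) / ((2 * k).factorial : ℝ))
          * ∫⁻ γ, ENNReal.ofReal ((∑ i, γ i * b i) ^ (2 * k)) ∂gamPi θ n := by
        rw [ofReal_gamMoment hθ]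
    _ ≤ ∫⁻ γ, (ENNReal.ofReal (Real.exp (l * ∑ i, γ i * b i))
          + ENNReal.ofReal (Real.exp (-l * ∑ i, γ i * b i))) ∂gamPi θ n := by
        rw [← lintegral_const_mul' _ _ ENNReal.ofReal_ne_top]
        refine lintegral_mono fun γ => ?_
        rw [← ENNReal.ofReal_mul (by positivity), ← ENNReal.ofReal_add (Real.exp_pos _).le
          (Real.exp_pos _).le]
        refine ENNReal.ofReal_le_ofReal ?_
        have := pow_div_factorial_le (l * ∑ i, γ i * b i) k
        rw [mul_pow] at this
        rw [neg_mul]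
        refine le_trans (le_of_eq ?_) this
        ring
    _ ≤ _ := by
        rw [lintegral_add_left (by fun_prop), two_mul,
          ENNReal.ofReal_add (Real.exp_pos _).le (Real.exp_pos _).le]
        exact add_le_add h1 h2

theorem sum_antidiagonal_pow_div_factorial (u v : ℝ) (d : ℕ) :
    ∑ p ∈ antidiagonal d, u ^ p.1 / (p.1.factorial : ℝ) * (v ^ p.2 / (p.2.factorial : ℝ))
      = (u + v) ^ d / (d.factorial : ℝ) := by
  rw [(Commute.all u v).add_pow', sum_div]
  refine sum_congr rfl fun p hp => ?_
  have h := Nat.add_choose_mul_factorial_mul_factorial p.2 p.1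
  rw [add_comm, mem_antidiagonal.1 hp, mul_right_comm] at h
  have h' : (d.choose p.1 : ℝ) * p.1.factorial * p.2.factorial = d.factorial := by exact_mod_cast h
  have h1 := Nat.cast_ne_zero (R := ℝ).2 p.1.factorial_ne_zero
  have h2 := Nat.cast_ne_zero (R := ℝ).2 p.2.factorial_ne_zero
  have h3 := Nat.cast_ne_zero (R := ℝ).2 d.factorial_ne_zero
  rw [nsmul_eq_mul]
  field_simp
  rw [← h']
  ring

theorem norm_mbfComp_le (hθ : 0 < θ) (x : ℕ → ℂ) (d : ℕ) {b : Fin n → ℝ} (hb : StrictAnti b) :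
    ‖mbfComp θ x n d b‖
      ≤ ((∑ k ∈ range n, ‖x k‖ * (k + 1)) * ‖b‖) ^ d / (d.factorial : ℝ) := by
  induction n generalizing d with
  | zero =>
    rw [mbfComp]
    split_ifs with h
    · simp [h]
    · simp; positivity
  | succ n ih =>
    have hP := isProbabilityMeasure_daK hθ hb
    rw [mbfComp, sum_range_succ, add_comm (∑ k ∈ range n, _), add_mul, ← sum_antidiagonal_pow_div_factorial]
    refine (norm_sum_le _ _).trans (sum_le_sum fun p _ => ?_)
    rw [norm_mul, norm_div, norm_pow, norm_mul, Complex.norm_natCast]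
    refine mul_le_mul ?_ ?_ (norm_nonneg _) (by positivity)
    · rw [mul_assoc]
      gcongr
      rw [Complex.norm_real]
      refine (norm_sum_le _ _).trans ?_
      calc ∑ i, ‖b i‖ ≤ ∑ _i : Fin (n + 1), ‖b‖ := sum_le_sum fun i _ => norm_le_pi_norm b i
        _ = (n + 1) * ‖b‖ := by simp
    · refine (norm_integral_le_of_norm_le_const (C := ((∑ k ∈ range n, ‖x k‖ * (k + 1)) * ‖b‖) ^ p.2
        / (p.2.factorial : ℝ)) ((ae_interlaces_daK θ b).mono fun a ha => ?_)).trans ?_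
      · refine (ih p.2 (ha.strictAnti hb)).trans ?_
        have := ha.norm_le
        gcongr
      · simp

theorem mbfComp_succ_of_eq_zero {x : ℕ → ℂ} (hx : x n = 0) (d : ℕ) (b : Fin (n + 1) → ℝ) :
    mbfComp θ x (n + 1) d b = ∫ a, mbfComp θ x n d a ∂daK θ b := by
  rw [mbfComp, sum_eq_single (0, d)]
  · simp
  · rintro ⟨i, j⟩ hp hne
    have : i ≠ 0 := by
      rintro rfl
      apply hne
      simpa using hp
    simp [hx, this]
  · simp

theorem norm_mbfComp_le_of_le {m : ℕ} (hm : 0 < m) (hθ : 0 < θ) {x : ℕ → ℂ} (hx : ∀ k, m ≤ k → x k = 0)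
    {d i j : ℕ} {α β : ℝ} (h : ∀ a : Fin m → ℝ, StrictAnti a →
      ‖mbfComp θ x m d a‖ ≤ α * dirMoment θ i a + β * dirMoment θ j a) {N : ℕ} (hN : m ≤ N)
    {b : Fin N → ℝ} (hb : StrictAnti b) :
    ‖mbfComp θ x N d b‖ ≤ α * dirMoment θ i b + β * dirMoment θ j b := by
  induction N, hN using Nat.le_induction with
  | base => exact h b hb
  | succ N hN ih =>
    have hN0 := hm.trans_le hN
    rw [mbfComp_succ_of_eq_zero (hx N hN)]
    have hi := integrable_dirMoment hθ hN0 hb i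
    have hj := integrable_dirMoment hθ hN0 hb j
    refine (norm_integral_le_of_norm_le ((hi.const_mul α).add (hj.const_mul β))
      ((ae_interlaces_daK θ b).mono fun a ha => ih (ha.strictAnti hb))).trans ?_
    simp only [Pi.add_apply]
    rw [integral_add (hi.const_mul α) (hj.const_mul β), integral_const_mul, integral_const_mul,
      integral_dirMoment hθ hN0 hb, integral_dirMoment hθ hN0 hb]

theorem pow_le_rf {x : ℝ} (hx : 0 < x) (k : ℕ) : x ^ k ≤ rf x k := by
  rw [rf, ← card_range k, ← prod_const, card_range]
  exact prod_le_prod (fun _ _ => hx.le) fun i _ => by simp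

theorem dirMoment_even_nonneg (hθ : 0 < θ) (k : ℕ) (a : Fin n → ℝ) : 0 ≤ dirMoment θ (2 * k) a :=
  div_nonneg (gamMoment_even_nonneg _ _ _) (prod_nonneg fun _ _ => by positivity)

/-- Bound for the even Dirichlet moments. -/
theorem dirMoment_even_le (hθ : 0 < θ) (hn : 0 < n) {b : Fin n → ℝ} {l : ℝ}
    (hl : ∀ i, |l * b i| ≤ 1 / 2) (k : ℕ) :
    (l * (n * θ)) ^ (2 * k) * dirMoment θ (2 * k) b / ((2 * k).factorial : ℝ)
      ≤ 2 * Real.exp (θ * (|l * ∑ i, b i| + 2 * l ^ 2 * ∑ i, b i ^ 2)) := by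
  refine le_trans ?_ (gamMoment_even_le hθ hl k)
  have hnθ : 0 < n * θ := by positivity
  have hl0 := (even_two_mul k).pow_nonneg l
  have h1 := gamMoment_even_nonneg θ k b
  have h2 := rf_pos hnθ (2 * k)
  rw [mul_pow, mul_assoc]
  gcongr
  rw [dirMoment, mul_div_assoc', div_le_iff₀ h2, mul_comm]
  gcongr
  exact pow_le_rf hnθ _

/-- Domination of the Taylor components, uniform in the number of levels. -/
theorem exists_norm_mbfComp_le (hθ : 0 < θ) {m : ℕ} (hm : 0 < m) : ∃ C : ℝ, 0 < C ∧
    ∀ (x : ℕ → ℂ), (∀ k, m ≤ k → x k = 0) → ∀ N, m ≤ N → ∀ l : ℝ,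
      8 * ∑ k ∈ range m, ‖x k‖ * (k + 1) ≤ l * (N * θ) →
      ∀ b : Fin N → ℝ, StrictAnti b → (∀ i, |l * b i| ≤ 1 / 2) → ∀ d,
      ‖mbfComp θ x N d b‖
        ≤ C * Real.exp (θ * (|l * ∑ i, b i| + 2 * l ^ 2 * ∑ i, b i ^ 2)) * (1 / 2) ^ d := by
  obtain ⟨m, rfl⟩ := Nat.exists_eq_succ_of_ne_zero hm.ne'
  obtain ⟨c, hc, hcd⟩ := exists_le_dirMoment hθ m
  refine ⟨12 / c, by positivity, fun x hx N hN l hl b hb hlb d => ?_⟩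
  set Q := ∑ k ∈ range (m + 1), ‖x k‖ * (k + 1) with hQ
  have hQ0 : 0 ≤ Q := sum_nonneg fun k _ => by positivity
  set E := Real.exp (θ * (|l * ∑ i, b i| + 2 * l ^ 2 * ∑ i, b i ^ 2)) with hE
  have hE0 : 0 < E := Real.exp_pos _
  have hN0 := hm.trans_le hN
  have hdm : ∀ k {n : ℕ} (a : Fin n → ℝ), 0 ≤ dirMoment θ (2 * k) a := fun k n a =>
    dirMoment_even_nonneg hθ k a
  -- even moments, at level `N` and at level `m`
  have hev : ∀ k, (2 * Q) ^ (2 * k) / ((2 * k).factorial : ℝ) * dirMoment θ (2 * k) b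
      ≤ 2 * E * (1 / 4) ^ (2 * k) := by
    intro k
    have h1 := dirMoment_even_le hθ hN0 hlb k
    have h2 : (8 * Q) ^ (2 * k) * dirMoment θ (2 * k) b / ((2 * k).factorial : ℝ) ≤ 2 * E := by
      refine le_trans ?_ h1
      have := hdm k b
      gcongr
    have h3 : 2 * Q = 1 / 4 * (8 * Q) := by ring
    rw [h3, mul_pow]
    calc _ = (8 * Q) ^ (2 * k) * dirMoment θ (2 * k) b / ((2 * k).factorial : ℝ) * (1 / 4) ^ (2 * k) := by ring
      _ ≤ _ := by gcongr
  have hpt : ∀ k (a : Fin (m + 1) → ℝ), (Q * ‖a‖) ^ (2 * k)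
      ≤ c⁻¹ * ((2 * Q) ^ (2 * k) * dirMoment θ (2 * k) a) := by
    intro k a
    have h1 : Q * ‖a‖ = 2 * Q * (‖a‖ / 2) := by ring
    rw [h1, mul_pow, mul_left_comm]
    gcongr
    rw [inv_mul_eq_div, le_div_iff₀ hc, mul_comm]
    exact hcd k a
  rcases Nat.even_or_odd' d with ⟨k, rfl | rfl⟩
  · have h1 : ∀ a : Fin (m + 1) → ℝ, StrictAnti a → ‖mbfComp θ x (m + 1) (2 * k) a‖
        ≤ c⁻¹ * ((2 * Q) ^ (2 * k) / ((2 * k).factorial : ℝ)) * dirMoment θ (2 * k) a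
          + 0 * dirMoment θ (2 * k) a := by
      intro a ha
      refine (norm_mbfComp_le hθ x _ ha).trans ?_
      rw [zero_mul, add_zero, div_le_iff₀ (by positivity)]
      refine (hpt k a).trans (le_of_eq ?_)
      field_simp
    refine (norm_mbfComp_le_of_le hm hθ hx h1 hN hb).trans ?_
    have h2 := hev k
    have h4 : (1 / 4 : ℝ) ^ (2 * k) ≤ (1 / 2) ^ (2 * k) := by gcongr; norm_num
    calc _ = c⁻¹ * ((2 * Q) ^ (2 * k) / ((2 * k).factorial : ℝ) * dirMoment θ (2 * k) b) := by ring
      _ ≤ c⁻¹ * (2 * E * (1 / 2) ^ (2 * k)) := by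
        refine mul_le_mul_of_nonneg_left (h2.trans ?_) (by positivity)
        gcongr
      _ ≤ 12 / c * E * (1 / 2) ^ (2 * k) := by
        have : 0 ≤ c⁻¹ * E * (1 / 2) ^ (2 * k) := by positivity
        calc _ = 2 * (c⁻¹ * E * (1 / 2) ^ (2 * k)) := by ring
          _ ≤ 12 * (c⁻¹ * E * (1 / 2) ^ (2 * k)) := by linarith
          _ = _ := by ring
  · have h1 : ∀ a : Fin (m + 1) → ℝ, StrictAnti a → ‖mbfComp θ x (m + 1) (2 * k + 1) a‖
        ≤ c⁻¹ * ((2 * Q) ^ (2 * k) / ((2 * k).factorial : ℝ)) * dirMoment θ (2 * k) a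
          + c⁻¹ * ((2 * k + 2) * ((2 * Q) ^ (2 * (k + 1)) / ((2 * (k + 1)).factorial : ℝ)))
            * dirMoment θ (2 * (k + 1)) a := by
      intro a ha
      refine (norm_mbfComp_le hθ x _ ha).trans ?_
      set t := (∑ k ∈ range (m + 1), ‖x k‖ * (k + 1)) * ‖a‖ with ht
      have ht0 : 0 ≤ t := by positivity
      have h2 : t ^ (2 * k + 1) ≤ t ^ (2 * k) + t ^ (2 * (k + 1)) := by
        have h3 : t ≤ 1 + t ^ 2 := by nlinarith [sq_nonneg (t - 1)]
        calc t ^ (2 * k + 1) = t ^ (2 * k) * t := pow_succ _ _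
          _ ≤ t ^ (2 * k) * (1 + t ^ 2) := by gcongr
          _ = _ := by ring
      have h5 : t ^ (2 * k) / ((2 * k + 1).factorial : ℝ) ≤ t ^ (2 * k) / ((2 * k).factorial : ℝ) := by
        gcongr
        omega
      have h6 : t ^ (2 * (k + 1)) / ((2 * k + 1).factorial : ℝ)
          = (2 * k + 2) * (t ^ (2 * (k + 1)) / ((2 * (k + 1)).factorial : ℝ)) := by
        have : (2 * (k + 1)).factorial = (2 * k + 2) * (2 * k + 1).factorial := by
          rw [← Nat.factorial_succ]; rfl
        rw [this]
        push_cast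
        field_simp
      calc t ^ (2 * k + 1) / ((2 * k + 1).factorial : ℝ)
          ≤ (t ^ (2 * k) + t ^ (2 * (k + 1))) / ((2 * k + 1).factorial : ℝ) := by gcongr
        _ ≤ t ^ (2 * k) / ((2 * k).factorial : ℝ)
            + (2 * k + 2) * (t ^ (2 * (k + 1)) / ((2 * (k + 1)).factorial : ℝ)) := by
          rw [add_div, h6]; gcongr
        _ ≤ c⁻¹ * ((2 * Q) ^ (2 * k) * dirMoment θ (2 * k) a) / ((2 * k).factorial : ℝ)
            + (2 * k + 2) * (c⁻¹ * ((2 * Q) ^ (2 * (k + 1)) * dirMoment θ (2 * (k + 1)) a)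
              / ((2 * (k + 1)).factorial : ℝ)) := by
          gcongr
          · exact hpt k a
          · exact hpt (k + 1) a
        _ = _ := by ring
    refine (norm_mbfComp_le_of_le hm hθ hx h1 hN hb).trans ?_
    have h2 := hev k
    have h3 := hev (k + 1)
    have h4 : (1 / 4 : ℝ) ^ (2 * k) ≤ 2 * (1 / 2) ^ (2 * k + 1) := by
      have : (1 / 4 : ℝ) ^ (2 * k) ≤ (1 / 2) ^ (2 * k) := by gcongr; norm_num
      rw [pow_succ]; linarith
    have h5 : (2 * k + 2) * (1 / 4 : ℝ) ^ (2 * (k + 1)) ≤ (1 / 2) ^ (2 * k + 1) := by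
      have h6 : ((2 * k + 2 : ℕ) : ℝ) ≤ 2 ^ (2 * k + 2) := by
        exact_mod_cast (Nat.lt_two_pow_self (n := 2 * k + 2)).le
      have h7 : (1 / 4 : ℝ) ^ (2 * (k + 1)) = (1 / 2) ^ (2 * k + 2) * (1 / 2) ^ (2 * k + 2) := by
        rw [← mul_pow]; norm_num; ring_nf
      have h8 : (2 : ℝ) ^ (2 * k + 2) * (1 / 2) ^ (2 * k + 2) = 1 := by
        rw [← mul_pow]; norm_num
      have h9 : (1 / 2 : ℝ) ^ (2 * k + 2) ≤ (1 / 2) ^ (2 * k + 1) :=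
        pow_le_pow_of_le_one (by norm_num) (by norm_num) (by omega)
      push_cast at h6
      calc (2 * k + 2) * (1 / 4 : ℝ) ^ (2 * (k + 1))
          ≤ 2 ^ (2 * k + 2) * ((1 / 2) ^ (2 * k + 2) * (1 / 2) ^ (2 * k + 2)) := by
            rw [h7]; gcongr
        _ = (1 / 2) ^ (2 * k + 2) := by rw [← mul_assoc, h8, one_mul]
        _ ≤ _ := h9
    calc _ = c⁻¹ * ((2 * Q) ^ (2 * k) / ((2 * k).factorial : ℝ) * dirMoment θ (2 * k) b)
          + c⁻¹ * ((2 * k + 2) * ((2 * Q) ^ (2 * (k + 1)) / ((2 * (k + 1)).factorial : ℝ)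
            * dirMoment θ (2 * (k + 1)) b)) := by ring
      _ ≤ c⁻¹ * (2 * E * (1 / 4) ^ (2 * k))
          + c⁻¹ * ((2 * k + 2) * (2 * E * (1 / 4) ^ (2 * (k + 1)))) := by gcongr
      _ = c⁻¹ * 2 * E * ((1 / 4) ^ (2 * k) + (2 * k + 2) * (1 / 4) ^ (2 * (k + 1))) := by ring
      _ ≤ c⁻¹ * 2 * E * (2 * (1 / 2) ^ (2 * k + 1) + (1 / 2) ^ (2 * k + 1)) := by gcongr
      _ ≤ 12 / c * E * (1 / 2) ^ (2 * k + 1) := by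
        have : 0 ≤ c⁻¹ * E * (1 / 2) ^ (2 * k + 1) := by positivity
        calc _ = 6 * (c⁻¹ * E * (1 / 2) ^ (2 * k + 1)) := by ring
          _ ≤ 12 * (c⁻¹ * E * (1 / 2) ^ (2 * k + 1)) := by linarith
          _ = _ := by ring

end Domination

section CoefficientBounds

open MvPolynomial Finset

variable {n : ℕ} {θ : ℝ}

theorem norm_eval_le_of_antitone {G : MvPolynomial (Fin n) ℂ} {H : (Fin n → ℝ) → ℝ}
    (hH : Continuous H) {r : ℝ}
    (h : ∀ b : Fin n → ℝ, StrictAnti b → (∀ i, |b i| ≤ r) → ‖eval (toC b) G‖ ≤ H b)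
    {b : Fin n → ℝ} (hb : Antitone b) (hr : ∀ i, |b i| < r) : ‖eval (toC b) G‖ ≤ H b := by
  have hc : Continuous fun (δ : ℝ) (i : Fin n) => b i + δ * -(i : ℝ) := by fun_prop
  have h0 : (fun i => b i + 0 * -((i : ℕ) : ℝ)) = b := by simp
  have h1 : Tendsto (fun (δ : ℝ) (i : Fin n) => b i + δ * -(i : ℝ)) (𝓝[>] 0) (𝓝 b) := by
    have := hc.tendsto 0
    rw [h0] at this
    exact this.mono_left nhdsWithin_le_nhds
  have hG : Continuous fun b : Fin n → ℝ => ‖eval (toC b) G‖ :=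
    (G.continuous_eval.comp (by fun_prop)).norm
  refine le_of_tendsto_of_tendsto ((hG.tendsto b).comp h1) ((hH.tendsto b).comp h1) ?_
  have h2 : ∀ᶠ δ in 𝓝[>] (0 : ℝ), ∀ i : Fin n, |b i + δ * -(i : ℝ)| < r := by
    rw [eventually_all]
    intro i
    have : Tendsto (fun δ : ℝ => |b i + δ * -(i : ℝ)|) (𝓝[>] 0) (𝓝 |b i|) := by
      have h3 := ((continuous_apply i).tendsto b).comp h1
      exact h3.abs
    exact this.eventually_lt_const (hr i)
  filter_upwards [h2, self_mem_nhdsWithin] with δ hδ hpos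
  refine h _ (fun i j hij => ?_) fun i => (hδ i).le
  have h4 : δ * -(j : ℝ) < δ * -(i : ℝ) :=
    mul_lt_mul_of_pos_left (strictAnti_neg_coe n hij) hpos
  have := hb hij.le
  linarith

theorem toSym_injective_of_support {d : ℕ} {f : MvPolynomial ℕ ℂ}
    (hf : ∀ s ∈ f.support, s 0 = 0) (hd : ∀ s ∈ f.support, ∀ k, d < k → s k = 0)
    (h : (toSym f : MvPolynomial (Fin d) ℂ) = 0) : f = 0 := by
  obtain ⟨q, rfl⟩ := exists_rename_eq_of_vars_subset_range f (fun i : Fin d => (i : ℕ) + 1)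
    (fun i j hij => Fin.ext (by simpa using hij)) (by
      intro k hk
      obtain ⟨s, hs, hks⟩ := (mem_vars_iff_mem_support k).1 hk
      have hk0 : k ≠ 0 := fun h0 => (Finsupp.mem_support_iff.1 hks) (h0 ▸ hf s hs)
      have hkd : ¬ d < k := fun h0 => (Finsupp.mem_support_iff.1 hks) (hd s hs k h0)
      exact ⟨⟨k - 1, by omega⟩, by simp; omega⟩)
  have hq : esymmAlgHom (Fin d) ℂ d q = 0 := by
    apply Subtype.ext
    rw [esymmAlgHom_apply]
    rw [toSym, aeval_rename] at h
    exact h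
  rw [(injective_iff_map_eq_zero _).1 (esymmAlgHom_fin_injective ℂ le_rfl) q hq, map_zero]

/-- Points with decreasing positive coordinates bounded by `ε`. -/
def decreasingBox (d : ℕ) (ε : ℝ) : Set (Fin d → ℝ) :=
  {β | StrictAnti β ∧ ∀ i, 0 < β i ∧ β i < ε}

theorem eq_zero_of_eval_decreasingBox {d : ℕ} {ε : ℝ} (hε : 0 < ε) {F : MvPolynomial (Fin d) ℂ}
    (h : ∀ β ∈ decreasingBox d ε, eval (toC β) F = 0) : F = 0 := by
  have hinf : ∀ i : Fin d, ((fun t : ℝ => (t : ℂ)) ''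
      Set.Ioo (ε * (d - i) / (d + 1)) (ε * (d - i + 1) / (d + 1))).Infinite := by
    intro i
    refine Set.Infinite.image Complex.ofReal_injective.injOn (Set.Ioo_infinite ?_)
    have : (0 : ℝ) < d + 1 := by positivity
    gcongr
    linarith
  refine funext_set _ hinf fun x hx => ?_
  rw [Set.mem_univ_pi] at hx
  choose β hβ hβx using hx
  have : x = toC β := funext fun i => (hβx i).symm
  rw [this, map_zero]
  have hd : (0 : ℝ) < d + 1 := by positivity
  refine h β ⟨fun i j hij => ?_, fun i => ⟨?_, ?_⟩⟩
  · refine ((hβ j).2.trans_le ?_).trans (hβ i).1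
    have : ((i : ℕ) : ℝ) + 1 ≤ (j : ℕ) := by exact_mod_cast hij
    gcongr
    linarith
  · refine lt_of_le_of_lt ?_ (hβ i).1
    have : ((i : ℕ) : ℝ) ≤ d := by exact_mod_cast i.2.le
    have : (0 : ℝ) ≤ d - i := by linarith
    positivity
  · refine (hβ i).2.trans_le ?_
    rw [div_le_iff₀ hd]
    have : (0 : ℝ) ≤ (i : ℕ) := by positivity
    gcongr
    linarith

theorem exists_coeff_eq_sum_eval {d : ℕ} {ε : ℝ} (hε : 0 < ε) (S : Finset (ℕ →₀ ℕ))
    (h0 : ∀ s ∈ S, s 0 = 0) (hd : ∀ s ∈ S, ∀ k, d < k → s k = 0) (s : ℕ →₀ ℕ) (hs : s ∈ S) :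
    ∃ c : decreasingBox d ε →₀ ℂ, ∀ f : MvPolynomial ℕ ℂ, f.support ⊆ S →
      coeff s f = c.sum fun β z => z * eval (toC β.1) (toSym f) := by
  let φ : S → decreasingBox d ε → ℂ := fun t β => eval (toC β.1) (toSym (monomial t.1 (1 : ℂ)))
  have hexp : ∀ f : MvPolynomial ℕ ℂ, f.support ⊆ S → ∀ β : decreasingBox d ε,
      eval (toC β.1) (toSym f) = ∑ t : S, coeff t.1 f * φ t β := by
    intro f hf β
    conv_lhs => rw [f.as_sum]
    rw [sum_subset hf (fun t _ ht => by rw [notMem_support_iff.1 ht, monomial_zero]),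
      map_sum, map_sum, ← sum_coe_sort S]
    refine sum_congr rfl fun t _ => ?_
    rw [← mul_one (coeff _ f), ← smul_eq_mul, ← smul_monomial, map_smul, smul_eval]
    simp [φ]
  have hli : LinearIndependent ℂ φ := by
    rw [Fintype.linearIndependent_iff]
    intro g hg t
    let f : MvPolynomial ℕ ℂ := ∑ t : S, monomial t.1 (g t)
    have hcoeff : ∀ t : S, coeff t.1 f = g t := by
      intro t
      simp only [f, coeff_sum, coeff_monomial]
      rw [sum_eq_single t (fun u _ hu => if_neg fun h => hu (Subtype.ext h)) (by simp), if_pos rfl]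
    have hf : f.support ⊆ S := by
      refine support_sum.trans fun u hu => ?_
      obtain ⟨t, -, ht⟩ := Finset.mem_biUnion.1 hu
      rw [Finset.mem_singleton.1 (support_monomial_subset ht)]
      exact t.2
    have hz : f = 0 := by
      refine toSym_injective_of_support (d := d) (fun s hs => h0 s (hf hs))
        (fun s hs => hd s (hf hs)) (eq_zero_of_eval_decreasingBox hε fun β hβ => ?_)
      rw [hexp f hf ⟨β, hβ⟩]
      have := congrFun hg ⟨β, hβ⟩
      simpa [hcoeff] using this
    rw [← hcoeff t, hz, coeff_zero]
  have hsp := span_flip_eq_top_iff_linearIndependent.2 hli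
  have hmem : (Pi.single ⟨s, hs⟩ 1 : S → ℂ) ∈ Submodule.span ℂ (Set.range (flip φ)) := by
    rw [hsp]; trivial
  obtain ⟨c, hc⟩ := (Finsupp.mem_span_range_iff_exists_finsupp).1 hmem
  refine ⟨c, fun f hf => ?_⟩
  simp only [hexp f hf, Finsupp.sum, mul_sum]
  rw [sum_comm]
  have h2 : ∀ t : S, ∑ β ∈ c.support, c β * (coeff t.1 f * φ t β)
      = coeff t.1 f * (Pi.single ⟨s, hs⟩ 1 : S → ℂ) t := by
    intro t
    rw [← hc, Finsupp.sum, Finset.sum_apply, mul_sum]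
    refine sum_congr rfl fun β _ => ?_
    simp only [Pi.smul_apply, smul_eq_mul, flip]
    ring
  simp only [h2]
  rw [sum_eq_single ⟨s, hs⟩ (fun t _ ht => by rw [Pi.single_eq_of_ne ht, mul_zero]) (by simp)]
  simp

theorem eq_zero_of_mem_finsupp_Icc {d k : ℕ} {s : ℕ →₀ ℕ}
    (hs : s ∈ (Finset.Icc 1 d).finsupp fun _ => range (d + 1)) (hk : ¬(1 ≤ k ∧ k ≤ d)) :
    s k = 0 := by
  by_contra h
  exact hk (Finset.mem_Icc.1 ((Finset.mem_finsupp_iff.1 hs).1 (Finsupp.mem_support_iff.2 h)))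

theorem support_subset_finsupp {d : ℕ} {f : MvPolynomial ℕ ℂ}
    (hf : IsWeightedHomogeneous (fun k : ℕ => k) f d) (hf0 : ∀ s ∈ f.support, s 0 = 0) :
    f.support ⊆ (Finset.Icc 1 d).finsupp fun _ => range (d + 1) := by
  intro s hs
  have hw := hf (mem_support_iff.1 hs)
  rw [Finsupp.weight_apply, Finsupp.sum] at hw
  have hle : ∀ k ∈ s.support, s k * k ≤ d := by
    intro k hk
    rw [← hw]
    exact single_le_sum (f := fun k => s k • k) (fun _ _ => Nat.zero_le _) hk
  refine Finset.mem_finsupp_iff.2 ⟨fun k hk => ?_, fun k hk => ?_⟩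
  · have hk0 : k ≠ 0 := by
      rintro rfl
      exact Finsupp.mem_support_iff.1 hk (hf0 s hs)
    have h1 := hle k hk
    have h2 : 1 ≤ s k := Nat.one_le_iff_ne_zero.2 (Finsupp.mem_support_iff.1 hk)
    exact Finset.mem_Icc.2 ⟨Nat.one_le_iff_ne_zero.2 hk0, by nlinarith⟩
  · by_cases hks : k ∈ s.support
    · have := hle k hks
      have := (Finset.mem_Icc.1 hk).1
      rw [Finset.mem_range]
      nlinarith
    · rw [Finsupp.notMem_support_iff.1 hks]; simp

theorem exists_norm_coeff_le {ε : ℝ} (hε : 0 < ε) (d : ℕ) : ∃ C : ℝ, 0 < C ∧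
    ∀ f : MvPolynomial ℕ ℂ, IsWeightedHomogeneous (fun k : ℕ => k) f d →
      (∀ s ∈ f.support, s 0 = 0) → ∀ M : ℝ, 0 ≤ M →
      (∀ β ∈ decreasingBox d ε, ‖eval (toC β) (toSym f)‖ ≤ M) → ∀ s, ‖coeff s f‖ ≤ C * M := by
  classical
  let S : Finset (ℕ →₀ ℕ) := (Finset.Icc 1 d).finsupp fun _ => range (d + 1)
  have h0 : ∀ s ∈ S, s 0 = 0 := fun s hs => eq_zero_of_mem_finsupp_Icc hs (by omega)
  have hd : ∀ s ∈ S, ∀ k, d < k → s k = 0 := fun s hs k hk =>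
    eq_zero_of_mem_finsupp_Icc hs (by omega)
  choose! c hc using exists_coeff_eq_sum_eval hε S h0 hd
  refine ⟨1 + ∑ s ∈ S, ∑ β ∈ (c s).support, ‖c s β‖, by positivity, fun f hf hf0 M hM hβ s => ?_⟩
  have hfS := support_subset_finsupp hf hf0
  by_cases hs : s ∈ S
  · rw [hc s hs f hfS, Finsupp.sum]
    refine (norm_sum_le _ _).trans ?_
    calc ∑ β ∈ (c s).support, ‖c s β * eval (toC β.1) (toSym f)‖
        ≤ ∑ β ∈ (c s).support, ‖c s β‖ * M := by
          refine sum_le_sum fun β _ => ?_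
          rw [norm_mul]
          exact mul_le_mul_of_nonneg_left (hβ β.1 β.2) (norm_nonneg _)
      _ = (∑ β ∈ (c s).support, ‖c s β‖) * M := by rw [sum_mul]
      _ ≤ _ := by
        refine mul_le_mul_of_nonneg_right ?_ hM
        have := single_le_sum (f := fun s => ∑ β ∈ (c s).support, ‖c s β‖)
          (fun _ _ => by positivity) hs
        linarith
  · rw [notMem_support_iff.1 fun h => hs (hfS h), norm_zero]
    positivity

theorem es_map {ι κ A : Type*} [CommRing A] (e : ι ↪ κ) (v : κ → A)
    (T : Finset ι) (k : ℕ) : es v (T.map e) k = es (fun i => v (e i)) T k := by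
  rw [es, powersetCard_map, sum_map]
  simp [es]

theorem es_subset {ι A : Type*} [CommRing A] (v : ι → A) {T U : Finset ι} (h : T ⊆ U)
    (hv : ∀ i ∈ U, i ∉ T → v i = 0) (k : ℕ) : es v U k = es v T k := by
  refine (sum_subset (powersetCard_mono h) fun t ht ht' => ?_).symm
  rw [Finset.mem_powersetCard] at ht ht'
  have : ¬ t ⊆ T := fun h => ht' ⟨h, ht.2⟩
  obtain ⟨i, hi, hiT⟩ := Finset.not_subset.1 this
  exact prod_eq_zero hi (hv i (ht.1 hi) hiT)

/-- Extension of a tuple by zeros. -/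
def padR {d : ℕ} (β : Fin d → ℝ) (N : ℕ) : Fin N → ℝ :=
  fun i => if h : i.1 < d then β ⟨i.1, h⟩ else 0

theorem padR_castLE {d N : ℕ} (h : d ≤ N) (β : Fin d → ℝ) (i : Fin d) :
    padR β N (Fin.castLE h i) = β i := by
  simp [padR]

theorem eval_toSym_padR {d N : ℕ} (h : d ≤ N) (β : Fin d → ℝ) (f : MvPolynomial ℕ ℂ) :
    eval (toC (padR β N)) (toSym f) = eval (toC β) (toSym f) := by
  rw [eval_toSym, eval_toSym]
  congr 2
  funext k
  rw [es_subset (T := univ.map (Fin.castLEEmb h)) _ (subset_univ _), es_map]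
  · congr 1
    funext i
    simp [toC, padR_castLE]
  · intro i _ hi
    have : ¬ i.1 < d := fun hid => hi (Finset.mem_map.2 ⟨⟨i, hid⟩, Finset.mem_univ _, rfl⟩)
    simp [padR, this]

theorem antitone_padR {d : ℕ} {ε : ℝ} {β : Fin d → ℝ} (hβ : β ∈ decreasingBox d ε) (N : ℕ) :
    Antitone (padR β N) := by
  intro i j hij
  simp only [padR]
  split_ifs with h1 h2 h2
  · exact hβ.1.antitone hij
  · exact absurd (lt_of_le_of_lt (Fin.le_def.1 hij) h1) h2
  · exact (hβ.2 _).1.le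
  · exact le_rfl

theorem abs_padR_le {d : ℕ} {ε : ℝ} (hε : 0 < ε) {β : Fin d → ℝ} (hβ : β ∈ decreasingBox d ε)
    (N : ℕ) (i : Fin N) : |padR β N i| < ε := by
  simp only [padR]
  split_ifs with h1
  · rw [abs_of_pos (hβ.2 _).1]; exact (hβ.2 _).2
  · simpa using hε

theorem sum_padR {d N : ℕ} (h : d ≤ N) (β : Fin d → ℝ) (g : ℝ → ℝ) (hg : g 0 = 0) :
    ∑ i, g (padR β N i) = ∑ i, g (β i) := by
  rw [← sum_subset (subset_univ (univ.map (Fin.castLEEmb h)))]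
  · simp [padR_castLE]
  · intro i _ hi
    have : ¬ i.1 < d := fun hid => hi (Finset.mem_map.2 ⟨⟨i, hid⟩, Finset.mem_univ _, rfl⟩)
    simp [padR, this, hg]

theorem exists_norm_mbfComp_scaled_le (hθ : 0 < θ) {m : ℕ} (hm : 0 < m) {Y : ℝ} (hY : 0 ≤ Y) :
    ∃ C l : ℝ, 0 < C ∧ 0 < l ∧
    ∀ y : ℕ → ℂ, (∀ k, m ≤ k → y k = 0) → (∀ k, ‖y k‖ ≤ Y) → ∀ N : ℕ, m ≤ N →
      ∀ b : Fin N → ℝ, StrictAnti b → (∀ i, |l * b i| ≤ 1 / 2) → ∀ d,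
      ‖mbfComp θ (fun k => N * y k - N * y (k + 1)) N d b‖
        ≤ C * Real.exp (θ * (|l * ∑ i, b i| + 2 * l ^ 2 * ∑ i, b i ^ 2)) * (1 / 2) ^ d := by
  obtain ⟨C, hC, h⟩ := exists_norm_mbfComp_le hθ hm
  have hs : 0 ≤ ∑ k ∈ range m, ((k : ℝ) + 1) := by positivity
  refine ⟨C, 8 / θ * (1 + 2 * Y * ∑ k ∈ range m, ((k : ℝ) + 1)), hC, by positivity,
    fun y hy hyY N hN b hb hlb d => ?_⟩
  refine h _ (fun k hk => by rw [hy k hk, hy (k + 1) (by omega), sub_self]) N hN _ ?_ b hb hlb d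
  have h1 : ∑ k ∈ range m, ‖(N : ℂ) * y k - N * y (k + 1)‖ * (k + 1)
      ≤ ∑ k ∈ range m, N * (2 * Y) * ((k : ℝ) + 1) := by
    refine sum_le_sum fun k _ => mul_le_mul_of_nonneg_right ?_ (by positivity)
    rw [← mul_sub, norm_mul, Complex.norm_natCast]
    refine mul_le_mul_of_nonneg_left ((norm_sub_le _ _).trans ?_) (by positivity)
    linarith [hyY k, hyY (k + 1)]
  rw [← mul_sum] at h1
  have h2 : 8 / θ * (1 + 2 * Y * ∑ k ∈ range m, ((k : ℝ) + 1)) * (N * θ)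
      = 8 * (N * (1 + 2 * Y * ∑ k ∈ range m, ((k : ℝ) + 1))) := by field_simp
  rw [h2]
  have : (0 : ℝ) ≤ N := by positivity
  nlinarith

/-- Uniform bounds for the coefficients of the Taylor components as polynomials in the
elementary symmetric functions. -/
theorem exists_norm_coeff_lift_le (hθ : 0 < θ) {m : ℕ} (hm : 0 < m) {Y : ℝ} (hY : 0 ≤ Y) (d : ℕ) :
    ∃ C : ℝ, 0 < C ∧ ∀ y : ℕ → ℂ, (∀ k, m ≤ k → y k = 0) → (∀ k, ‖y k‖ ≤ Y) →
      ∀ N : ℕ, m ≤ N → d ≤ N → ∀ F, IsCompRep θ (fun k => N * y k) N F →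
      ∀ f : MvPolynomial ℕ ℂ, IsWeightedHomogeneous (fun k : ℕ => k) f d →
      (∀ s ∈ f.support, s 0 = 0) → toSym f = F d → ∀ s, ‖coeff s f‖ ≤ C := by
  obtain ⟨C, l, hC, hl, h⟩ := exists_norm_mbfComp_scaled_le hθ hm hY
  set ε : ℝ := 1 / (2 * l) with hεdef
  have hε : 0 < ε := by positivity
  have hlε : l * ε = 1 / 2 := by rw [hεdef]; field_simp
  obtain ⟨D, hD, hcoeff⟩ := exists_norm_coeff_le hε d
  refine ⟨D * (C * Real.exp (θ * (l * (d * ε) + 2 * l ^ 2 * (d * ε ^ 2)))), by positivity,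
    fun y hy hyY N hN hdN F hF f hf hf0 hfF s => ?_⟩
  refine hcoeff f hf hf0 _ (by positivity) (fun β hβ => ?_) s
  rw [← eval_toSym_padR hdN, hfF]
  have key := norm_eval_le_of_antitone (G := F d) (r := ε)
    (H := fun b => C * Real.exp (θ * (|l * ∑ i, b i| + 2 * l ^ 2 * ∑ i, b i ^ 2)) * (1 / 2) ^ d)
    (by fun_prop) (fun b hb hbε => by
      rw [← hF.eval_eq d hb]
      refine h y hy hyY N hN b hb (fun i => ?_) d
      rw [abs_mul, abs_of_pos hl, ← hlε]
      exact mul_le_mul_of_nonneg_left (hbε i) hl.le)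
    (antitone_padR hβ N) (abs_padR_le hε hβ N)
  refine key.trans ?_
  have h1 := sum_padR hdN β (fun t => t) rfl
  have h2 := sum_padR hdN β (fun t => t ^ 2) (by simp)
  rw [h1, h2]
  have h3 : ∑ i, β i ≤ d * ε := by
    refine (sum_le_sum fun i _ => (hβ.2 i).2.le).trans ?_
    simp
  have h4 : ∑ i, β i ^ 2 ≤ d * ε ^ 2 := by
    refine (sum_le_sum fun i _ => pow_le_pow_left₀ (hβ.2 i).1.le (hβ.2 i).2.le 2).trans ?_
    simp
  have h5 : 0 ≤ ∑ i, β i := sum_nonneg fun i _ => (hβ.2 i).1.le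
  rw [abs_of_nonneg (by positivity)]
  have h6 : (1 / 2 : ℝ) ^ d ≤ 1 := pow_le_one₀ (by norm_num) (by norm_num)
  calc _ ≤ C * Real.exp (θ * (l * ∑ i, β i + 2 * l ^ 2 * ∑ i, β i ^ 2)) * 1 := by gcongr
    _ ≤ _ := by rw [mul_one]; gcongr

end CoefficientBounds

section IteratedIntegral

open Finset

variable {n : ℕ} {θ : ℝ}

/-- The multivariate Bessel function as an iterated integral over Dixon–Anderson kernels. -/
def mbfVal (θ : ℝ) (x : ℕ → ℂ) : (n : ℕ) → (Fin n → ℝ) → ℂ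
  | 0, _ => 1
  | n + 1, b => Complex.exp (x n * ((∑ i, b i : ℝ) : ℂ)) * ∫ a, mbfVal θ x n a ∂daK θ b

theorem aestronglyMeasurable_mbfComp (hθ : 0 < θ) (x : ℕ → ℂ) (d : ℕ) {b : Fin (n + 1) → ℝ}
    (hb : StrictAnti b) : AEStronglyMeasurable (mbfComp θ x n d) (daK θ b) := by
  obtain ⟨y, hy⟩ : ∃ y : ℕ → ℂ, x = fun k => y k - y (k + 1) := by
    refine ⟨fun k => -∑ j ∈ range k, x j, ?_⟩
    funext k
    simp only [sum_range_succ]; ring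
  obtain ⟨F, hF⟩ := exists_isCompRep hθ y n
  have hm : Continuous fun a : Fin n → ℝ => MvPolynomial.eval (toC a) (F d) :=
    (F d).continuous_eval.comp (by fun_prop)
  refine hm.aestronglyMeasurable.congr ?_
  filter_upwards [ae_interlaces_daK θ b] with a ha
  rw [hy, hF.eval_eq d (ha.strictAnti hb)]

theorem hasSum_mbfComp (hθ : 0 < θ) (x : ℕ → ℂ) {b : Fin n → ℝ} (hb : StrictAnti b) :
    HasSum (fun d => mbfComp θ x n d b) (mbfVal θ x n b) := by
  induction n with
  | zero =>
    simp only [mbfComp, mbfVal]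
    exact hasSum_ite_eq 0 1
  | succ n ih =>
    have := isProbabilityMeasure_daK hθ hb
    set Q := ∑ k ∈ range n, ‖x k‖ * ((k : ℝ) + 1) with hQ
    have hQ0 : 0 ≤ Q := sum_nonneg fun k _ => by positivity
    have hle : ∀ d, ∀ᵐ a ∂daK θ b, ‖mbfComp θ x n d a‖ ≤ (Q * ‖b‖) ^ d / (d.factorial : ℝ) := by
      intro d
      filter_upwards [ae_interlaces_daK θ b] with a ha
      refine (norm_mbfComp_le hθ x d (ha.strictAnti hb)).trans ?_
      have := ha.norm_le
      gcongr
    have hsum : Summable fun d : ℕ => (Q * ‖b‖) ^ d / (d.factorial : ℝ) :=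
      Real.summable_pow_div_factorial _
    have h1 : HasSum (fun d => ∫ a, mbfComp θ x n d a ∂daK θ b) (∫ a, mbfVal θ x n a ∂daK θ b) := by
      refine hasSum_integral_of_dominated_convergence
        (fun d _ => (Q * ‖b‖) ^ d / (d.factorial : ℝ))
        (fun d => aestronglyMeasurable_mbfComp hθ x d hb) hle (ae_of_all _ fun _ => hsum)
        (integrable_const _) ?_
      filter_upwards [ae_interlaces_daK θ b] with a ha
      exact ih (ha.strictAnti hb)
    have h2 : Summable fun d => ‖∫ a, mbfComp θ x n d a ∂daK θ b‖ := by
      refine Summable.of_nonneg_of_le (fun _ => norm_nonneg _) (fun d => ?_) hsum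
      simpa using norm_integral_le_of_norm_le_const (hle d)
    set z : ℂ := x n * ((∑ i, b i : ℝ) : ℂ) with hz
    have h3 : HasSum (fun d : ℕ => z ^ d / (d.factorial : ℂ)) (Complex.exp z) := by
      rw [Complex.exp_eq_exp_ℂ]
      exact NormedSpace.expSeries_div_hasSum_exp z
    have h4 : Summable fun d : ℕ => ‖z ^ d / (d.factorial : ℂ)‖ :=
      NormedSpace.norm_expSeries_div_summable z
    have h5 := summable_norm_sum_mul_antidiagonal_of_summable_norm h4 h2
    have h6 := tsum_mul_tsum_eq_tsum_sum_antidiagonal_of_summable_norm h4 h2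
    rw [h3.tsum_eq, h1.tsum_eq] at h6
    have h7 := h5.of_norm.hasSum
    rw [← h6] at h7
    exact h7

end IteratedIntegral

section InterlacingArrays

open Finset

variable {n N : ℕ} {θ : ℝ}

/-- Adjoining a top row to a triangular array. -/
def triSnoc (n : ℕ) : (Fin (n + 1) → ℝ) × Tri n ≃ᵐ Tri (n + 1) where
  toFun p := Fin.snoc (α := fun k : Fin (n + 1) => Fin (k.1 + 1) → ℝ) p.2 p.1
  invFun x := (x (Fin.last n), fun k => x k.castSucc)
  left_inv p := by
    refine Prod.ext ?_ ?_
    · exact Fin.snoc_last (α := fun k : Fin (n + 1) => Fin (k.1 + 1) → ℝ) p.1 p.2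
    · funext k
      exact Fin.snoc_castSucc (α := fun k : Fin (n + 1) => Fin (k.1 + 1) → ℝ) p.1 p.2 k
  right_inv x := Fin.snoc_init_self (α := fun k : Fin (n + 1) => Fin (k.1 + 1) → ℝ) x
  measurable_toFun := by
    refine measurable_pi_iff.2 fun k => ?_
    refine Fin.lastCases ?_ (fun k => ?_) k
    · have : (fun p : (Fin (n + 1) → ℝ) × Tri n =>
          Fin.snoc (α := fun k : Fin (n + 1) => Fin (k.1 + 1) → ℝ) p.2 p.1 (Fin.last n))
          = Prod.fst := by
        funext p
        exact Fin.snoc_last (α := fun k : Fin (n + 1) => Fin (k.1 + 1) → ℝ) p.1 p.2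
      have h : Measurable (Prod.fst : (Fin (n + 1) → ℝ) × Tri n → _) := measurable_fst
      rw [← this] at h
      exact h
    · have : (fun p : (Fin (n + 1) → ℝ) × Tri n =>
          Fin.snoc (α := fun k : Fin (n + 1) => Fin (k.1 + 1) → ℝ) p.2 p.1 k.castSucc)
          = fun p => p.2 k := by
        funext p
        exact Fin.snoc_castSucc (α := fun k : Fin (n + 1) => Fin (k.1 + 1) → ℝ) p.1 p.2 k
      have h : Measurable fun p : (Fin (n + 1) → ℝ) × Tri n => p.2 k :=
        (measurable_pi_apply k).comp measurable_snd
      rw [← this] at h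
      exact h
  measurable_invFun := by
    refine (measurable_pi_apply _).prodMk (measurable_pi_iff.2 fun k => measurable_pi_apply _)

theorem triSnoc_last (p : (Fin (n + 1) → ℝ) × Tri n) : triSnoc n p (Fin.last n) = p.1 :=
  Fin.snoc_last (α := fun k : Fin (n + 1) => Fin (k.1 + 1) → ℝ) p.1 p.2

theorem triSnoc_castSucc (p : (Fin (n + 1) → ℝ) × Tri n) (k : Fin n) :
    triSnoc n p k.castSucc = p.2 k :=
  Fin.snoc_castSucc (α := fun k : Fin (n + 1) => Fin (k.1 + 1) → ℝ) p.1 p.2 k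

theorem measurePreserving_triSnoc (n : ℕ) :
    MeasurePreserving (triSnoc n) (volume.prod volume) volume := by
  refine ⟨(triSnoc n).measurable, ?_⟩
  refine (Measure.pi_eq fun s hs => ?_).symm
  rw [Measure.map_apply (triSnoc n).measurable (MeasurableSet.univ_pi hs)]
  have : triSnoc n ⁻¹' Set.univ.pi s
      = s (Fin.last n) ×ˢ Set.univ.pi fun k : Fin n => s k.castSucc := by
    ext p
    simp only [Set.mem_preimage, Set.mem_univ_pi, Set.mem_prod]
    constructor
    · intro h
      refine ⟨?_, fun k => ?_⟩
      · have := h (Fin.last n); rwa [triSnoc_last] at this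
      · have := h k.castSucc; rwa [triSnoc_castSucc] at this
    · rintro ⟨h1, h2⟩ k
      refine Fin.lastCases ?_ (fun k => ?_) k
      · rwa [triSnoc_last]
      · rw [triSnoc_castSucc]; exact h2 k
  rw [this, Measure.prod_prod, Fin.prod_univ_castSucc, mul_comm]
  congr 1
  exact volume_pi_pi fun k : Fin n => s k.castSucc

theorem lvl_triSnoc (b : Fin (n + 2) → ℝ) (a : Fin (n + 1) → ℝ) (x : Tri n) (k : ℕ) (hk : k < n + 1)
    (hk' : k < n + 2) : lvl b (triSnoc n (a, x)) k hk' = lvl a x k hk := by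
  unfold lvl
  by_cases h : k < n
  · rw [dif_pos (show k < n + 2 - 1 by omega), dif_pos (show k < n + 1 - 1 by omega)]
    funext i
    exact congrFun (triSnoc_castSucc (a, x) ⟨k, h⟩) i
  · obtain rfl : k = n := by omega
    rw [dif_pos (show k < k + 2 - 1 by omega), dif_neg (show ¬ k < k + 1 - 1 by omega)]
    funext i
    exact congrFun (triSnoc_last (a, x)) i

theorem lvl_top (b : Fin (n + 1) → ℝ) (x : Tri n) (h : n < n + 1) : lvl b x n h = b := by
  unfold lvl
  rw [dif_neg (by omega)]

theorem obpDomain_triSnoc (b : Fin (n + 2) → ℝ) (a : Fin (n + 1) → ℝ) (x : Tri n) :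
    triSnoc n (a, x) ∈ obpDomain b ↔ Interlaces a b ∧ x ∈ obpDomain a := by
  change (∀ k : Fin (n + 1), Interlaces (triSnoc n (a, x) k) (lvl b (triSnoc n (a, x)) (k.1 + 1) _))
    ↔ _
  constructor
  · intro h
    refine ⟨?_, fun k => ?_⟩
    · have := h (Fin.last n)
      rw [triSnoc_last] at this
      have h2 := lvl_top b (triSnoc n (a, x)) (by omega)
      simpa only [Fin.val_last, h2] using this
    · have := h k.castSucc
      rw [triSnoc_castSucc] at this
      have h2 := lvl_triSnoc b a x (k.1 + 1) (by omega) (by omega)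
      simpa only [Fin.val_castSucc, h2] using this
  · rintro ⟨h1, h2⟩ k
    refine Fin.lastCases ?_ (fun k => ?_) k
    · rw [triSnoc_last]
      have h3 := lvl_top b (triSnoc n (a, x)) (by omega)
      simpa only [Fin.val_last, h3] using h1
    · rw [triSnoc_castSucc]
      have h3 := lvl_triSnoc b a x (k.1 + 1) (by omega) (by omega)
      simpa only [Fin.val_castSucc, h3] using h2 k

theorem sumLvl_triSnoc (b : Fin (n + 2) → ℝ) (a : Fin (n + 1) → ℝ) (x : Tri n) (k : ℕ)
    (hk : k ≤ n + 1) : sumLvl b (triSnoc n (a, x)) k = sumLvl a x k := by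
  unfold sumLvl
  by_cases h0 : k = 0
  · rw [if_pos h0, if_pos h0]
  · rw [if_neg h0, if_neg h0, dif_pos (show k - 1 < n + 2 - 1 by omega)]
    by_cases h : k - 1 < n
    · rw [dif_pos (show k - 1 < n + 1 - 1 by omega)]
      exact sum_congr rfl fun i _ => congrFun (triSnoc_castSucc (a, x) ⟨k - 1, h⟩) i
    · rw [dif_neg (show ¬ k - 1 < n + 1 - 1 by omega)]
      obtain rfl : k = n + 1 := by omega
      exact sum_congr rfl fun i _ => congrFun (triSnoc_last (a, x)) i

theorem sumLvl_top (b : Fin (n + 1) → ℝ) (x : Tri n) : sumLvl b x (n + 1) = ∑ i, b i := by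
  unfold sumLvl
  rw [if_neg (by omega), dif_neg (by omega)]

theorem vdm_rpow (a : Fin n → ℝ) (r : ℝ) :
    vdm a ^ r = ∏ i : Fin n, ∏ j : Fin n, if i < j then |a i - a j| ^ r else 1 := by
  have h : ∀ i j : Fin n, 0 ≤ if i < j then |a i - a j| else 1 := fun i j => by
    split_ifs <;> positivity
  rw [vdm, ← Real.finsetProd_rpow _ _ fun i _ => prod_nonneg fun j _ => h i j]
  refine prod_congr rfl fun i _ => ?_
  rw [← Real.finsetProd_rpow _ _ fun j _ => h i j]
  refine prod_congr rfl fun j _ => ?_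
  split_ifs <;> simp

theorem obpWt_triSnoc (b : Fin (n + 2) → ℝ) (a : Fin (n + 1) → ℝ) (x : Tri n) :
    obpWt θ b (triSnoc n (a, x)) = obpWt θ a x *
      (vdm a ^ (2 - 2 * θ) * ∏ i, ∏ j, |b i - a j| ^ (θ - 1)) := by
  unfold obpWt
  refine (Fin.prod_univ_castSucc (n := n) _).trans ?_
  congr 1
  · refine prod_congr rfl fun k _ => ?_
    rw [triSnoc_castSucc]
    have h3 := lvl_triSnoc b a x (k.1 + 1) (by omega) (by omega)
    simp only [Fin.val_castSucc, h3]
  · rw [triSnoc_last]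
    have h3 := lvl_top b (triSnoc n (a, x)) (by omega)
    simp only [Fin.val_last, h3, vdm_rpow]

/-- The normalised density of the interlacing arrays below `b`. -/
def arrD (θ : ℝ) (b : Fin N → ℝ) (x : Tri (N - 1)) : ℝ :=
  (obpDomain b).indicator (fun x => (∏ k : Fin N, Real.Gamma ((k.1 + 1) * θ)) /
    Real.Gamma θ ^ (N * (N + 1) / 2) * vdm b ^ (1 - 2 * θ) * obpWt θ b x) x

/-- The exponential weight in the integral representation of Bessel functions. -/
def arrE (y : ℕ → ℂ) (b : Fin N → ℝ) (x : Tri (N - 1)) : ℂ :=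
  Complex.exp (∑ k : Fin N, y k * ((sumLvl b x (k.1 + 1) - sumLvl b x k.1 : ℝ) : ℂ))

theorem arrD_triSnoc (hθ : 0 < θ) {b : Fin (n + 2) → ℝ} (hb : StrictAnti b)
    (a : Fin (n + 1) → ℝ) (x : Tri n) :
    arrD θ b (triSnoc n (a, x)) = daD θ b a * arrD θ a x := by
  by_cases h : Interlaces a b
  · by_cases h2 : x ∈ obpDomain a
    · have ha := vdm_pos (h.strictAnti hb).injective
      have e1 : vdm a ^ (2 - 2 * θ) = vdm a * vdm a ^ (1 - 2 * θ) := by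
        rw [show 2 - 2 * θ = 1 + (1 - 2 * θ) by ring, Real.rpow_add ha, Real.rpow_one]
      rw [arrD, Set.indicator_of_mem ((obpDomain_triSnoc b a x).2 ⟨h, h2⟩), arrD,
        Set.indicator_of_mem h2, daD, Set.indicator_of_mem (show a ∈ {a | Interlaces a b} from h),
        obpWt_triSnoc, e1, Fin.prod_univ_castSucc]
      have e2 : (n + 2) * (n + 2 + 1) / 2 = (n + 1) * (n + 1 + 1) / 2 + (n + 2) := by
        rw [show (n + 2) * (n + 2 + 1) = (n + 1) * (n + 1 + 1) + (n + 2) * 2 by ring,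
          Nat.add_mul_div_right _ _ (by norm_num)]
      rw [e2, pow_add]
      have hΓ := (Real.Gamma_pos_of_pos hθ).ne'
      simp only [Fin.val_castSucc, Fin.val_last]
      push_cast
      rw [show (n : ℝ) + 1 + 1 = (n + 1 : ℝ) + 1 by ring]
      generalize (∏ k : Fin (n + 1), Real.Gamma (((k : ℕ) + 1 : ℝ) * θ)) = G
      field_simp
    · have h3 : triSnoc n (a, x) ∉ obpDomain b := fun h3 => h2 ((obpDomain_triSnoc b a x).1 h3).2
      rw [arrD, Set.indicator_of_notMem h3, arrD, Set.indicator_of_notMem h2, mul_zero]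
  · have h3 : triSnoc n (a, x) ∉ obpDomain b := fun h3 => h ((obpDomain_triSnoc b a x).1 h3).1
    rw [arrD, Set.indicator_of_notMem h3, daD,
      Set.indicator_of_notMem (show a ∉ {a | Interlaces a b} from h), zero_mul]

theorem arrE_triSnoc (y : ℕ → ℂ) (b : Fin (n + 2) → ℝ) (a : Fin (n + 1) → ℝ) (x : Tri n) :
    arrE y b (triSnoc n (a, x))
      = Complex.exp (y (n + 1) * ((∑ i, b i - ∑ i, a i : ℝ) : ℂ)) * arrE y a x := by
  rw [arrE, arrE, ← Complex.exp_add]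
  congr 1
  refine Eq.trans ?_ (add_comm _ _)
  refine (Fin.sum_univ_castSucc (n := n + 1) _).trans ?_
  congr 1
  · refine sum_congr rfl fun k _ => ?_
    rw [Fin.val_castSucc, sumLvl_triSnoc b a x _ (by omega), sumLvl_triSnoc b a x _ (by omega)]
  · rw [Fin.val_last, sumLvl_triSnoc b a x _ le_rfl, sumLvl_top b, sumLvl_top a]

theorem measurable_lvl (b : Fin N → ℝ) (k : ℕ) (hk : k < N) (s : Fin (k + 1)) :
    Measurable fun x : Tri (N - 1) => lvl b x k hk s := by
  unfold lvl
  by_cases h : k < N - 1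
  · simp only [dif_pos h]
    exact (measurable_pi_apply s).comp (measurable_pi_apply (⟨k, h⟩ : Fin (N - 1)))
  · simp only [dif_neg h]
    exact measurable_const

theorem measurable_tri_apply (k : Fin N) (i : Fin (k.1 + 1)) :
    Measurable fun x : Tri N => x k i :=
  (measurable_pi_apply i).comp (measurable_pi_apply k)

theorem measurableSet_obpDomain (b : Fin N → ℝ) : MeasurableSet (obpDomain b) := by
  unfold obpDomain Interlaces
  simp only [Set.ofPred_forall]
  refine MeasurableSet.iInter fun k => MeasurableSet.iInter fun i => ?_
  exact (measurableSet_lt (measurable_tri_apply k i) (measurable_lvl b _ _ _)).inter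
    (measurableSet_lt (measurable_lvl b _ _ _) (measurable_tri_apply k i))

theorem measurable_obpWt (b : Fin N → ℝ) : Measurable (obpWt θ b) := by
  unfold obpWt
  refine Finset.measurable_prod _ fun k _ => Measurable.mul ?_ ?_
  · refine Finset.measurable_prod _ fun i _ => Finset.measurable_prod _ fun j _ => ?_
    split_ifs
    · exact (((measurable_tri_apply k i).sub (measurable_tri_apply k j)).abs).pow_const _
    · exact measurable_const
  · refine Finset.measurable_prod _ fun i _ => Finset.measurable_prod _ fun j _ => ?_
    exact (((measurable_lvl b _ _ i).sub (measurable_tri_apply k j)).abs).pow_const _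

theorem measurable_arrD (b : Fin N → ℝ) : Measurable (arrD θ b) :=
  Measurable.indicator (measurable_const.mul (measurable_obpWt b)) (measurableSet_obpDomain b)

theorem measurable_sumLvl (b : Fin N → ℝ) (k : ℕ) :
    Measurable fun x : Tri (N - 1) => sumLvl b x k := by
  unfold sumLvl
  split_ifs with h1 h2
  · exact measurable_const
  · exact Finset.measurable_sum _ fun i _ => measurable_tri_apply _ i
  · exact measurable_const

theorem measurable_arrE (y : ℕ → ℂ) (b : Fin N → ℝ) : Measurable (arrE y b) := by
  unfold arrE
  refine Complex.measurable_exp.comp (Finset.measurable_sum _ fun k _ => measurable_const.mul ?_)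
  exact Complex.measurable_ofReal.comp ((measurable_sumLvl b _).sub (measurable_sumLvl b _))

theorem MBF_eq_integral (y : ℕ → ℂ) (b : Fin N → ℝ) :
    MBF θ b (fun k => y k) = ∫ x, arrE y b x * ((arrD θ b x : ℝ) : ℂ) := by
  rw [MBF, ← integral_indicator (measurableSet_obpDomain b), ← integral_const_mul]
  refine integral_congr_ae (ae_of_all _ fun x => ?_)
  by_cases h : x ∈ obpDomain b
  · simp only [Set.indicator_of_mem h, arrD, arrE, vdm_rpow]
    push_cast
    ring
  · simp only [Set.indicator_of_notMem h, arrD]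
    simp

theorem volume_tri_zero :
    (volume : Measure (Tri (0 + 1 - 1))) = Measure.dirac fun k => k.elim0 :=
  Measure.pi_of_empty (α := Fin 0) (β := fun k => Fin (k.1 + 1) → ℝ) (fun _ => volume) _

theorem arr_one (hθ : 0 < θ) (y : ℕ → ℂ) (b : Fin (0 + 1) → ℝ) (x : Tri (0 + 1 - 1)) :
    arrE y b x * ((arrD θ b x : ℝ) : ℂ) = Complex.exp (y 0 * ((∑ i, b i : ℝ) : ℂ)) := by
  have hx : x ∈ obpDomain b := fun k => k.elim0
  have hΓ := (Real.Gamma_pos_of_pos hθ).ne'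
  have h1 : arrD θ b x = 1 := by
    rw [arrD, Set.indicator_of_mem hx]
    simp [vdm, obpWt, hΓ]
  rw [h1, arrE]
  simp [sumLvl]

theorem abs_sum_le_norm (b : Fin n → ℝ) : |∑ i, b i| ≤ n * ‖b‖ := by
  refine (abs_sum_le_sum_abs _ _).trans ((sum_le_sum fun i _ => norm_le_pi_norm b i).trans ?_)
  simp

theorem arr_triSnoc (hθ : 0 < θ) (y : ℕ → ℂ) {b : Fin (n + 2) → ℝ} (hb : StrictAnti b)
    (a : Fin (n + 1) → ℝ) (x : Tri n) :
    arrE y b (triSnoc n (a, x)) * ((arrD θ b (triSnoc n (a, x)) : ℝ) : ℂ)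
      = (daD θ b a : ℂ) * Complex.exp (y (n + 1) * ((∑ i, b i - ∑ i, a i : ℝ) : ℂ)) *
        (arrE y a x * ((arrD θ a x : ℝ) : ℂ)) := by
  rw [arrE_triSnoc, arrD_triSnoc hθ hb]
  push_cast
  ring

theorem measurable_arr (y : ℕ → ℂ) (b : Fin N → ℝ) :
    Measurable fun x => arrE y b x * ((arrD θ b x : ℝ) : ℂ) :=
  (measurable_arrE y b).mul (Complex.measurable_ofReal.comp (measurable_arrD b))

theorem exists_lintegral_arr_le (hθ : 0 < θ) (y : ℕ → ℂ) (n : ℕ) : ∃ S : ℝ, 0 ≤ S ∧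
    ∀ b : Fin (n + 1) → ℝ, StrictAnti b →
      ∫⁻ x, ‖arrE y b x * ((arrD θ b x : ℝ) : ℂ)‖ₑ ≤ ENNReal.ofReal (Real.exp (S * ‖b‖)) := by
  induction n with
  | zero =>
    refine ⟨‖y 0‖, norm_nonneg _, fun b _ => ?_⟩
    have hvol : (volume : Measure (Tri (0 + 1 - 1))) Set.univ = 1 := by
      rw [volume_tri_zero]; simp
    simp only [arr_one hθ y b, lintegral_const, hvol, mul_one]
    rw [← ofReal_norm]
    refine ENNReal.ofReal_le_ofReal ((Complex.norm_exp_le_exp_norm _).trans (Real.exp_le_exp.2 ?_))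
    rw [norm_mul, Complex.norm_real]
    refine mul_le_mul_of_nonneg_left ?_ (norm_nonneg _)
    simpa using abs_sum_le_norm b
  | succ n ih =>
    obtain ⟨S, hS, h⟩ := ih
    refine ⟨‖y (n + 1)‖ * (2 * n + 3) + S, by positivity, fun b hb => ?_⟩
    have := isProbabilityMeasure_daK hθ hb
    have hm := measurable_arr (θ := θ) y b
    refine ((measurePreserving_triSnoc n).lintegral_comp hm.enorm).symm.trans_le ?_
    refine (lintegral_prod _ (hm.enorm.comp (triSnoc n).measurable).aemeasurable).trans_le ?_
    calc ∫⁻ a, ∫⁻ x, ‖arrE y b (triSnoc n (a, x)) * ((arrD θ b (triSnoc n (a, x)) : ℝ) : ℂ)‖ₑ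
        ≤ ∫⁻ a, ENNReal.ofReal (daD θ b a) *
          ENNReal.ofReal (Real.exp ((‖y (n + 1)‖ * (2 * n + 3) + S) * ‖b‖)) := by
          refine lintegral_mono fun a => ?_
          simp only [arr_triSnoc hθ y hb, enorm_mul (_ * _)]
          refine (lintegral_const_mul _ (measurable_arr (θ := θ) y a).enorm).trans_le ?_
          by_cases hab : Interlaces a b
          · rw [enorm_mul, mul_assoc]
            have e1 : ‖(daD θ b a : ℂ)‖ₑ = ENNReal.ofReal (daD θ b a) := by
              rw [← ofReal_norm, Complex.norm_real, Real.norm_of_nonneg (daD_nonneg hθ b a)]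
            rw [e1]
            refine mul_le_mul_right ?_ _
            refine (mul_le_mul_right (h a (hab.strictAnti hb)) _).trans ?_
            rw [← ofReal_norm, ← ENNReal.ofReal_mul (norm_nonneg _)]
            refine ENNReal.ofReal_le_ofReal ?_
            rw [add_mul, Real.exp_add]
            have e2 := hab.norm_le
            refine mul_le_mul ((Complex.norm_exp_le_exp_norm _).trans (Real.exp_le_exp.2 ?_))
              (Real.exp_le_exp.2 (by gcongr)) (by positivity) (by positivity)
            rw [norm_mul, Complex.norm_real, mul_assoc]
            refine mul_le_mul_of_nonneg_left ?_ (norm_nonneg _)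
            refine (norm_sub_le _ _).trans ?_
            have e3 := abs_sum_le_norm b
            have e4 := abs_sum_le_norm a
            have e5 : ((n + 1 : ℕ) : ℝ) * ‖a‖ ≤ (n + 1 : ℕ) * ‖b‖ := by gcongr
            simp only [Real.norm_eq_abs]
            push_cast at e3 e4 e5
            nlinarith
          · rw [daD, Set.indicator_of_notMem (show a ∉ {a | Interlaces a b} from hab)]
            simp
      _ = _ := by
        rw [lintegral_mul_const _ (measurable_daD θ b).ennreal_ofReal]
        have e : ∫⁻ a, ENNReal.ofReal (daD θ b a) = 1 := by
          have h1 : daK θ b Set.univ = 1 := measure_univ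
          rwa [daK, withDensity_apply _ MeasurableSet.univ, Measure.restrict_univ] at h1
        rw [e, one_mul]

theorem integrable_arr (hθ : 0 < θ) (y : ℕ → ℂ) {b : Fin (n + 1) → ℝ} (hb : StrictAnti b) :
    Integrable fun x => arrE y b x * ((arrD θ b x : ℝ) : ℂ) := by
  obtain ⟨S, -, h⟩ := exists_lintegral_arr_le hθ y n
  exact ⟨(measurable_arr y b).aestronglyMeasurable, (h b hb).trans_lt ENNReal.ofReal_lt_top⟩

theorem integral_arr (hθ : 0 < θ) (y : ℕ → ℂ) {b : Fin (n + 1) → ℝ} (hb : StrictAnti b) :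
    ∫ x, arrE y b x * ((arrD θ b x : ℝ) : ℂ)
      = Complex.exp (y (n + 1) * ((∑ i, b i : ℝ) : ℂ)) *
        mbfVal θ (fun k => y k - y (k + 1)) (n + 1) b := by
  induction n with
  | zero =>
    have hp := isProbabilityMeasure_daK hθ hb
    have hvol : (volume : Measure (Tri (0 + 1 - 1))) Set.univ = 1 := by
      rw [volume_tri_zero]; simp
    simp only [arr_one hθ y b, mbfVal, integral_const, measureReal_def, hvol, measure_univ]
    rw [← mul_assoc, ← Complex.exp_add]
    simp
    ring_nf
  | succ n ih =>
    refine ((measurePreserving_triSnoc n).integral_comp (triSnoc n).measurableEmbedding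
      _).symm.trans ?_
    refine (integral_prod _ (((measurePreserving_triSnoc n).integrable_comp_emb
        (triSnoc n).measurableEmbedding).2 (integrable_arr hθ y hb))).trans ?_
    simp only [Function.comp_apply, arr_triSnoc hθ y hb, integral_const_mul]
    rw [mbfVal, ← mul_assoc, ← Complex.exp_add, daK,
      integral_withDensity_eq_integral_toReal_smul (measurable_daD θ b).ennreal_ofReal
        (ae_of_all _ fun _ => ENNReal.ofReal_lt_top), ← integral_const_mul]
    refine integral_congr_ae (ae_of_all _ fun a => ?_)
    by_cases hab : Interlaces a b
    · have e : ∫ x : Tri n, arrE y a x * ((arrD θ a x : ℝ) : ℂ) = _ := ih (hab.strictAnti hb)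
      simp only [e, ENNReal.toReal_ofReal (daD_nonneg hθ b a), Complex.real_smul]
      rw [Complex.exp_add, show y (n + 1) * ((∑ i, b i - ∑ i, a i : ℝ) : ℂ)
        = y (n + 1 + 1) * ((∑ i, b i : ℝ) : ℂ) + (y (n + 1) - y (n + 1 + 1)) * ((∑ i, b i : ℝ) : ℂ)
          + -(y (n + 1) * ((∑ i, a i : ℝ) : ℂ)) by push_cast; ring,
        Complex.exp_add, Complex.exp_add, Complex.exp_neg]
      field_simp [Complex.exp_ne_zero]
    · simp only [daD, Set.indicator_of_notMem (show a ∉ {a | Interlaces a b} from hab)]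
      simp

theorem MBF_eq_mbfVal (hθ : 0 < θ) (y : ℕ → ℂ) (hN : 0 < N) {b : Fin N → ℝ} (hb : StrictAnti b) :
    MBF θ b (fun k => y k) = Complex.exp (y N * ((∑ i, b i : ℝ) : ℂ)) *
        mbfVal θ (fun k => y k - y (k + 1)) N b := by
  obtain ⟨n, rfl⟩ := Nat.exists_eq_succ_of_ne_zero hN.ne'
  rw [MBF_eq_integral, integral_arr hθ y hb]

end InterlacingArrays

section TranslationScaling

open Finset MvPolynomial

variable {n : ℕ} {θ : ℝ}

theorem daD_add_const (θ : ℝ) (b : Fin (n + 1) → ℝ) (a : Fin n → ℝ) (c : ℝ) :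
    daD θ (fun i => b i + c) (fun i => a i + c) = daD θ b a := by
  have hv : ∀ {k : ℕ} (v : Fin k → ℝ), vdm (fun i => v i + c) = vdm v := fun v => by simp [vdm]
  have hI : Interlaces (fun i => a i + c) (fun i => b i + c) ↔ Interlaces a b := by
    simp [Interlaces]
  by_cases h : Interlaces a b
  · rw [daD, daD, Set.indicator_of_mem (show a ∈ {a | Interlaces a b} from h),
      Set.indicator_of_mem (by exact hI.2 h)]
    simp [hv]
  · rw [daD, daD, Set.indicator_of_notMem (show a ∉ {a | Interlaces a b} from h),
      Set.indicator_of_notMem (by exact fun h' => h (hI.1 h'))]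

theorem mbfVal_add_const (hθ : 0 < θ) (x : ℕ → ℂ) (b : Fin n → ℝ) (c : ℝ) :
    mbfVal θ x n (fun i => b i + c)
      = Complex.exp (c * ∑ k ∈ range n, (k + 1) * x k) * mbfVal θ x n b := by
  induction n with
  | zero => simp [mbfVal]
  | succ n ih =>
    have hInt : ∀ b : Fin (n + 1) → ℝ, ∫ a, mbfVal θ x n a ∂daK θ b
        = ∫ a, daD θ b a • mbfVal θ x n a := fun b => by
      rw [daK, integral_withDensity_eq_integral_toReal_smul (measurable_daD θ b).ennreal_ofReal
        (ae_of_all _ fun _ => ENNReal.ofReal_lt_top)]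
      simp only [ENNReal.toReal_ofReal (daD_nonneg hθ b _)]
    have h := integral_add_right_eq_self (μ := (volume : Measure (Fin n → ℝ)))
      (fun a => daD θ (fun i => b i + c) a • mbfVal θ x n a) (fun _ => c)
    rw [mbfVal, mbfVal, hInt, ← h, hInt]
    have h2 : ∀ a : Fin n → ℝ, daD θ (fun i => b i + c) (a + fun _ => c) •
        mbfVal θ x n (a + fun _ => c) = Complex.exp (c * ∑ k ∈ range n, (k + 1) * x k) *
          daD θ b a • mbfVal θ x n a := fun a => by
      have e : (a + fun _ => c) = fun i => a i + c := rfl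
      rw [e, daD_add_const, ih, mul_smul_comm]
    simp only [h2, integral_const_mul, sum_range_succ (fun k : ℕ => ((k : ℂ) + 1) * x k)]
    rw [← mul_assoc, ← mul_assoc, ← Complex.exp_add, ← Complex.exp_add]
    congr 2
    simp [sum_add_distrib]
    ring

theorem mbfComp_const_mul (x : ℕ → ℂ) (s : ℂ) (d : ℕ) (b : Fin n → ℝ) :
    mbfComp θ (fun k => s * x k) n d b = s ^ d * mbfComp θ x n d b := by
  induction n generalizing d with
  | zero =>
    rcases d with _ | d <;> simp [mbfComp]
  | succ n ih =>
    rw [mbfComp, mbfComp, mul_sum]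
    refine sum_congr rfl fun p hp => ?_
    rw [HasAntidiagonal.mem_antidiagonal] at hp
    simp only [ih, integral_const_mul]
    rw [← hp, pow_add, mul_assoc s, mul_pow s]
    ring

theorem mbfComp_zero_right (hθ : 0 < θ) (x : ℕ → ℂ) {b : Fin n → ℝ} (hb : StrictAnti b) :
    mbfComp θ x n 0 b = 1 := by
  induction n with
  | zero => simp [mbfComp]
  | succ n ih =>
    have := isProbabilityMeasure_daK hθ hb
    simp only [mbfComp, HasAntidiagonal.antidiagonal_zero, sum_singleton, pow_zero, Nat.factorial_zero,
      Nat.cast_one, div_one, one_mul]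
    rw [integral_congr_ae (g := fun _ => (1 : ℂ))]
    · simp
    · filter_upwards [ae_interlaces_daK θ b] with a ha using ih (ha.strictAnti hb)

theorem mbfComp_smul (hθ : 0 < θ) (y : ℕ → ℂ) {s : ℝ} (hs : 0 < s) (d : ℕ) {b : Fin n → ℝ}
    (hb : StrictAnti b) :
    mbfComp θ (fun k => y k - y (k + 1)) n d (fun i => s * b i)
      = (s : ℂ) ^ d * mbfComp θ (fun k => y k - y (k + 1)) n d b := by
  obtain ⟨F, hF⟩ := exists_isCompRep hθ y n
  have hsb : StrictAnti fun i => s * b i := fun i j h => mul_lt_mul_of_pos_left (hb h) hs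
  rw [hF.eval_eq d hb, hF.eval_eq d hsb, eval_eq, eval_eq, mul_sum]
  refine sum_congr rfl fun t ht => ?_
  have e : ∑ i ∈ t.support, t i = d := by
    have := hF.homog d (mem_support_iff.1 ht)
    simpa [Finsupp.weight_apply, Finsupp.sum] using this
  simp only [toC, Complex.ofReal_mul, mul_pow, prod_mul_distrib, prod_pow_eq_pow_sum, e]
  ring

end TranslationScaling

section NewtonAsymptotics

open Finset MvPolynomial

variable {N : ℕ}

theorem es_univ_succ_mul {A ι : Type*} [CommRing A] [Fintype ι] [DecidableEq ι] (v : ι → A)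
    (k : ℕ) : ((k : A) + 1) * es v univ (k + 1) = ∑ i, v i * es1 v i k := by
  have h2 : ∀ i, v i * es1 v i k = es v univ (k + 1) - es1 v i (k + 1) := fun i => by
    rw [es_univ_succ v i k]; ring
  simp only [h2, sum_sub_distrib, sum_es1, sum_const, card_univ, nsmul_eq_mul]
  push_cast
  ring

theorem newton_two {A ι : Type*} [CommRing A] [Fintype ι] [DecidableEq ι] (v : ι → A)
    (h0 : ∑ i, v i = 0) (k : ℕ) : ((k : A) + 1) * es v univ (k + 1)
      = -(∑ i, v i ^ 2) * shiftSeq (es v univ) k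
        + ∑ i, v i ^ 3 * shiftSeq (shiftSeq (es1 v i)) k := by
  rw [es_univ_succ_mul]
  rcases k with _ | _ | k
  · simp [shiftSeq, es1, es_zero, h0]
  · simp only [shiftSeq, es_zero, mul_one, mul_zero, sum_const_zero, add_zero]
    have : ∀ i, v i * es1 v i (0 + 1) = v i * es v univ 1 - v i ^ 2 := fun i => by
      rw [es_univ_succ v i 0, es1, es1, es_zero]; ring
    simp only [this, sum_sub_distrib, ← sum_mul, h0]
    ring
  · simp only [shiftSeq]
    have : ∀ i, v i * es1 v i (k + 1 + 1) = v i * es v univ (k + 1 + 1)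
        - v i ^ 2 * es v univ (k + 1) + v i ^ 3 * es1 v i k := fun i => by
      rw [es_univ_succ v i (k + 1), es_univ_succ v i k]; ring
    simp only [this, sum_sub_distrib, sum_add_distrib, ← sum_mul, h0]
    ring

theorem sum_norm_pow_le {c : ℝ} {w : Fin N → ℂ} (hw : ∀ i, ‖w i‖ ≤ c / √N) :
    ∑ i, ‖w i‖ ^ 2 ≤ c ^ 2 := by
  rcases Nat.eq_zero_or_pos N with rfl | hN
  · simpa using sq_nonneg c
  calc ∑ i, ‖w i‖ ^ 2 ≤ ∑ i : Fin N, (c / √N) ^ 2 :=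
        sum_le_sum fun i _ => pow_le_pow_left₀ (norm_nonneg _) (hw i) 2
    _ = c ^ 2 := by
      have : (N : ℝ) ≠ 0 := by positivity
      simp only [sum_const, card_univ, Fintype.card_fin, nsmul_eq_mul, div_pow,
        Real.sq_sqrt (Nat.cast_nonneg N)]
      field_simp

theorem sum_norm_cube_le {c : ℝ} (hc : 0 ≤ c) {w : Fin N → ℂ} (hw : ∀ i, ‖w i‖ ≤ c / √N) :
    ∑ i, ‖w i‖ ^ 3 ≤ c ^ 3 / √N := by
  calc ∑ i, ‖w i‖ ^ 3 ≤ ∑ i : Fin N, (c / √N) * ‖w i‖ ^ 2 :=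
        sum_le_sum fun i _ => by
          rw [pow_succ' _ 2]; exact mul_le_mul_of_nonneg_right (hw i) (by positivity)
    _ = (c / √N) * ∑ i, ‖w i‖ ^ 2 := by rw [mul_sum]
    _ ≤ (c / √N) * c ^ 2 := mul_le_mul_of_nonneg_left (sum_norm_pow_le hw) (by positivity)
    _ = _ := by ring

theorem norm_le_of_le_div_sqrt {c : ℝ} (hc : 0 ≤ c) {w : Fin N → ℂ} (hw : ∀ i, ‖w i‖ ≤ c / √N)
    (i : Fin N) : ‖w i‖ ≤ c := by
  refine (hw i).trans (div_le_self hc ?_)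
  rw [Real.one_le_sqrt]
  exact_mod_cast i.pos

theorem exists_norm_es_le {c : ℝ} (hc : 0 ≤ c) (k : ℕ) : ∃ A : ℝ, 0 < A ∧
    ∀ N : ℕ, 0 < N → ∀ w : Fin N → ℂ, (∀ i, ‖w i‖ ≤ c / √N) → ∑ i, w i = 0 →
      ∀ j ≤ k, ‖es w univ j‖ ≤ A ∧ ∀ i, ‖es1 w i j‖ ≤ A := by
  induction k with
  | zero =>
    refine ⟨1, one_pos, fun N hN w hw h0 j hj => ?_⟩
    obtain rfl : j = 0 := by omega
    simp [es1, es_zero]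
  | succ k ih =>
    obtain ⟨A, hA, h⟩ := ih
    refine ⟨A + (c ^ 2 * A + c ^ 3 * A) + c * A, by positivity, fun N hN w hw h0 j hj => ?_⟩
    rcases hj.lt_or_eq with hj' | rfl
    · obtain ⟨h1, h2⟩ := h N hN w hw h0 j (by omega)
      have : 0 ≤ (c ^ 2 * A + c ^ 3 * A) + c * A := by positivity
      exact ⟨by linarith, fun i => by linarith [h2 i]⟩
    have hsqrt : 1 ≤ √(N : ℝ) := by rw [Real.one_le_sqrt]; exact_mod_cast hN
    have hs1 : ‖shiftSeq (es w univ) k‖ ≤ A := by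
      rcases k with _ | k
      · simpa [shiftSeq] using hA.le
      · exact (h N hN w hw h0 k (by omega)).1
    have hs2 : ∀ i, ‖shiftSeq (shiftSeq (es1 w i)) k‖ ≤ A := fun i => by
      rcases k with _ | _ | k
      · simpa [shiftSeq] using hA.le
      · simpa [shiftSeq] using hA.le
      · exact (h N hN w hw h0 k (by omega)).2 i
    have key : ‖es w univ (k + 1)‖ ≤ c ^ 2 * A + c ^ 3 * A := by
      have e1 : ‖((k : ℂ) + 1) * es w univ (k + 1)‖ ≤ c ^ 2 * A + c ^ 3 * A := by
        rw [newton_two w h0]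
        refine (norm_add_le _ _).trans (add_le_add ?_ ?_)
        · rw [norm_mul, norm_neg]
          refine mul_le_mul ?_ hs1 (norm_nonneg _) (by positivity)
          refine (norm_sum_le _ _).trans ?_
          simpa using sum_norm_pow_le hw
        · refine (norm_sum_le _ _).trans ?_
          calc ∑ i, ‖w i ^ 3 * shiftSeq (shiftSeq (es1 w i)) k‖ ≤ ∑ i, ‖w i‖ ^ 3 * A :=
                sum_le_sum fun i _ => by
                  rw [norm_mul, norm_pow]
                  exact mul_le_mul_of_nonneg_left (hs2 i) (by positivity)
            _ = (∑ i, ‖w i‖ ^ 3) * A := by rw [sum_mul]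
            _ ≤ c ^ 3 * A := by
              refine mul_le_mul_of_nonneg_right ((sum_norm_cube_le hc hw).trans ?_) hA.le
              exact div_le_self (by positivity) hsqrt
      refine le_trans ?_ e1
      rw [norm_mul]
      have : (1 : ℝ) ≤ ‖(k : ℂ) + 1‖ := by
        rw [show (k : ℂ) + 1 = ((k + 1 : ℕ) : ℂ) by push_cast; ring, Complex.norm_natCast]
        push_cast; linarith [(Nat.cast_nonneg k : (0 : ℝ) ≤ k)]
      exact le_mul_of_one_le_left (norm_nonneg _) this
    refine ⟨by nlinarith [mul_nonneg hc hA.le], fun i => ?_⟩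
    have e : es1 w i (k + 1) = es w univ (k + 1) - w i * es1 w i k := by
      rw [es_univ_succ w i k]; ring
    rw [e]
    refine (norm_sub_le _ _).trans ?_
    rw [norm_mul]
    have h3 := mul_le_mul (norm_le_of_le_div_sqrt hc hw i) ((h N hN w hw h0 k le_rfl).2 i)
      (norm_nonneg _) hc
    linarith

theorem exists_norm_newton_le {c : ℝ} (hc : 0 ≤ c) (k : ℕ) : ∃ A : ℝ, 0 < A ∧
    ∀ N : ℕ, 0 < N → ∀ w : Fin N → ℂ, (∀ i, ‖w i‖ ≤ c / √N) → ∑ i, w i = 0 →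
      ‖((k : ℂ) + 1) * es w univ (k + 1) + (∑ i, w i ^ 2) * shiftSeq (es w univ) k‖ ≤ A / √N := by
  obtain ⟨A, hA, h⟩ := exists_norm_es_le hc k
  refine ⟨c ^ 3 * A + 1, by positivity, fun N hN w hw h0 => ?_⟩
  rw [newton_two w h0, neg_mul, neg_add_cancel_comm]
  refine (norm_sum_le _ _).trans ?_
  have hs2 : ∀ i, ‖shiftSeq (shiftSeq (es1 w i)) k‖ ≤ A := fun i => by
    rcases k with _ | _ | k
    · simpa [shiftSeq] using hA.le
    · simpa [shiftSeq] using hA.le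
    · exact (h N hN w hw h0 k (by omega)).2 i
  calc ∑ i, ‖w i ^ 3 * shiftSeq (shiftSeq (es1 w i)) k‖ ≤ ∑ i, ‖w i‖ ^ 3 * A :=
        sum_le_sum fun i _ => by
          rw [norm_mul, norm_pow]
          exact mul_le_mul_of_nonneg_left (hs2 i) (by positivity)
    _ = (∑ i, ‖w i‖ ^ 3) * A := by rw [sum_mul]
    _ ≤ c ^ 3 / √N * A := mul_le_mul_of_nonneg_right (sum_norm_cube_le hc hw) hA.le
    _ ≤ (c ^ 3 * A + 1) / √N := by
      rw [div_mul_eq_mul_div]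
      gcongr
      linarith

end NewtonAsymptotics

section AsymptoticRecursion

open Finset MvPolynomial

variable {θ : ℝ}

theorem exists_norm_aeval_le (B : ℕ → ℝ) (g : MvPolynomial ℕ ℂ) : ∃ A : ℝ, 0 < A ∧
    ∀ u : ℕ → ℂ, (∀ k, ‖u k‖ ≤ B k) → ‖aeval u g‖ ≤ A := by
  induction g using MvPolynomial.induction_on with
  | C c => exact ⟨‖c‖ + 1, by positivity, fun u _ => by simp⟩
  | add p q hp hq =>
    obtain ⟨A, hA, hp⟩ := hp
    obtain ⟨A', hA', hq⟩ := hq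
    refine ⟨A + A', by positivity, fun u hu => ?_⟩
    rw [map_add]
    exact (norm_add_le _ _).trans (add_le_add (hp u hu) (hq u hu))
  | mul_X p i hp =>
    obtain ⟨A, hA, hp⟩ := hp
    refine ⟨A * (|B i| + 1), by positivity, fun u hu => ?_⟩
    rw [map_mul, aeval_X, norm_mul]
    refine mul_le_mul (hp u hu) ?_ (norm_nonneg _) hA.le
    linarith [hu i, le_abs_self (B i)]

theorem exists_norm_aeval_linear_le (B : ℕ → ℝ) (S : Finset (ℕ →₀ ℕ)) {K : ℝ} (hK : 0 < K)
    (L : MvPolynomial ℕ ℂ →ₗ[ℂ] MvPolynomial ℕ ℂ) : ∃ A : ℝ, 0 < A ∧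
    ∀ f : MvPolynomial ℕ ℂ, f.support ⊆ S → (∀ s, ‖coeff s f‖ ≤ K) →
    ∀ u : ℕ → ℂ, (∀ k, ‖u k‖ ≤ B k) → ‖aeval u (L f)‖ ≤ A := by
  choose A hA h using fun s => exists_norm_aeval_le B (L (monomial s 1))
  refine ⟨∑ s ∈ S, K * A s + 1, ?_, fun f hf hc u hu => ?_⟩
  · have : 0 ≤ ∑ s ∈ S, K * A s := sum_nonneg fun s _ => mul_nonneg hK.le (hA s).le
    linarith
  have e : f = ∑ s ∈ S, coeff s f • monomial s 1 := by
    conv_lhs => rw [f.as_sum]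
    simp only [smul_monomial, smul_eq_mul, mul_one]
    refine sum_subset hf fun s _ hs => ?_
    rw [notMem_support_iff.1 hs, map_zero]
  rw [e, map_sum, map_sum]
  simp only [map_smul, smul_eq_mul]
  refine (norm_sum_le _ _).trans ?_
  refine (sum_le_sum fun s _ => ?_).trans (le_add_of_nonneg_right zero_le_one)
  rw [norm_mul]
  exact mul_le_mul (hc s) (h s u hu) (norm_nonneg _) hK.le

theorem sum_mul_aeval_pderiv {d : ℕ} {f : MvPolynomial ℕ ℂ}
    (hf : IsWeightedHomogeneous (fun k : ℕ => k) f d) (hf0 : ∀ s ∈ f.support, s 0 = 0)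
    (u : ℕ → ℂ) : (d : ℂ) * aeval u f
      = ∑ p ∈ range d, aeval u (pderiv (p + 1) f) * (((p : ℂ) + 1) * u (p + 1)) := by
  have key : C (d : ℂ) * f = ∑ p ∈ range d, C ((p : ℂ) + 1) * (X (p + 1) * pderiv (p + 1) f) := by
    conv_lhs => rw [f.as_sum]
    conv_rhs => rw [f.as_sum]
    simp only [map_sum, mul_sum, X_mul_pderiv_monomial]
    rw [sum_comm]
    refine sum_congr rfl fun s hs => ?_
    have hw := hf (mem_support_iff.1 hs)
    have hsS := (Finset.mem_finsupp_iff.1 (support_subset_finsupp hf hf0 hs)).1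
    rw [Finsupp.weight_apply, Finsupp.sum_of_support_subset (s := range (d + 1)) _
      (fun k hk => by have := Finset.mem_Icc.1 (hsS hk); rw [Finset.mem_range]; omega) _
      (by simp), sum_range_succ'] at hw
    simp only [smul_eq_mul, mul_zero, add_zero] at hw
    simp only [← map_nsmul, C_mul_monomial, ← map_sum]
    congr 1
    have hw' : (d : ℂ) = ∑ p ∈ range d, (s (p + 1) : ℂ) * (p + 1) := by exact_mod_cast hw.symm
    rw [hw', sum_mul]
    refine sum_congr rfl fun p _ => ?_
    simp only [nsmul_eq_mul]
    ring
  have h := congrArg (aeval u) key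
  simp only [map_mul, map_sum, aeval_X, algHom_C, aeval_C] at h
  simp only [Algebra.algebraMap_self, RingHom.id_apply] at h
  rw [h]
  exact sum_congr rfl fun p _ => by ring

theorem pderiv_succ_eq_zero {d p : ℕ} {f : MvPolynomial ℕ ℂ}
    (hf : IsWeightedHomogeneous (fun k : ℕ => k) f d) (hf0 : ∀ s ∈ f.support, s 0 = 0)
    (hp : d ≤ p) : pderiv (p + 1) f = 0 := by
  refine pderiv_eq_zero_of_notMem_vars fun h => ?_
  obtain ⟨s, hs, hps⟩ := (mem_vars_iff_mem_support _).1 h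
  exact Finsupp.mem_support_iff.1 hps
    (eq_zero_of_mem_finsupp_Icc (support_subset_finsupp hf hf0 hs) (by omega))

theorem pderiv_comm {σ : Type*} (i j : σ) (f : MvPolynomial σ ℂ) :
    pderiv i (pderiv j f) = pderiv j (pderiv i f) := by
  classical
  have h : ⁅pderiv (R := ℂ) i, pderiv (R := ℂ) j⁆ = 0 := by
    refine derivation_ext fun k => ?_
    rw [Derivation.commutator_apply, pderiv_X, pderiv_X]
    simp only [Pi.single_apply]
    split_ifs <;> simp
  have h2 := congrArg (fun D => D f) h
  simpa [Derivation.commutator_apply, sub_eq_zero] using h2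

theorem norm_natCast_sub_le {N : ℕ} (hN : 0 < N) (p : ℕ) : ‖(N : ℂ) - p‖ ≤ (1 + p) * N := by
  refine (norm_sub_le _ _).trans ?_
  rw [Complex.norm_natCast, Complex.norm_natCast]
  have : (1 : ℝ) ≤ N := by exact_mod_cast hN
  nlinarith [(Nat.cast_nonneg p : (0 : ℝ) ≤ p)]

theorem exists_norm_gq_le {B : ℕ → ℝ} (p q : ℕ) : ∃ A : ℝ, 0 < A ∧
    ∀ N : ℕ, 0 < N → ∀ u : ℕ → ℂ, (∀ k, ‖u k‖ ≤ B k) → ‖gq (N : ℂ) u p q‖ ≤ A * N := by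
  have aux : ∀ r i j : ℕ, ∃ A : ℝ, 0 < A ∧ ∀ N : ℕ, 0 < N → ∀ u : ℕ → ℂ, (∀ k, ‖u k‖ ≤ B k) →
      ‖((N : ℂ) - r) * u i * u j‖ ≤ A * N := fun r i j => by
    refine ⟨(1 + r) * ((|B i| + 1) * (|B j| + 1)), by positivity, fun N hN u hu => ?_⟩
    rw [norm_mul, norm_mul, mul_assoc]
    have h1 : ‖u i‖ ≤ |B i| + 1 := by linarith [hu i, le_abs_self (B i)]
    have h2 : ‖u j‖ ≤ |B j| + 1 := by linarith [hu j, le_abs_self (B j)]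
    calc _ ≤ ((1 + r) * N : ℝ) * ((|B i| + 1) * (|B j| + 1)) := by
          refine mul_le_mul (norm_natCast_sub_le hN r) ?_ (by positivity) (by positivity)
          exact mul_le_mul h1 h2 (norm_nonneg _) (by positivity)
      _ = _ := by ring
  induction p generalizing q with
  | zero => exact aux q 0 q
  | succ p ih =>
    obtain ⟨A, hA, h⟩ := ih (q + 1)
    obtain ⟨A1, hA1, h1⟩ := aux p p (q + 1)
    obtain ⟨A2, hA2, h2⟩ := aux q (p + 1) q
    refine ⟨A + A1 + A2, by positivity, fun N hN u hu => ?_⟩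
    rw [gq]
    refine (norm_add_le _ _).trans ?_
    refine (add_le_add_left (norm_sub_le _ _) _).trans ?_
    linarith [h N hN u hu, h1 N hN u hu, h2 N hN u hu]

theorem norm_mul_succ_sub_sq_le {N : ℕ} (hN : 0 < N) (p : ℕ) :
    ‖((N : ℂ) - p) * (N - p + 1) - N ^ 2‖ ≤ (1 + 3 * p + p ^ 2) * N := by
  have h1 : (1 : ℝ) ≤ N := by exact_mod_cast hN
  have hp : (0 : ℝ) ≤ p := Nat.cast_nonneg p
  rw [show ((N : ℂ) - p) * (N - p + 1) - N ^ 2 = (((N * (1 - 2 * p) + p ^ 2 - p : ℝ)) : ℂ) by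
    push_cast; ring, Complex.norm_real, Real.norm_eq_abs, abs_le]
  constructor <;> nlinarith [mul_nonneg hp hp, mul_nonneg hp (sub_nonneg.2 h1),
    mul_nonneg (mul_nonneg hp hp) (sub_nonneg.2 h1)]

theorem exists_norm_recursion_le (hθ : 0 < θ) {m : ℕ} (hm : 0 < m) {Y : ℝ} (hY : 0 ≤ Y) {c : ℝ}
    (hc : 0 ≤ c) (d : ℕ) : ∃ A : ℝ, 0 < A ∧ ∀ y : ℕ → ℂ, (∀ k, m ≤ k → y k = 0) →
      (∀ k, ‖y k‖ ≤ Y) → ∀ N : ℕ, m ≤ N → d ≤ N → ∀ b : Fin N → ℝ, StrictAnti b →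
      (∀ i, |b i| ≤ c / √N) → ∑ i, b i = 0 →
      ‖(d : ℂ) * mbfComp θ (fun k => N * y k - N * y (k + 1)) N d b
        - ((∑ i, b i ^ 2 : ℝ) : ℂ) / θ * (∑ k ∈ range m, y k ^ 2) * shiftSeq (shiftSeq fun d =>
          mbfComp θ (fun k => N * y k - N * y (k + 1)) N d b) d‖ ≤ A / √N := by
  obtain ⟨K, hK, hcoeff⟩ := exists_norm_coeff_lift_le hθ hm hY d
  choose B' hB' hes using exists_norm_es_le hc
  let B : ℕ → ℝ := fun k => B' k
  let S : Finset (ℕ →₀ ℕ) := (Finset.Icc 1 d).finsupp fun _ => range (d + 1)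
  choose D1 hD1 hd1 using fun p : ℕ => exists_norm_aeval_linear_le B S hK
    (pderiv (p + 1)).toLinearMap
  choose D2 hD2 hd2 using fun p q : ℕ => exists_norm_aeval_linear_le B S hK
    ((pderiv (q + 1)).toLinearMap ∘ₗ (pderiv (p + 1)).toLinearMap)
  choose Gq hGq hgq using fun p q : ℕ => exists_norm_gq_le (B := B) p q
  choose A hA hnewton using exists_norm_newton_le hc
  have hsB : ∀ p, ∃ b : ℝ, 0 < b ∧ ∀ u : ℕ → ℂ, (∀ k, ‖u k‖ ≤ B k) → ‖shiftSeq u p‖ ≤ b := by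
    rintro (_ | p)
    · exact ⟨1, one_pos, fun u _ => by simp [shiftSeq]⟩
    · exact ⟨B p, hB' p, fun u hu => hu p⟩
  choose sB hsB0 hsB using hsB
  let R1 : ℝ := ∑ p ∈ range d, D1 p * A p
  let R2 : ℝ := ∑ p ∈ range d, ∑ q ∈ range d, D2 p q * Gq p q
  let R3 : ℝ := ∑ p ∈ range d, D1 p * (θ * sB p * (1 + 3 * p + p ^ 2))
  have hR1 : 0 ≤ R1 := sum_nonneg fun p _ => mul_nonneg (hD1 p).le (hA p).le
  have hR2 : 0 ≤ R2 := sum_nonneg fun p _ => sum_nonneg fun q _ =>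
    mul_nonneg (hD2 p q).le (hGq p q).le
  have hR3 : 0 ≤ R3 := sum_nonneg fun p _ => mul_nonneg (hD1 p).le
    (mul_nonneg (mul_nonneg hθ.le (hsB0 p).le) (by positivity))
  refine ⟨R1 + c ^ 2 / θ * (R2 + R3) + 1, by positivity,
    fun y hy hyY N hmN hdN b hb hbc hb0 => ?_⟩
  have hN : 0 < N := hm.trans_le hmN
  have hNC : (N : ℂ) ≠ 0 := by exact_mod_cast hN.ne'
  have hθC : (θ : ℂ) ≠ 0 := by exact_mod_cast hθ.ne'
  obtain ⟨F, hF⟩ := exists_isCompRep hθ (fun k => N * y k) N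
  obtain ⟨f, hf, hf0, hfF⟩ := exists_lift (hF.symm d) (hF.homog d)
  have hfK := hcoeff y hy hyY N hmN hdN F hF f hf hf0 hfF
  have hfS : f.support ⊆ S := support_subset_finsupp hf hf0
  set u : ℕ → ℂ := fun k => es (toC b) univ k with hu_def
  have hw : ∀ i, ‖toC b i‖ ≤ c / √N := fun i => by
    simpa only [toC, Complex.norm_real, Real.norm_eq_abs] using hbc i
  have hw0 : ∑ i, toC b i = 0 := by
    simp only [toC, ← Complex.ofReal_sum, hb0, Complex.ofReal_zero]
  have hu : ∀ k, ‖u k‖ ≤ B k := fun k => (hes k N hN _ hw hw0 k le_rfl).1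
  have hG : ∀ e, mbfComp θ (fun k => N * y k - N * y (k + 1)) N e b = eval (toC b) (F e) :=
    fun e => hF.eval_eq e hb
  simp only [hG]
  set v : ℂ := ((∑ i, b i ^ 2 : ℝ) : ℂ) with hv
  have hv' : v = ∑ i, toC b i ^ 2 := by simp [hv, toC]
  have hvc : ‖v‖ ≤ c ^ 2 := by
    rw [hv']
    refine (norm_sum_le _ _).trans ?_
    simp only [norm_pow]
    exact sum_norm_pow_le hw
  set Z : ℂ := ∑ k ∈ range m, y k ^ 2 with hZ
  set G2 := shiftSeq (shiftSeq fun e => eval (toC b) (F e)) d with hG2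
  have hlap := hF.lap d hb
  rw [← hfF, dunklLap_toSym (toC_injective hb), eval_toSym, aeval_lapOp] at hlap
  have hyN : y N = 0 := hy N hmN
  have hsum : ∑ k ∈ range N, ((N : ℂ) * y k - N * y N) ^ 2 = N ^ 2 * Z := by
    rw [hyN, hZ, mul_sum]
    rw [← sum_subset (range_subset_range.2 hmN)]
    · exact sum_congr rfl fun k _ => by ring
    · intro k _ hk
      rw [hy k (by simpa using hk)]; simp
  have hG2' : eval (toC b) (shiftSeq (shiftSeq F) d) = G2 := by
    rw [hG2]
    rcases d with _ | _ | d <;> simp [shiftSeq]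
  rw [hsum, hG2'] at hlap
  simp only [Fintype.card_fin, Algebra.algebraMap_self, RingHom.id_apply] at hlap
  set E : ℕ → ℂ := fun p => aeval u (pderiv (p + 1) f) with hE
  have hE0 : ∀ p, d ≤ p → pderiv (p + 1) f = 0 := fun p hp => pderiv_succ_eq_zero hf hf0 hp
  set R : ℂ := ∑ p ∈ range d, ∑ q ∈ range d,
    aeval u (pderiv (q + 1) (pderiv (p + 1) f)) * gq (N : ℂ) u p q with hR
  have hlap' : ∑ p ∈ range d, E p * (-θ * (((N : ℂ) - p) * (N - p + 1)) * shiftSeq u p) + R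
      = N ^ 2 * Z * G2 := by
    rw [← hlap]
    congr 1
    · refine sum_subset (range_subset_range.2 hdN) fun p _ hp => ?_
      simp [hE, hE0 p (by simpa using hp)]
    · have hq0 : ∀ p q, d ≤ q → pderiv (q + 1) (pderiv (p + 1) f) = 0 := fun p q hq => by
        rw [pderiv_comm, hE0 q hq, map_zero]
      rw [hR, ← sum_subset (range_subset_range.2 hdN)]
      · refine sum_congr rfl fun p _ => ?_
        refine sum_subset (range_subset_range.2 hdN) fun q _ hq => ?_
        rw [hq0 p q (by simpa using hq)]; simp
      · intro p _ hp
        refine sum_eq_zero fun q _ => ?_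
        rw [hE0 p (by simpa using hp)]; simp
  have hEuler : (d : ℂ) * eval (toC b) (F d) = ∑ p ∈ range d, E p * (((p : ℂ) + 1) * u (p + 1)) := by
    rw [← hfF, eval_toSym]
    exact sum_mul_aeval_pderiv hf hf0 u
  have hEb : ∀ p, ‖E p‖ ≤ D1 p := fun p => hd1 p f hfS hfK u hu
  set T : ℂ := ∑ p ∈ range d, E p * (-θ * shiftSeq u p * (((N : ℂ) - p) * (N - p + 1) - N ^ 2))
    with hT
  have hRb : ‖R‖ ≤ R2 * N := by
    rw [hR, sum_mul]
    refine (norm_sum_le _ _).trans (sum_le_sum fun p _ => ?_)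
    rw [sum_mul]
    refine (norm_sum_le _ _).trans (sum_le_sum fun q _ => ?_)
    rw [norm_mul, mul_assoc]
    exact mul_le_mul (hd2 p q f hfS hfK u hu) (hgq p q N hN u hu) (norm_nonneg _) (hD2 p q).le
  have hTb : ‖T‖ ≤ R3 * N := by
    rw [hT, sum_mul]
    refine (norm_sum_le _ _).trans (sum_le_sum fun p _ => ?_)
    rw [norm_mul, norm_mul, norm_mul, norm_neg, Complex.norm_real, Real.norm_of_nonneg hθ.le,
      mul_assoc (D1 p), mul_assoc (θ * sB p)]
    refine mul_le_mul (hEb p) ?_ (by positivity) (hD1 p).le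
    refine mul_le_mul ?_ (norm_mul_succ_sub_sq_le hN p) (norm_nonneg _)
      (mul_nonneg hθ.le (hsB0 p).le)
    exact mul_le_mul_of_nonneg_left (hsB p u hu) hθ.le
  have hmain : (d : ℂ) * eval (toC b) (F d) - v / θ * Z * G2
      = ∑ p ∈ range d, E p * (((p : ℂ) + 1) * u (p + 1) + v * shiftSeq u p)
        - v / θ * ((R + T) / N ^ 2) := by
    have e1 : Z * G2 = (∑ p ∈ range d, E p * (-θ * (((N : ℂ) - p) * (N - p + 1)) * shiftSeq u p)
        + R) / N ^ 2 := by
      rw [hlap']; field_simp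
    have e2 : ∑ p ∈ range d, E p * (-θ * (((N : ℂ) - p) * (N - p + 1)) * shiftSeq u p)
        = T - θ * N ^ 2 * ∑ p ∈ range d, E p * shiftSeq u p := by
      rw [hT, mul_sum, ← sum_sub_distrib]
      exact sum_congr rfl fun p _ => by ring
    have e3 : ∑ p ∈ range d, E p * (((p : ℂ) + 1) * u (p + 1) + v * shiftSeq u p)
        = ∑ p ∈ range d, E p * (((p : ℂ) + 1) * u (p + 1))
          + v * ∑ p ∈ range d, E p * shiftSeq u p := by
      rw [mul_sum, ← sum_add_distrib]
      exact sum_congr rfl fun p _ => by ring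
    rw [hEuler, mul_assoc, e1, e2, e3]
    field_simp
    ring
  rw [hmain]
  have hN1 : (1 : ℝ) ≤ N := by exact_mod_cast hN
  have hsq : √(N : ℝ) ≤ N := Real.sqrt_le_iff.2 ⟨by positivity, by nlinarith⟩
  have hsq0 : 0 < √(N : ℝ) := by positivity
  have hfirst : ‖∑ p ∈ range d, E p * (((p : ℂ) + 1) * u (p + 1) + v * shiftSeq u p)‖
      ≤ R1 / √N := by
    rw [sum_div]
    refine (norm_sum_le _ _).trans (sum_le_sum fun p _ => ?_)
    rw [norm_mul, mul_div_assoc]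
    refine mul_le_mul (hEb p) ?_ (norm_nonneg _) (hD1 p).le
    rw [hv']
    exact hnewton p N hN _ hw hw0
  have hsecond : ‖v / θ * ((R + T) / N ^ 2)‖ ≤ c ^ 2 / θ * (R2 + R3) / √N := by
    have hθn : ‖(θ : ℂ)‖ = θ := by rw [Complex.norm_real, Real.norm_of_nonneg hθ.le]
    rw [norm_mul, norm_div, norm_div, hθn, norm_pow, Complex.norm_natCast, mul_div_assoc]
    refine mul_le_mul (by gcongr) ?_ (by positivity) (by positivity)
    rw [div_le_div_iff₀ (by positivity) hsq0]
    calc ‖R + T‖ * √N ≤ ((R2 + R3) * N) * N := by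
          refine mul_le_mul ((norm_add_le _ _).trans ?_) hsq hsq0.le (by positivity)
          linarith
      _ = _ := by ring
  refine (norm_sub_le _ _).trans ((add_le_add hfirst hsecond).trans ?_)
  rw [← add_div]
  exact div_le_div_of_nonneg_right (by linarith) hsq0.le

end AsymptoticRecursion

section GaussianLimit

/-- The homogeneous components of `exp w`, where `w` has degree `2`. -/
def gaussComp (w : ℂ) (d : ℕ) : ℂ := if Even d then w ^ (d / 2) / ((d / 2).factorial : ℂ) else 0

theorem hasSum_gaussComp (w : ℂ) : HasSum (gaussComp w) (Complex.exp w) := by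
  have h1 : HasSum (fun k => gaussComp w (2 * k)) (Complex.exp w) := by
    have : (fun k => gaussComp w (2 * k)) = fun k => w ^ k / (k.factorial : ℂ) := by
      funext k; simp [gaussComp]
    rw [this, Complex.exp_eq_exp_ℂ]
    exact NormedSpace.expSeries_div_hasSum_exp w
  have h2 : HasSum (fun k => gaussComp w (2 * k + 1)) 0 := by
    have : (fun k => gaussComp w (2 * k + 1)) = fun _ => 0 := by
      funext k; simp [gaussComp, Nat.even_add_one]
    rw [this]
    exact hasSum_zero
  simpa using h1.even_add_odd h2

theorem gaussComp_add_two (w : ℂ) (d : ℕ) :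
    ((d : ℂ) + 2) * gaussComp w (d + 2) = 2 * w * gaussComp w d := by
  rcases Nat.even_or_odd' d with ⟨k, rfl | rfl⟩
  · have e : (2 * k + 2) / 2 = k + 1 := by omega
    have hk : ((k.factorial : ℕ) : ℂ) ≠ 0 := by exact_mod_cast k.factorial_ne_zero
    have hk1 : (k : ℂ) + 1 ≠ 0 := by exact_mod_cast k.succ_ne_zero
    simp only [gaussComp, e, Nat.factorial_succ, show Even (2 * k + 2) from ⟨k + 1, by ring⟩,
      even_two_mul, if_true, Nat.mul_div_cancel_left k two_pos]
    push_cast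
    field_simp
    ring
  · simp [gaussComp, Nat.even_add_one, Nat.even_add]

theorem norm_gaussComp_le {w : ℂ} {R : ℝ} (h : ‖w‖ ≤ R) (d : ℕ) :
    ‖gaussComp w d‖ ≤ ‖gaussComp R d‖ := by
  have hR : ‖(R : ℂ)‖ = R := by
    rw [Complex.norm_real, Real.norm_of_nonneg ((norm_nonneg w).trans h)]
  unfold gaussComp
  split_ifs
  · rw [norm_div, norm_div, norm_pow, norm_pow, hR]
    gcongr
  · simp

theorem tendsto_tsum_sub_exp {ι : Type*} {L : Filter ι} {G : ι → ℕ → ℂ} {Z α : ι → ℂ} {α₀ : ℂ}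
    {R : ℝ} {B : ℕ → ℝ} (hZ : ∀ᶠ q in L, ‖Z q‖ ≤ R) (hα : Tendsto α L (𝓝 α₀))
    (hrec : ∀ d : ℕ, Tendsto (fun q => (d : ℂ) * G q d - α q * Z q * shiftSeq (shiftSeq (G q)) d)
      L (𝓝 0))
    (hG0 : ∀ᶠ q in L, G q 0 = 1) (hB : Summable B) (hGB : ∀ᶠ q in L, ∀ d, ‖G q d‖ ≤ B d) :
    Tendsto (fun q => ∑' d, G q d - Complex.exp (α₀ / 2 * Z q)) L (𝓝 0) := by
  set S : ℝ := ‖α₀ / 2‖ * R with hS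
  have hw : ∀ᶠ q in L, ‖α₀ / 2 * Z q‖ ≤ S := by
    filter_upwards [hZ] with q hq
    rw [norm_mul]
    exact mul_le_mul_of_nonneg_left hq (norm_nonneg _)
  have hgb : ∀ d, L.IsBoundedUnder (· ≤ ·) (norm ∘ fun q => Z q * gaussComp (α₀ / 2 * Z q) d) :=
    fun d => isBoundedUnder_of_eventually_le (a := R * ‖gaussComp S d‖) <| by
      filter_upwards [hw, hZ] with q hq hZq
      rw [Function.comp_apply, norm_mul]
      exact mul_le_mul hZq (norm_gaussComp_le hq d) (norm_nonneg _) ((norm_nonneg _).trans hZq)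
  have hZb : L.IsBoundedUnder (· ≤ ·) (norm ∘ Z) := isBoundedUnder_of_eventually_le hZ
  have hcomp : ∀ d, Tendsto (fun q => G q d - gaussComp (α₀ / 2 * Z q) d) L (𝓝 0) := by
    intro d
    induction d using Nat.twoStepInduction with
    | zero =>
      refine tendsto_const_nhds.congr' ?_
      filter_upwards [hG0] with q hq
      simp [hq, gaussComp]
    | one =>
      refine (hrec 1).congr fun q => ?_
      simp [shiftSeq, gaussComp]
    | more d ih _ =>
      have h1 := hrec (d + 2)
      have h2 := (hα.mul ih).congr fun q => rfl
      rw [mul_zero] at h2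
      have h3 := h2.zero_mul_isBoundedUnder_le hZb
      have h4 : Tendsto (fun q => α q - α₀) L (𝓝 0) := by simpa using hα.sub_const α₀
      have h5 := h4.zero_mul_isBoundedUnder_le (hgb d)
      have h6 := ((h1.add h3).add h5).const_mul (((d : ℂ) + 2)⁻¹)
      rw [add_zero, add_zero, mul_zero] at h6
      refine h6.congr fun q => ?_
      have hd : (d : ℂ) + 2 ≠ 0 := by exact_mod_cast (Nat.succ_ne_zero (d + 1))
      have e := gaussComp_add_two (α₀ / 2 * Z q) d
      rw [inv_mul_eq_iff_eq_mul₀ hd, mul_sub ((d : ℂ) + 2), e]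
      simp only [shiftSeq]
      push_cast
      ring
  have hsumS : Summable fun d => B d + ‖gaussComp S d‖ := hB.add (hasSum_gaussComp S).summable.norm
  have h := tendsto_tsum_of_dominated_convergence (𝓕 := L)
    (f := fun q d => G q d - gaussComp (α₀ / 2 * Z q) d) (g := fun _ => 0) hsumS hcomp (by
      filter_upwards [hw, hGB] with q hq hGq d
      exact (norm_sub_le _ _).trans (add_le_add (hGq d) (norm_gaussComp_le hq d)))
  rw [tsum_zero] at h
  refine h.congr' ?_
  filter_upwards [hGB] with q hq
  rw [(Summable.of_norm_bounded hB hq).tsum_sub (hasSum_gaussComp _).summable,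
    (hasSum_gaussComp _).tsum_eq]

end GaussianLimit

section RegularSequences

open Finset

variable {N : ℕ}

theorem integral_empMeasure (a : Fin N → ℝ) (f : ℝ → ℝ) :
    ∫ t, f t ∂empMeasure a = (N : ℝ)⁻¹ * ∑ i, f (a i / N) := by
  rw [empMeasure, integral_smul_measure, integral_finsetSum_measure fun i _ =>
    integrable_dirac (by simp)]
  simp [integral_dirac]

theorem RegularSeq.exists_abs_le {a : (N : ℕ) → Fin N → ℝ} {μ : Measure ℝ} (h : RegularSeq a μ) :
    ∃ C : ℝ, 0 ≤ C ∧ ∀ N i, |a N i| ≤ C * N := by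
  obtain ⟨hanti, ⟨C, hC⟩, -⟩ := h
  refine ⟨|C|, abs_nonneg C, fun N i => ?_⟩
  have hN : 1 ≤ N := i.pos
  obtain ⟨h1, h2⟩ := hC N hN
  have h3 := (hanti N hN).antitone (show (⟨0, by omega⟩ : Fin N) ≤ i from Nat.zero_le _)
  have h4 := (hanti N hN).antitone (show i ≤ (⟨N - 1, by omega⟩ : Fin N) from by
    rw [Fin.le_def]; have := i.isLt; simp only; omega)
  have h5 : C * N ≤ |C| * N := by gcongr; exact le_abs_self C
  rw [abs_le] at h1 h2 ⊢
  constructor <;> linarith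

theorem RegularSeq.tendsto_integral {a : (N : ℕ) → Fin N → ℝ} {μ : Measure ℝ} (h : RegularSeq a μ)
    {g : ℝ → ℝ} (hg : Continuous g) :
    Tendsto (fun N => ∫ t, g t ∂empMeasure (a N)) atTop (𝓝 (∫ t, g t ∂μ)) := by
  obtain ⟨C, hC0, hC⟩ := h.exists_abs_le
  obtain ⟨-, -, -, ⟨R, hR⟩, hconv⟩ := h
  set M := max C R with hM
  have hM0 : 0 ≤ M := hC0.trans (le_max_left _ _)
  have hMM : -M ≤ M := by linarith
  let p : ℝ → ℝ := fun t => (Set.projIcc (-M) M hMM t : ℝ)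
  have hp : Continuous p := continuous_subtype_val.comp continuous_projIcc
  have hpt : ∀ t, |t| ≤ M → p t = t := fun t ht => by
    simp only [p, Set.projIcc_of_mem hMM (abs_le.1 ht)]
  obtain ⟨A, hA⟩ := isCompact_Icc.exists_bound_of_continuousOn (hg.continuousOn (s := Set.Icc (-M) M))
  let F : BoundedContinuousFunction ℝ ℝ := BoundedContinuousFunction.ofNormedAddCommGroup
    (fun t => g (p t)) (hg.comp hp) A fun t => hA _ (Set.projIcc (-M) M hMM t).2
  have hF : ∀ t, |t| ≤ M → F t = g t := fun t ht => by
    change g (p t) = g t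
    rw [hpt t ht]
  have h1 : ∫ t, F t ∂μ = ∫ t, g t ∂μ := by
    refine integral_congr_ae ?_
    have : ∀ᵐ t ∂μ, t ∈ {t : ℝ | |t| ≤ R} := hR
    filter_upwards [this] with t ht using hF t (le_trans ht (le_max_right _ _))
  rw [← h1]
  refine (hconv F).congr fun N => ?_
  rw [integral_empMeasure, integral_empMeasure]
  congr 1
  refine sum_congr rfl fun i _ => hF _ ?_
  have hN : (0 : ℝ) < N := by exact_mod_cast i.pos
  rw [abs_div, abs_of_pos hN, div_le_iff₀ hN]
  exact (hC N i).trans (by gcongr; exact le_max_left _ _)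

theorem RegularSeq.tendsto_varM {a : (N : ℕ) → Fin N → ℝ} {μ : Measure ℝ} (h : RegularSeq a μ) :
    Tendsto (fun N => varM (empMeasure (a N))) atTop (𝓝 (varM μ)) :=
  (h.tendsto_integral (continuous_pow 2)).sub ((h.tendsto_integral continuous_id).pow 2)

/-- The centred and rescaled tuple `(aᵢ - |a| / N) / N^(3/2)`. -/
def centred (a : Fin N → ℝ) (i : Fin N) : ℝ :=
  (a i - N * meanM (empMeasure a)) / (N * √N)

theorem sum_eq_meanM (hN : 0 < N) (a : Fin N → ℝ) :
    ∑ i, a i = N * (N * meanM (empMeasure a)) := by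
  have : (N : ℝ) ≠ 0 := by positivity
  rw [meanM, integral_empMeasure a (fun t => t), ← sum_div]
  field_simp

theorem sum_centred (hN : 0 < N) (a : Fin N → ℝ) : ∑ i, centred a i = 0 := by
  simp only [centred, ← sum_div, sum_sub_distrib, sum_eq_meanM hN a, sum_const, card_univ,
    Fintype.card_fin, nsmul_eq_mul, sub_self, zero_div]

theorem sum_centred_sq (hN : 0 < N) (a : Fin N → ℝ) :
    ∑ i, centred a i ^ 2 = varM (empMeasure a) := by
  have hN' : (N : ℝ) ≠ 0 := by positivity
  have h := sum_eq_meanM hN a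
  have h2 : (N : ℝ) ^ 3 * ∫ t, t ^ 2 ∂empMeasure a = ∑ i, a i ^ 2 := by
    rw [integral_empMeasure a (fun t => t ^ 2)]
    simp only [div_pow, ← sum_div]
    field_simp
  rw [varM]
  set e := meanM (empMeasure a)
  have h3 : ∑ i, (a i - N * e) ^ 2 = N ^ 3 * ∫ t, t ^ 2 ∂empMeasure a - N ^ 3 * e ^ 2 := by
    simp only [sub_sq, sum_add_distrib, sum_sub_distrib, ← sum_mul, ← mul_sum, h, h2, sum_const,
      card_univ, Fintype.card_fin, nsmul_eq_mul]
    ring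
  simp only [centred, div_pow, mul_pow, ← sum_div, Real.sq_sqrt (Nat.cast_nonneg N)]
  rw [h3]
  field_simp

theorem strictAnti_centred {a : Fin N → ℝ} (ha : StrictAnti a) : StrictAnti (centred a) := by
  intro i j hij
  have hN : 0 < N := i.pos
  have := ha hij
  exact div_lt_div_of_pos_right (by linarith) (by positivity)

theorem abs_centred_le {a : Fin N → ℝ} {C : ℝ} (ha : ∀ i, |a i| ≤ C * N) (i : Fin N) :
    |centred a i| ≤ 2 * C / √N := by
  have hN : 0 < N := i.pos
  have hN' : (0 : ℝ) < N := by exact_mod_cast hN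
  have h1 : |N * meanM (empMeasure a)| ≤ C * N := by
    have h := sum_eq_meanM hN a
    have h2 : |(N : ℝ) * (N * meanM (empMeasure a))| ≤ N * (C * N) := by
      rw [← h]
      refine (abs_sum_le_sum_abs _ _).trans ((sum_le_sum fun i _ => ha i).trans ?_)
      simp
    rw [abs_mul, abs_of_pos hN'] at h2
    exact le_of_mul_le_mul_left h2 hN'
  rw [centred, abs_div, abs_of_pos (by positivity : 0 < (N : ℝ) * √N), div_le_div_iff₀
    (by positivity) (by positivity)]
  have h3 := (abs_sub (a i) (N * meanM (empMeasure a))).trans (add_le_add (ha i) h1)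
  calc _ ≤ (C * N + C * N) * √N := by gcongr
    _ = _ := by ring

end RegularSequences

section Assembly

open Finset

variable {m N : ℕ} {θ : ℝ}

/-- Extension of a tuple by zeros to a sequence. -/
def zeroExt (y : Fin m → ℂ) (k : ℕ) : ℂ :=
  if h : k < m then y ⟨k, h⟩ else 0

theorem zeroExt_of_le (y : Fin m → ℂ) {k : ℕ} (hk : m ≤ k) : zeroExt y k = 0 :=
  dif_neg hk.not_gt

theorem norm_zeroExt_le {y : Fin m → ℂ} {Y : ℝ} (hY : 0 ≤ Y) (hy : ‖y‖ ≤ Y) (k : ℕ) :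
    ‖zeroExt y k‖ ≤ Y := by
  unfold zeroExt
  split_ifs with h
  · exact (norm_le_pi_norm y _).trans hy
  · simpa using hY

theorem sum_range_zeroExt (y : Fin m → ℂ) (f : ℂ → ℂ) :
    ∑ k ∈ range m, f (zeroExt y k) = ∑ i, f (y i) := by
  rw [← Fin.sum_univ_eq_sum_range fun k => f (zeroExt y k)]
  simp [zeroExt]

theorem sum_range_succ_mul_sub (y : ℕ → ℂ) (n : ℕ) :
    ∑ k ∈ range n, ((k : ℂ) + 1) * (y k - y (k + 1)) = ∑ k ∈ range n, y k - n * y n := by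
  induction n with
  | zero => simp
  | succ n ih => rw [sum_range_succ, ih, sum_range_succ]; push_cast; ring

theorem hasSum_mbfComp_centred (hθ : 0 < θ) (h : m ≤ N) (hN : 0 < N) (y : Fin m → ℂ)
    {a : Fin N → ℝ} (ha : StrictAnti a) :
    HasSum (fun d => mbfComp θ (fun k => N * zeroExt y k - N * zeroExt y (k + 1)) N d (centred a))
      (MBF θ a (padC h fun i => y i / ((√N : ℝ) : ℂ)) *
        Complex.exp (-((√N * meanM (empMeasure a) : ℝ) : ℂ) * ∑ i, y i)) := by
  have hN' : (0 : ℝ) < N := by exact_mod_cast hN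
  have hs : 0 < √(N : ℝ) := Real.sqrt_pos.2 hN'
  have hsC : ((√N : ℝ) : ℂ) ≠ 0 := by exact_mod_cast hs.ne'
  have hss : ((√N : ℝ) : ℂ) * ((√N : ℝ) : ℂ) = N := by
    rw [← Complex.ofReal_mul, Real.mul_self_sqrt hN'.le, Complex.ofReal_natCast]
  have hρ : 0 < (N : ℝ) * √N := by positivity
  set e := meanM (empMeasure a)
  let y' : ℕ → ℂ := fun k => zeroExt y k / ((√N : ℝ) : ℂ)
  have hpad : (padC h fun i => y i / ((√N : ℝ) : ℂ)) = fun k : Fin N => y' k := by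
    funext k
    simp only [padC, y', zeroExt]
    split_ifs <;> simp
  have hyN : y' N = 0 := by simp [y', zeroExt_of_le y h]
  have haff : a = fun i => (N * √N) * centred a i + N * e := by
    funext i
    simp only [centred]
    field_simp
    ring
  have hsum : ∑ k ∈ range N, y' k = (∑ i, y i) / ((√N : ℝ) : ℂ) := by
    rw [← sum_div, ← sum_range_zeroExt y fun z => z]
    congr 1
    exact (sum_subset (range_subset_range.2 h) fun k _ hk =>
      zeroExt_of_le y (by simpa using hk)).symm
  have hscale : StrictAnti fun i => (N * √N) * centred a i := fun i j hij =>
    mul_lt_mul_of_pos_left (strictAnti_centred ha hij) hρ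
  have hval : MBF θ a (padC h fun i => y i / ((√N : ℝ) : ℂ)) *
      Complex.exp (-((√N * e : ℝ) : ℂ) * ∑ i, y i)
      = mbfVal θ (fun k => y' k - y' (k + 1)) N fun i => (N * √N) * centred a i := by
    rw [hpad, MBF_eq_mbfVal hθ y' hN ha, hyN, zero_mul, Complex.exp_zero, one_mul]
    conv_lhs => rw [haff]
    rw [mbfVal_add_const hθ, sum_range_succ_mul_sub, hyN, mul_zero, sub_zero, hsum, mul_right_comm,
      ← Complex.exp_add]
    convert one_mul _
    rw [← Complex.exp_zero]
    congr 1
    push_cast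
    rw [← hss]
    field_simp
    ring
  rw [hval]
  refine (hasSum_mbfComp hθ (fun k => y' k - y' (k + 1)) hscale).congr_fun fun d => ?_
  rw [mbfComp_smul hθ y' hρ d (strictAnti_centred ha), ← mbfComp_const_mul]
  congr 1
  funext k
  simp only [y']
  push_cast
  field_simp

theorem tendstoUniformlyOn_of_tendsto_sub {α : Type*} {F : ℕ → α → ℂ} {f : α → ℂ} {K : Set α}
    (h : Tendsto (fun q : ℕ × α => F q.1 q.2 - f q.2) (atTop ×ˢ 𝓟 K) (𝓝 0)) :
    TendstoUniformlyOn F f atTop K := by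
  rw [tendstoUniformlyOn_iff_tendsto]
  rw [Metric.uniformity_eq_comap_nhds_zero, tendsto_comap_iff]
  refine (tendsto_zero_iff_norm_tendsto_zero.1 h).congr fun q => ?_
  rw [Function.comp_apply, dist_comm, dist_eq_norm]

theorem tendsto_div_sqrt_natCast (A : ℝ) : Tendsto (fun N : ℕ => A / √(N : ℝ)) atTop (𝓝 0) :=
  (Real.tendsto_sqrt_atTop.comp tendsto_natCast_atTop_atTop).const_div_atTop A

end Assembly

/-- (Theorem 5.4) Asymptotics of multivariate Bessel functions:
for a regular sequence `a(N)` with limiting measure `μ`,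
`𝓑_{a(N)}(y/√N; N; θ) exp(-√N 𝔼[μ_N] ∑ y_i) → exp((Var[μ]/2θ) ∑ y_i²)`,
uniformly on compact subsets of `ℂ^m`. -/
theorem mbf_asymptotics
    (θ : ℝ) (hθ : 0 < θ) (m : ℕ) (hm : 1 ≤ m)
    (a : (N : ℕ) → Fin N → ℝ) (μ : Measure ℝ) (hreg : RegularSeq a μ) :
    ∀ K : Set (Fin m → ℂ), IsCompact K →
      TendstoUniformlyOn
        (fun (N : ℕ) (y : Fin m → ℂ) =>
          (if h : m ≤ N then
              MBF θ (a N) (padC h fun i => y i / ((Real.sqrt N : ℝ) : ℂ))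
            else 0) *
            Complex.exp
              (-((Real.sqrt N * meanM (empMeasure (a N)) : ℝ) : ℂ) * ∑ i, y i))
        (fun y : Fin m → ℂ =>
          Complex.exp (((varM μ / (2 * θ) : ℝ) : ℂ) * ∑ i, y i ^ 2))
        atTop K := by
  intro K hK
  obtain ⟨Y₀, hY₀⟩ := hK.isBounded.exists_norm_le
  set Y := max Y₀ 0 with hYdef
  have hY : 0 ≤ Y := le_max_right _ _
  have hKY : ∀ y ∈ K, ‖y‖ ≤ Y := fun y hy => (hY₀ y hy).trans (le_max_left _ _)
  obtain ⟨C, hC, haC⟩ := hreg.exists_abs_le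
  have hanti : ∀ N, 1 ≤ N → StrictAnti (a N) := hreg.1
  let G : ℕ × (Fin m → ℂ) → ℕ → ℂ := fun q d =>
    mbfComp θ (fun k => q.1 * zeroExt q.2 k - q.1 * zeroExt q.2 (k + 1)) q.1 d (centred (a q.1))
  let Z : ℕ × (Fin m → ℂ) → ℂ := fun q => ∑ k ∈ Finset.range m, zeroExt q.2 k ^ 2
  let α : ℕ × (Fin m → ℂ) → ℂ := fun q => ((varM (empMeasure (a q.1)) : ℝ) : ℂ) / θ
  have hev : ∀ {p : ℕ × (Fin m → ℂ) → Prop} (n₀ : ℕ), (∀ N y, n₀ ≤ N → y ∈ K → p (N, y)) →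
      ∀ᶠ q in atTop ×ˢ 𝓟 K, p q := fun {p} n₀ hp =>
    eventually_prod_principal_iff.2 ((eventually_ge_atTop n₀).mono fun N hN y hy => hp N y hN hy)
  have hZ : ∀ᶠ q in atTop ×ˢ 𝓟 K, ‖Z q‖ ≤ m * Y ^ 2 := hev 0 fun N y _ hy => by
    refine (norm_sum_le _ _).trans ((Finset.sum_le_card_nsmul _ _ (Y ^ 2) fun k _ => ?_).trans ?_)
    · rw [norm_pow]
      exact pow_le_pow_left₀ (norm_nonneg _) (norm_zeroExt_le hY (hKY y hy) k) 2
    · simp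
  have hα : Tendsto α (atTop ×ˢ 𝓟 K) (𝓝 (((varM μ : ℝ) : ℂ) / θ)) :=
    (((Complex.continuous_ofReal.tendsto _).comp hreg.tendsto_varM).div_const _).comp tendsto_fst
  have hrec : ∀ d : ℕ, Tendsto (fun q => d * G q d - α q * Z q * shiftSeq (shiftSeq (G q)) d)
      (atTop ×ˢ 𝓟 K) (𝓝 0) := fun d => by
    obtain ⟨A, -, hA⟩ := exists_norm_recursion_le hθ hm hY (c := 2 * C) (by positivity) d
    refine squeeze_zero_norm' (hev (max m d) fun N y hN hy => ?_)
      ((tendsto_div_sqrt_natCast A).comp tendsto_fst)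
    have hmN : m ≤ N := (le_max_left _ _).trans hN
    have h := hA (zeroExt y) (fun k => zeroExt_of_le y) (norm_zeroExt_le hY (hKY y hy)) N hmN
      ((le_max_right _ _).trans hN) (centred (a N)) (strictAnti_centred (hanti N (hm.trans hmN)))
      (abs_centred_le (haC N)) (sum_centred (hm.trans hmN) _)
    rwa [sum_centred_sq (hm.trans hmN)] at h
  have hG0 : ∀ᶠ q in atTop ×ˢ 𝓟 K, G q 0 = 1 := hev 1 fun N y hN _ =>
    mbfComp_zero_right hθ _ (strictAnti_centred (hanti N hN))
  obtain ⟨D, l, hD, hl, hDl⟩ := exists_norm_mbfComp_scaled_le hθ hm hY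
  have hGB : ∀ᶠ q in atTop ×ˢ 𝓟 K, ∀ d, ‖G q d‖ ≤
      D * Real.exp (θ * (2 * l ^ 2 * (2 * C) ^ 2)) * (1 / 2) ^ d := by
    obtain ⟨n₀, hn₀⟩ := eventually_atTop.1
      ((tendsto_div_sqrt_natCast (l * (2 * C))).eventually_le_const (by norm_num : (0 : ℝ) < 1 / 2))
    refine hev (max m n₀) fun N y hN hy d => ?_
    have hmN : m ≤ N := (le_max_left _ _).trans hN
    have hN1 : 0 < N := hm.trans hmN
    have hb := abs_centred_le (haC N)
    have h := hDl (zeroExt y) (fun k => zeroExt_of_le y) (norm_zeroExt_le hY (hKY y hy)) N hmN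
      (centred (a N)) (strictAnti_centred (hanti N hN1)) (fun i => by
        rw [abs_mul, abs_of_pos hl]
        refine (mul_le_mul_of_nonneg_left (hb i) hl.le).trans ?_
        rw [← mul_div_assoc]
        exact hn₀ N ((le_max_right _ _).trans hN)) d
    refine h.trans ?_
    have hsq : ∑ i, centred (a N) i ^ 2 ≤ (2 * C) ^ 2 := by
      refine (Finset.sum_le_card_nsmul _ _ ((2 * C) ^ 2 / N) fun i _ => ?_).trans ?_
      · rw [← sq_abs, ← Real.sq_sqrt (Nat.cast_nonneg N), ← div_pow]
        exact pow_le_pow_left₀ (abs_nonneg _) (hb i) 2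
      · have : (N : ℝ) ≠ 0 := by positivity
        rw [Finset.card_univ, Fintype.card_fin, nsmul_eq_mul, mul_div_cancel₀ _ this]
    rw [sum_centred hN1, mul_zero, abs_zero, zero_add]
    gcongr
  have hB : Summable fun d : ℕ => D * Real.exp (θ * (2 * l ^ 2 * (2 * C) ^ 2)) * (1 / 2 : ℝ) ^ d :=
    summable_geometric_two.mul_left _
  refine tendstoUniformlyOn_of_tendsto_sub ((tendsto_tsum_sub_exp hZ hα hrec hG0 hB hGB).congr' ?_)
  refine hev m fun N y hN _ => ?_
  have hN1 : 0 < N := hm.trans hN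
  have hs := (hasSum_mbfComp_centred hθ hN hN1 y (hanti N hN1)).tsum_eq
  simp only [dif_pos hN]
  rw [← hs]
  simp only [Z, sum_range_zeroExt y fun z => z ^ 2]
  congr 3
  push_cast
  have : (θ : ℂ) ≠ 0 := by exact_mod_cast hθ.ne'
  field_simp

end
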